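/- Let n ≥ 3 be an integer, ψ a standard radial factor, α ∈ (0,1), and μ > 0. There exists a constant C > 0, depending only on n, α, μ, and ψ and independent of r₀, such that for every 0 < r₀ ≤ 1 the following holds: if W is a C^{2,α} function on {x : 0 < |x| ≤ r₀} with N^{2,α}_{μ,(n−2)/2}(W) < ∞, W(x) = 0 for all |x| = r₀, and F := L_ψ W satisfies N^{0,α}_{μ,(n+2)/2}(F) < ∞, then N^{2,α}_{μ,(n−2)/2}(W) ≤ C ( sup_{0<|x|≤r₀} |x|^{(n−2)/2−μ} |W(x)| + N^{0,α}_{μ,(n+2)/2}(F) ). (This is the weighted Schauder a priori estimate, stated with homogeneous boundary data.) -/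

import Mathlib

open scoped Topology ENNReal
open Metric Filter MeasureTheory

noncomputable section

abbrev E (n : ℕ) := EuclideanSpace ℝ (Fin n)

/-- Euclidean Laplacian via second iterated derivative in coordinate directions. -/
def lap (n : ℕ) (u : E n → ℝ) (x : E n) : ℝ :=
  ∑ i : Fin n, iteratedFDeriv ℝ 2 u x (fun _ => EuclideanSpace.single i 1)

/-- The Yamabe operator `M(u) = Δu + (n(n−2)/4) u^{(n+2)/(n−2)}`. -/
def yamabeOp (n : ℕ) (u : E n → ℝ) (x : E n) : ℝ :=
  lap n u x + ((n : ℝ) * ((n : ℝ) - 2)) / 4 * u x ^ (((n : ℝ) + 2) / ((n : ℝ) - 2))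

/-- A standard radial factor: smooth, positive, `< 1`, `T`-periodic solution of the
radial Yamabe ODE in cylindrical coordinates. -/
def IsStdRadial (n : ℕ) (ψ : ℝ → ℝ) (T : ℝ) : Prop :=
  ContDiff ℝ (⊤ : ℕ∞) ψ ∧ 0 < T ∧ Function.Periodic ψ T ∧ (∀ t, 0 < ψ t ∧ ψ t < 1) ∧
    ∀ t, deriv (deriv ψ) t - ((n : ℝ) - 2) ^ 2 / 4 * ψ t
        + ((n : ℝ) * ((n : ℝ) - 2)) / 4 * ψ t ^ (((n : ℝ) + 2) / ((n : ℝ) - 2)) = 0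

/-- The operator `L_{ψ,d}` acting on functions of `t ∈ ℝ`. -/
def odeOp (n : ℕ) (ψ : ℝ → ℝ) (d : ℕ) (η : ℝ → ℝ) (t : ℝ) : ℝ :=
  deriv (deriv η) t
    + (((n : ℝ) * ((n : ℝ) + 2)) / 4 * ψ t ^ ((4 : ℝ) / ((n : ℝ) - 2))
        - ((n : ℝ) - 2) ^ 2 / 4 - (d : ℝ) * ((d : ℝ) + (n : ℝ) - 2)) * η t

/-- `ρ` is the indicial root of degree `d`. -/
def IsIndicialRoot (n : ℕ) (ψ : ℝ → ℝ) (T : ℝ) (d : ℕ) (ρ : ℝ) : Prop :=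
  0 < ρ ∧ ∃ p : ℝ → ℝ, (∃ t, p t ≠ 0) ∧ Function.Periodic p T ∧
    ∀ t, odeOp n ψ d (fun s => Real.exp (-ρ * s) * p s) t = 0

/-- The index set `I(ψ)`. -/
def IndexSet (ρ : ℕ → ℝ) : Set ℝ :=
  { μ | ∃ D : ℕ, 1 ≤ D ∧ ∃ m : ℕ → ℕ,
      (∃ d, 1 ≤ d ∧ d ≤ D ∧ m d ≠ 0) ∧
      μ = ∑ d ∈ Finset.Icc 1 D, (m d : ℝ) * ρ d }

/-- The linearized Yamabe operator at `û_ψ`. -/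
def linYamabe (n : ℕ) (ψ : ℝ → ℝ) (W : E n → ℝ) (x : E n) : ℝ :=
  lap n W x + ((n : ℝ) * ((n : ℝ) + 2)) / 4 * ‖x‖ ^ (-2 : ℝ)
      * ψ (-Real.log ‖x‖) ^ ((4 : ℝ) / ((n : ℝ) - 2)) * W x

/-- Hölder seminorm (valued in `ℝ≥0∞`) of a function on a set. -/
def holderSemi {X F : Type*} [NormedAddCommGroup X] [NormedAddCommGroup F]
    (α : ℝ) (A : Set X) (G : X → F) : ℝ≥0∞ :=
  ⨆ (x) (_ : x ∈ A) (y) (_ : y ∈ A) (_ : x ≠ y),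
    ENNReal.ofReal (‖G x - G y‖ / ‖x - y‖ ^ α)

/-- Weighted `C^k` norm on the punctured ball `{0 < |x| ≤ r₀}`. -/
def weightedNk (n k : ℕ) (μ σ r₀ : ℝ) (W : E n → ℝ) : ℝ≥0∞ :=
  ∑ j ∈ Finset.range (k + 1), ⨆ (x : E n) (_ : 0 < ‖x‖ ∧ ‖x‖ ≤ r₀),
    ENNReal.ofReal (‖x‖ ^ (σ + (j : ℝ) - μ) * ‖iteratedFDeriv ℝ j W x‖)

/-- Weighted `C^{k,α}` norm on the punctured ball `{0 < |x| ≤ r₀}`. -/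
def weightedNka (n k : ℕ) (α μ σ r₀ : ℝ) (W : E n → ℝ) : ℝ≥0∞ :=
  weightedNk n k μ σ r₀ W +
    ⨆ (r : ℝ) (_ : 0 < r ∧ r ≤ r₀ / Real.exp 1),
      ENNReal.ofReal (r ^ (σ + (k : ℝ) + α - μ)) *
        holderSemi α {x : E n | r / Real.exp 1 ≤ ‖x‖ ∧ ‖x‖ ≤ Real.exp 1 * r}
          (iteratedFDeriv ℝ k W)



/-- second derivative -/
def D2 {n : ℕ} (u : E n → ℝ) (x : E n) : E n →L[ℝ] E n →L[ℝ] ℝ := fderiv ℝ (fderiv ℝ u) x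

def ee {n : ℕ} (i : Fin n) : E n := EuclideanSpace.single i 1

lemma two_le_top : (2 : WithTop ℕ∞) ≤ ((⊤ : ℕ∞) : WithTop ℕ∞) := by
  have : ((2 : ℕ∞) : WithTop ℕ∞) ≤ ((⊤ : ℕ∞) : WithTop ℕ∞) := WithTop.coe_le_coe.2 le_top
  exact this

lemma norm_ee {n : ℕ} (i : Fin n) : ‖(ee i : E n)‖ = 1 := by simp [ee]

lemma sum_inner_ee {n : ℕ} (x y : E n) : ∑ i : Fin n, inner ℝ x (ee i) * inner ℝ y (ee i) = inner ℝ x y := by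
  simp [ee, PiLp.inner_apply, mul_comm]

lemma lap_eq {n : ℕ} (u : E n → ℝ) (x : E n) : lap n u x = ∑ i, D2 u x (ee i) (ee i) := by
  simp [lap, D2, ee, iteratedFDeriv_two_apply]

lemma hasFDerivAt_D2 {n : ℕ} {u : E n → ℝ} {x : E n} (h : ContDiffAt ℝ 2 u x) :
    HasFDerivAt (fderiv ℝ u) (D2 u x) x := by
  have : ContDiffAt ℝ 1 (fderiv ℝ u) x := h.fderiv_right (by norm_num)
  exact (this.differentiableAt (by norm_num)).hasFDerivAt

lemma fderiv_dir {n : ℕ} {u : E n → ℝ} {x : E n} (h : ContDiffAt ℝ 2 u x) (e f : E n) :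
    fderiv ℝ (fun z => fderiv ℝ u z e) x f = D2 u x f e := by
  have := ((hasFDerivAt_D2 h).clm_apply (hasFDerivAt_const e x)).fderiv
  rw [this]; simp

lemma hasDerivAt_line {n : ℕ} (z e : E n) (τ : ℝ) : HasDerivAt (fun τ : ℝ => z + τ • e) e τ := by
  simpa using ((hasDerivAt_id τ).smul_const e).const_add z

/-- compute second derivative by lines -/
lemma D2_of_line {n : ℕ} {g : E n → ℝ} {z e : E n} (h : ContDiff ℝ 2 g) {G1 : ℝ → ℝ} {G2 : ℝ}
    (h1 : ∀ τ, HasDerivAt (fun τ : ℝ => g (z + τ • e)) (G1 τ) τ) (h2 : HasDerivAt G1 G2 0) :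
    D2 g z e e = G2 := by
  have hd : ∀ τ, fderiv ℝ g (z + τ • e) e = G1 τ := fun τ => by
    have := ((h.differentiable (by norm_num)) (z + τ • e)).hasFDerivAt.comp_hasDerivAt τ
      (hasDerivAt_line z e τ)
    exact this.unique (h1 τ)
  have h3 := (hasFDerivAt_D2 (h.contDiffAt (x := z))).clm_apply (hasFDerivAt_const e z)
  have hz : z = z + (0:ℝ) • e := by simp
  rw [hz] at h3
  have h4 := h3.comp_hasDerivAt (0:ℝ) (hasDerivAt_line z e 0)
  have h5 : HasDerivAt G1 (D2 g z e e) 0 := by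
    have h6 : (fun z => (fderiv ℝ g z) e) ∘ (fun τ : ℝ => z + τ • e) = G1 := by
      ext τ; exact hd τ
    rw [h6] at h4
    simpa using h4
  exact h5.unique h2

lemma lap_comp_quad {n : ℕ} {h : ℝ → ℝ} (hh : ContDiff ℝ (⊤ : ℕ∞) h) (a γ : ℝ) (β z : E n) :
    lap n (fun z => h (a + inner ℝ β z + γ * ‖z‖ ^ 2)) z =
      deriv (deriv h) (a + inner ℝ β z + γ * ‖z‖ ^ 2) * ‖β + (2 * γ) • z‖ ^ 2 +
        deriv h (a + inner ℝ β z + γ * ‖z‖ ^ 2) * (2 * n * γ) := by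
  have hh1 : ContDiff ℝ (⊤ : ℕ∞) (deriv h) := by
    have := hh.iterate_deriv 1; simpa using this
  have hc : ContDiff ℝ 2 (fun z : E n => h (a + inner ℝ β z + γ * ‖z‖ ^ 2)) := by
    refine (hh.of_le two_le_top).comp ?_
    refine ((contDiff_const.add (contDiff_const.inner ℝ contDiff_id)).add
      (contDiff_const.mul (contDiff_norm_sq ℝ)))
  have key : ∀ i : Fin n, D2 (fun z : E n => h (a + inner ℝ β z + γ * ‖z‖ ^ 2)) z (ee i) (ee i) =
      deriv (deriv h) (a + inner ℝ β z + γ * ‖z‖ ^ 2) * (inner ℝ (β + (2 * γ) • z) (ee i)) ^ 2 +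
        deriv h (a + inner ℝ β z + γ * ‖z‖ ^ 2) * (2 * γ) := by
    intro i
    have hq : ∀ τ : ℝ, a + inner ℝ β (z + τ • ee i) + γ * ‖z + τ • ee i‖ ^ 2 =
        (a + inner ℝ β z + γ * ‖z‖ ^ 2) + inner ℝ (β + (2 * γ) • z) (ee i) * τ + γ * τ ^ 2 := by
      intro τ
      rw [norm_add_sq_real, inner_add_right, inner_smul_right, inner_smul_right, norm_smul, norm_ee,
        inner_add_left, inner_smul_left]
      simp; ring
    set q := a + inner ℝ β z + γ * ‖z‖ ^ 2
    set l := inner ℝ (β + (2 * γ) • z) (ee i)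
    have hq1 : ∀ τ : ℝ, HasDerivAt (fun τ : ℝ => q + l * τ + γ * τ ^ 2) (l + γ * (2 * τ)) τ := by
      intro τ
      have h1 := (((hasDerivAt_id τ).const_mul l).const_add q)
      have h2 := (((hasDerivAt_id τ).pow 2).const_mul γ)
      have := h1.add h2
      refine (this.congr_deriv ?_)
      simp
    refine D2_of_line hc (G1 := fun τ => deriv h (q + l * τ + γ * τ ^ 2) * (l + γ * (2 * τ))) ?_ ?_
    · intro τ
      simp only [hq]
      exact (hh.differentiable (by simp) _).hasDerivAt.comp τ (hq1 τ)
    · have e1 := (hh1.differentiable (by simp) (q + l * 0 + γ * 0 ^ 2)).hasDerivAt.comp (0:ℝ) (hq1 0)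
      have e2 : HasDerivAt (fun τ : ℝ => l + γ * (2 * τ)) (γ * 2) 0 := by
        simpa using (((hasDerivAt_id (0:ℝ)).const_mul 2).const_mul γ).const_add l
      refine (e1.mul e2).congr_deriv ?_
      simp; ring
  rw [lap_eq, Finset.sum_congr rfl fun i _ => key i, Finset.sum_add_distrib, ← Finset.mul_sum]
  congr 1
  · rw [← real_inner_self_eq_norm_sq (β + (2 * γ) • z), ← sum_inner_ee (β + (2 * γ) • z) (β + (2 * γ) • z)]
    simp only [sq]
  · simp; ring

lemma fderiv_mul_apply {n : ℕ} {f g : E n → ℝ} {z : E n} (hf : DifferentiableAt ℝ f z)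
    (hg : DifferentiableAt ℝ g z) (e : E n) :
    fderiv ℝ (fun z => f z * g z) z e = f z * fderiv ℝ g z e + g z * fderiv ℝ f z e := by
  rw [fderiv_fun_mul hf hg]; simp

lemma lap_mul {n : ℕ} {f g : E n → ℝ} (hf : ContDiff ℝ 2 f) (hg : ContDiff ℝ 2 g) (z : E n) :
    lap n (fun z => f z * g z) z = f z * lap n g z + g z * lap n f z +
      2 * ∑ i, fderiv ℝ f z (ee i) * fderiv ℝ g z (ee i) := by
  have hfd := hf.differentiable (by norm_num)
  have hgd := hg.differentiable (by norm_num)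
  rw [lap_eq, lap_eq, lap_eq, Finset.mul_sum, Finset.mul_sum, Finset.mul_sum, ← Finset.sum_add_distrib,
    ← Finset.sum_add_distrib]
  refine Finset.sum_congr rfl fun i _ => ?_
  rw [← fderiv_dir (hf.mul hg).contDiffAt, ← fderiv_dir hf.contDiffAt, ← fderiv_dir hg.contDiffAt]
  have : (fun z => fderiv ℝ (fun z => f z * g z) z (ee i)) =
      fun z => f z * fderiv ℝ g z (ee i) + g z * fderiv ℝ f z (ee i) := by
    ext z; exact fderiv_mul_apply (hfd z) (hgd z) _
  rw [this]
  have hf1 : DifferentiableAt ℝ (fun z => fderiv ℝ f z (ee i)) z :=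
    ((hasFDerivAt_D2 hf.contDiffAt).clm_apply (hasFDerivAt_const _ z)).differentiableAt
  have hg1 : DifferentiableAt ℝ (fun z => fderiv ℝ g z (ee i)) z :=
    ((hasFDerivAt_D2 hg.contDiffAt).clm_apply (hasFDerivAt_const _ z)).differentiableAt
  rw [fderiv_fun_add ((hfd z).fun_mul hg1) ((hgd z).fun_mul hf1), add_apply,
    fderiv_mul_apply (hfd z) hg1, fderiv_mul_apply (hgd z) hf1]
  ring

lemma integrable_of_cont_supp {n : ℕ} {O K : Set (E n)} {f : E n → ℝ} (hK : IsCompact K) (hKO : K ⊆ O)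
    (hf : ContinuousOn f O) (hz : ∀ x, x ∉ K → f x = 0) : Integrable f := by
  have h1 : IntegrableOn f K := (hf.mono hKO).integrableOn_compact hK
  refine (integrableOn_iff_integrable_of_support_subset ?_).1 h1
  intro x hx
  by_contra h
  exact hx (hz x h)

lemma ibp_lap {n : ℕ} {O : Set (E n)} (hO : IsOpen O) {w v : E n → ℝ} (hw : ContDiffOn ℝ 2 w O)
    (hv : ContDiff ℝ 2 v) (hK : HasCompactSupport v) (hs : tsupport v ⊆ O) :
    ∫ z, w z * lap n v z = ∫ z, v z * lap n w z := by
  have hwc : ∀ x ∈ O, ContDiffAt ℝ 2 w x := fun x hx => (hw x hx).contDiffAt (hO.mem_nhds hx)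
  have c0 : ContinuousOn w O := hw.continuousOn
  have c1 : ContinuousOn (fderiv ℝ w) O := fun x hx =>
    ((hwc x hx).fderiv_right (m := 1) (by norm_num)).continuousAt.continuousWithinAt
  have c2 : ContinuousOn (D2 w) O := fun x hx =>
    (((hwc x hx).fderiv_right (m := 1) (by norm_num)).fderiv_right (m := 0)
      (by norm_num)).continuousAt.continuousWithinAt
  have d1 : Continuous (fderiv ℝ v) := (hv.fderiv_right (m := 1) (by norm_num)).continuous
  have d2 : Continuous (D2 v) :=
    ((hv.fderiv_right (m := 1) (by norm_num)).fderiv_right (m := 0) (by norm_num)).continuous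
  have z0 : ∀ x, x ∉ tsupport v → v x = 0 := fun x hx => image_eq_zero_of_notMem_tsupport hx
  have t1 : tsupport (fderiv ℝ v) ⊆ tsupport v := tsupport_fderiv_subset ℝ
  have t2 : tsupport (D2 v) ⊆ tsupport v := (tsupport_fderiv_subset ℝ).trans t1
  have z1 : ∀ x, x ∉ tsupport v → fderiv ℝ v x = 0 := fun x hx =>
    image_eq_zero_of_notMem_tsupport (fun h => hx (t1 h))
  have z2 : ∀ x, x ∉ tsupport v → D2 v x = 0 := fun x hx =>
    image_eq_zero_of_notMem_tsupport (fun h => hx (t2 h))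
  have e1 : ∀ i : Fin n, Integrable (fun z => w z * D2 v z (ee i) (ee i)) := fun i =>
    integrable_of_cont_supp hK hs (c0.mul ((d2.clm_apply continuous_const).clm_apply continuous_const).continuousOn)
      (fun x hx => by simp [z2 x hx])
  have e2 : ∀ i : Fin n, Integrable (fun z => v z * D2 w z (ee i) (ee i)) := fun i =>
    integrable_of_cont_supp hK hs (hv.continuous.continuousOn.mul
      ((c2.clm_apply continuousOn_const).clm_apply continuousOn_const))
      (fun x hx => by simp [z0 x hx])
  simp only [lap_eq, Finset.mul_sum]
  rw [integral_finsetSum _ fun i _ => e1 i, integral_finsetSum _ fun i _ => e2 i]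
  refine Finset.sum_congr rfl fun i _ => ?_
  have z1' : tsupport (fun z => fderiv ℝ v z (ee i)) ⊆ tsupport v := by
    refine closure_minimal ?_ (isClosed_tsupport v)
    intro x hx
    by_contra h
    exact hx (by simp [z1 x h])
  have f1 : ∀ x, fderiv ℝ (fun z => fderiv ℝ v z (ee i)) x (ee i) = D2 v x (ee i) (ee i) := fun x =>
    fderiv_dir hv.contDiffAt _ _
  have f2 : ∀ x ∈ O, fderiv ℝ (fun z => fderiv ℝ w z (ee i)) x (ee i) = D2 w x (ee i) (ee i) :=
    fun x hx => fderiv_dir (hwc x hx) _ _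
  have g1 : Integrable (fun z => fderiv ℝ w z (ee i) * fderiv ℝ v z (ee i)) :=
    integrable_of_cont_supp hK hs ((c1.clm_apply continuousOn_const).mul
      (d1.clm_apply continuous_const).continuousOn) (fun x hx => by simp [z1 x hx])
  have g2 : Integrable (fun z => w z * fderiv ℝ v z (ee i)) :=
    integrable_of_cont_supp hK hs (c0.mul
      (d1.clm_apply continuous_const).continuousOn) (fun x hx => by simp [z1 x hx])
  have g3 : Integrable (fun z => v z * fderiv ℝ w z (ee i)) :=
    integrable_of_cont_supp hK hs (hv.continuous.continuousOn.mul
      (c1.clm_apply continuousOn_const)) (fun x hx => by simp [z0 x hx])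
  have f3 : ∀ x, v x * fderiv ℝ (fun z => fderiv ℝ w z (ee i)) x (ee i) = v x * D2 w x (ee i) (ee i) := by
    intro x
    by_cases hx : x ∈ tsupport v
    · rw [f2 x (hs hx)]
    · simp [z0 x hx]
  have A := integral_mul_fderiv_eq_neg_fderiv_mul_of_integrable (μ := volume) (f := w)
    (g := fun z => fderiv ℝ v z (ee i)) (v := ee i) g1 (by simpa only [f1] using e1 i) g2
    (fun x hx => (hwc x (hs (z1' hx))).differentiableAt (by norm_num))
    (fun x _ => ((hasFDerivAt_D2 hv.contDiffAt).clm_apply (hasFDerivAt_const _ x)).differentiableAt)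
  have B := integral_mul_fderiv_eq_neg_fderiv_mul_of_integrable (μ := volume) (f := v)
    (g := fun z => fderiv ℝ w z (ee i)) (v := ee i) (by simpa only [mul_comm] using g1)
    (by simpa only [f3] using e2 i) g3
    (fun x hx => (hv.differentiable (by norm_num)) x)
    (fun x hx => ((hasFDerivAt_D2 (hwc x (hs hx))).clm_apply (hasFDerivAt_const _ x)).differentiableAt)
  simp only [f1] at A
  simp only [f3] at B
  rw [A, B]
  congr 2
  ext z; ring


lemma radial_bound {n : ℕ} {f : E n → ℝ} {z : E n} {R A : ℝ} (hz : z ≠ 0) (hzR : ‖z‖ < R)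
    (hc : ContinuousOn (fun τ : ℝ => f (τ • z)) (Set.Icc 1 (R / ‖z‖)))
    (hd : ∀ τ ∈ Set.Ico 1 (R / ‖z‖), DifferentiableAt ℝ f (τ • z) ∧ ‖fderiv ℝ f (τ • z)‖ ≤ A)
    (h0 : f ((R / ‖z‖) • z) = 0) : |f z| ≤ A * (R - ‖z‖) := by
  have hz0 : 0 < ‖z‖ := norm_pos_iff.2 hz
  have h1 : 1 ≤ R / ‖z‖ := by rw [le_div_iff₀ hz0]; linarith
  have key := norm_image_sub_le_of_norm_deriv_right_le_segment (f := fun τ : ℝ => f (τ • z))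
    (f' := fun τ => fderiv ℝ f (τ • z) z) (C := A * ‖z‖) hc (fun τ hτ => by
      have h2 : HasDerivAt (fun τ : ℝ => τ • z) z τ := by
        simpa using (hasDerivAt_id τ).smul_const z
      exact ((hd τ hτ).1.hasFDerivAt.comp_hasDerivAt τ h2).hasDerivWithinAt)
    (fun τ hτ => ((fderiv ℝ f (τ • z)).le_opNorm z).trans
      (mul_le_mul_of_nonneg_right (hd τ hτ).2 (norm_nonneg z))) (R / ‖z‖) ⟨h1, le_rfl⟩
  simp only [h0, one_smul, zero_sub, norm_neg, Real.norm_eq_abs] at key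
  refine key.trans (le_of_eq ?_)
  field_simp

def thet (y : ℝ) : ℝ := Real.smoothTransition (y - 1)

lemma thet_smooth : ContDiff ℝ (⊤ : ℕ∞) thet :=
  Real.smoothTransition.contDiff.comp (contDiff_id.sub contDiff_const)

lemma thet_zero {y : ℝ} (h : y ≤ 1) : thet y = 0 := Real.smoothTransition.zero_of_nonpos (by linarith)
lemma thet_one {y : ℝ} (h : 2 ≤ y) : thet y = 1 := Real.smoothTransition.one_of_one_le (by linarith)
lemma thet_abs (y : ℝ) : |thet y| ≤ 1 := by
  unfold thet
  rw [abs_of_nonneg (Real.smoothTransition.nonneg _)]; exact Real.smoothTransition.le_one _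
lemma thet_d1 {y : ℝ} (h : 2 < y) : deriv thet y = 0 := by
  have : thet =ᶠ[𝓝 y] fun _ => (1:ℝ) := by
    filter_upwards [Ioi_mem_nhds h] with a ha using thet_one (le_of_lt ha)
  rw [this.deriv_eq]; simp
lemma thet_d2 {y : ℝ} (h : 2 < y) : deriv (deriv thet) y = 0 := by
  have : deriv thet =ᶠ[𝓝 y] fun _ => (0:ℝ) := by
    filter_upwards [Ioi_mem_nhds h] with a ha using thet_d1 ha
  rw [this.deriv_eq]; simp

lemma smooth_deriv {h : ℝ → ℝ} (hh : ContDiff ℝ (⊤ : ℕ∞) h) : ContDiff ℝ (⊤ : ℕ∞) (deriv h) := by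
  have := hh.iterate_deriv 1; simpa using this

lemma bdd_of_zero {f : ℝ → ℝ} (hf : Continuous f) {N : ℝ} (h : ∀ y, N < y → f y = 0) :
    ∃ M, 0 ≤ M ∧ ∀ y, 0 ≤ y → |f y| ≤ M := by
  obtain ⟨M, hM⟩ := (isCompact_Icc (a := (0:ℝ)) (b := N)).exists_bound_of_continuousOn hf.continuousOn
  refine ⟨|M|, abs_nonneg _, fun y hy => ?_⟩
  by_cases hN : N < y
  · rw [h y hN]; simp
  · exact (hM y ⟨hy, not_lt.1 hN⟩).trans (le_abs_self _)

lemma thet_bd : ∃ M, 0 ≤ M ∧ ∀ y, 0 ≤ y → |y * deriv thet y| ≤ M ∧ |y ^ 2 * deriv thet y| ≤ M ∧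
    |y ^ 2 * deriv (deriv thet) y| ≤ M := by
  have c1 := (smooth_deriv thet_smooth).continuous
  have c2 := (smooth_deriv (smooth_deriv thet_smooth)).continuous
  obtain ⟨M1, p1, h1⟩ := bdd_of_zero (f := fun y => y * deriv thet y) (by fun_prop) (N := 2)
    (fun y hy => by simp [thet_d1 hy])
  obtain ⟨M2, p2, h2⟩ := bdd_of_zero (f := fun y => y ^ 2 * deriv thet y) (by fun_prop) (N := 2)
    (fun y hy => by simp [thet_d1 hy])
  obtain ⟨M3, p3, h3⟩ := bdd_of_zero (f := fun y => y ^ 2 * deriv (deriv thet) y) (by fun_prop) (N := 2)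
    (fun y hy => by simp [thet_d2 hy])
  exact ⟨M1 + M2 + M3, by positivity, fun y hy =>
    ⟨by linarith [h1 y hy], by linarith [h2 y hy], by linarith [h3 y hy]⟩⟩

def eta (n : ℕ) (R ε : ℝ) (z : E n) : ℝ := thet (R ^ 2 / ε + inner ℝ 0 z + (-1 / ε) * ‖z‖ ^ 2)

lemma eta_arg {n : ℕ} (R ε : ℝ) (z : E n) :
    R ^ 2 / ε + inner ℝ 0 z + (-1 / ε) * ‖z‖ ^ 2 = (R ^ 2 - ‖z‖ ^ 2) / ε := by
  rw [inner_zero_left]; ring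

lemma eta_eq {n : ℕ} (R ε : ℝ) (z : E n) : eta n R ε z = thet ((R ^ 2 - ‖z‖ ^ 2) / ε) := by
  rw [eta, eta_arg]

lemma eta_smooth (n : ℕ) (R ε : ℝ) : ContDiff ℝ (⊤ : ℕ∞) (eta n R ε) :=
  thet_smooth.comp ((contDiff_const.add (contDiff_const.inner ℝ contDiff_id)).add
      (contDiff_const.mul (contDiff_norm_sq ℝ)))

lemma eta_lap {n : ℕ} (R ε : ℝ) (z : E n) : lap n (eta n R ε) z =
    deriv (deriv thet) ((R ^ 2 - ‖z‖ ^ 2) / ε) * (4 * ‖z‖ ^ 2 / ε ^ 2) +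
    deriv thet ((R ^ 2 - ‖z‖ ^ 2) / ε) * (-2 * n / ε) := by
  have := lap_comp_quad thet_smooth (R ^ 2 / ε) (-1 / ε) (0 : E n) z
  rw [eta_arg] at this
  have h2 : eta n R ε = fun z => thet (R ^ 2 / ε + inner ℝ 0 z + (-1 / ε) * ‖z‖ ^ 2) := rfl
  rw [h2, this]
  rw [zero_add, norm_smul, mul_pow, Real.norm_eq_abs, sq_abs]
  ring

lemma eta_fderiv {n : ℕ} (R ε : ℝ) (z e : E n) : fderiv ℝ (eta n R ε) z e =
    deriv thet ((R ^ 2 - ‖z‖ ^ 2) / ε) * (-2 / ε * inner ℝ z e) := by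
  have h2 : eta n R ε = fun z => thet ((R ^ 2 - ‖z‖ ^ 2) / ε) := by ext z; exact eta_eq R ε z
  have h3 : HasFDerivAt (fun z : E n => (R ^ 2 - ‖z‖ ^ 2) / ε)
      (ε⁻¹ • (-((2:ℕ) • (innerSL ℝ z : E n →L[ℝ] ℝ)))) z := by
    have := ((hasStrictFDerivAt_norm_sq z).hasFDerivAt.const_sub (R ^ 2)).const_smul ε⁻¹
    refine this.congr_of_eventuallyEq (Eventually.of_forall fun y => ?_)
    simp [div_eq_inv_mul]
  have h4 := (thet_smooth.differentiable (by simp) ((R ^ 2 - ‖z‖ ^ 2) / ε)).hasDerivAt.comp_hasFDerivAt z h3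
  have h5 := h4.fderiv
  rw [h2]
  change fderiv ℝ (thet ∘ fun z : E n => (R ^ 2 - ‖z‖ ^ 2) / ε) z e = _
  rw [h5]
  simp
  ring

lemma cont_D2 {n : ℕ} {w : E n → ℝ} {O : Set (E n)} (hO : IsOpen O) (hw : ContDiffOn ℝ 2 w O) :
    ContinuousOn (D2 w) O := fun x hx =>
  ((((hw x hx).contDiffAt (hO.mem_nhds hx)).fderiv_right (m := 1) (by norm_num)).fderiv_right (m := 0)
      (by norm_num)).continuousAt.continuousWithinAt

lemma cont_lap {n : ℕ} {w : E n → ℝ} {O : Set (E n)} (hO : IsOpen O) (hw : ContDiffOn ℝ 2 w O) :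
    ContinuousOn (lap n w) O := by
  have : lap n w = fun z => ∑ i, D2 w z (ee i) (ee i) := by ext z; exact lap_eq w z
  rw [this]
  exact continuousOn_finsetSum _ fun i _ =>
    ((cont_D2 hO hw).clm_apply continuousOn_const).clm_apply continuousOn_const

lemma smooth_lip {n : ℕ} {R : ℝ} (hR : 0 < R) {ζ : E n → ℝ} (hζ : ContDiff ℝ 2 ζ)
    (h0 : ∀ z, ‖z‖ = R → ζ z = 0) : ∃ C, 0 ≤ C ∧ (∀ z, ‖z‖ < R → |ζ z| ≤ C * (R - ‖z‖)) ∧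
      (∀ z, ‖z‖ < R → ‖fderiv ℝ ζ z‖ ≤ C) ∧ (∀ z, ‖z‖ < R → |lap n ζ z| ≤ C) := by
  have cd : Continuous (fderiv ℝ ζ) := hζ.continuous_fderiv (by norm_num)
  have cl : ContinuousOn (lap n ζ) Set.univ := cont_lap isOpen_univ hζ.contDiffOn
  obtain ⟨Z0, hZ0⟩ := (isCompact_closedBall (0 : E n) R).exists_bound_of_continuousOn hζ.continuous.continuousOn
  obtain ⟨Z1, hZ1⟩ := (isCompact_closedBall (0 : E n) R).exists_bound_of_continuousOn cd.continuousOn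
  obtain ⟨Z2, hZ2⟩ := (isCompact_closedBall (0 : E n) R).exists_bound_of_continuousOn (cl.mono (Set.subset_univ _))
  have m0 : (0 : E n) ∈ closedBall (0 : E n) R := by simp [hR.le]
  have p0 : 0 ≤ Z0 := (norm_nonneg _).trans (hZ0 0 m0)
  have p1 : 0 ≤ Z1 := (norm_nonneg _).trans (hZ1 0 m0)
  have p2 : 0 ≤ Z2 := (norm_nonneg _).trans (hZ2 0 m0)
  refine ⟨Z0 / R + Z1 + Z2, by positivity, fun z hz => ?_, fun z hz => ?_, fun z hz => ?_⟩
  · by_cases hz0 : z = 0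
    · subst hz0
      have h1 := hZ0 0 m0
      rw [Real.norm_eq_abs] at h1
      rw [norm_zero, sub_zero]
      calc |ζ 0| ≤ Z0 := h1
        _ = Z0 / R * R := by field_simp
        _ ≤ _ := by gcongr; linarith
    · have hp : 0 < ‖z‖ := norm_pos_iff.2 hz0
      have := radial_bound (f := ζ) (A := Z1) hz0 hz (hζ.continuous.comp (by fun_prop)).continuousOn
        (fun τ hτ => ⟨hζ.differentiable (by norm_num) _, hZ1 _ (by
          rw [mem_closedBall_zero_iff, norm_smul, Real.norm_eq_abs, abs_of_pos (by linarith [hτ.1])]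
          have := hτ.2
          rw [lt_div_iff₀ hp] at this; exact this.le)⟩)
        (h0 _ (by rw [norm_smul, Real.norm_eq_abs, abs_of_pos (by positivity)]; field_simp))
      refine this.trans ?_
      have : 0 ≤ Z0 / R := by positivity
      gcongr
      linarith
  · have := hZ1 z (by simpa using hz.le)
    have : 0 ≤ Z0 / R := by positivity
    linarith
  · have := hZ2 z (by simpa using hz.le)
    have : 0 ≤ Z0 / R := by positivity
    rw [Real.norm_eq_abs] at *
    linarith


lemma lap_zero_of_notMem {n : ℕ} {v : E n → ℝ} {z : E n} (hz : z ∉ tsupport v) : lap n v z = 0 := by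
  have h1 : z ∉ tsupport (fderiv ℝ (fderiv ℝ v)) := fun h =>
    hz (tsupport_fderiv_subset ℝ (tsupport_fderiv_subset ℝ h))
  rw [lap_eq]
  refine Finset.sum_eq_zero fun i _ => ?_
  rw [D2, image_eq_zero_of_notMem_tsupport h1]; simp

lemma lap_eta_mul {n : ℕ} (R ε : ℝ) {ζ : E n → ℝ} (hζ : ContDiff ℝ 2 ζ) (z : E n) :
    lap n (fun z => eta n R ε z * ζ z) z = thet ((R ^ 2 - ‖z‖ ^ 2) / ε) * lap n ζ z +
      ζ z * (deriv (deriv thet) ((R ^ 2 - ‖z‖ ^ 2) / ε) * (4 * ‖z‖ ^ 2 / ε ^ 2) +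
    deriv thet ((R ^ 2 - ‖z‖ ^ 2) / ε) * (-2 * n / ε)) +
      2 * ∑ i, deriv thet ((R ^ 2 - ‖z‖ ^ 2) / ε) * (-2 / ε * inner ℝ z (ee i)) * fderiv ℝ ζ z (ee i) := by
  rw [lap_mul ((eta_smooth n R ε).of_le two_le_top) hζ, eta_lap, eta_eq]
  simp only [eta_fderiv]

lemma eta_bound {n : ℕ} {R : ℝ} (hR : 0 < R) {ζ : E n → ℝ} (hζ : ContDiff ℝ 2 ζ) {C C1 M ε : ℝ}
    (hC : 0 ≤ C) (hC1 : 0 ≤ C1) (hM : 0 ≤ M) (hε : 0 < ε) (hε1 : ε ≤ 1) {z : E n} (hz : ‖z‖ < R)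
    {w : ℝ} (hw : |w| ≤ C1 * (R - ‖z‖)) (h1 : |ζ z| ≤ C * (R - ‖z‖)) (h2 : ‖fderiv ℝ ζ z‖ ≤ C)
    (h3 : |lap n ζ z| ≤ C)
    (hth : ∀ y, 0 ≤ y → |y * deriv thet y| ≤ M ∧ |y ^ 2 * deriv thet y| ≤ M ∧
    |y ^ 2 * deriv (deriv thet) y| ≤ M) :
    |w * lap n (fun z => eta n R ε z * ζ z) z| ≤ C1 * R * C + C1 * C * (4 * M + 2 * n * M / R ^ 2)
      + 4 * n * C1 * M * C := by
  rw [lap_eta_mul R ε hζ]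
  set q := (R ^ 2 - ‖z‖ ^ 2) / ε with hq
  have hz0 := norm_nonneg z
  have hq0 : 0 ≤ q := by
    apply div_nonneg _ hε.le
    nlinarith
  have hd : 0 < R - ‖z‖ := by linarith
  have hdq : R - ‖z‖ ≤ ε * q / R := by
    rw [le_div_iff₀ hR, hq]
    field_simp
    nlinarith
  obtain ⟨t1, t2, t3⟩ := hth q hq0
  rw [abs_mul] at t1 t2 t3
  rw [abs_of_nonneg hq0] at t1
  rw [abs_of_nonneg (by positivity)] at t2 t3
  have hw' : |w| ≤ C1 * (ε * q / R) := hw.trans (by gcongr)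
  have hw'' : |w| ≤ C1 * R := hw.trans (by gcongr; linarith)
  have hζ' : |ζ z| ≤ C * (ε * q / R) := h1.trans (by gcongr)
  have b1 : |w * (thet q * lap n ζ z)| ≤ C1 * R * C := by
    rw [abs_mul, abs_mul]
    calc _ ≤ C1 * R * (1 * C) := by gcongr; exact thet_abs q
      _ = _ := by ring
  have b2 : |w * (ζ z * (deriv (deriv thet) q * (4 * ‖z‖ ^ 2 / ε ^ 2) + deriv thet q * (-2 * n / ε)))| ≤
      C1 * C * (4 * M + 2 * n * M / R ^ 2) := by
    rw [abs_mul, abs_mul]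
    have c1 : |deriv (deriv thet) q * (4 * ‖z‖ ^ 2 / ε ^ 2) + deriv thet q * (-2 * n / ε)| ≤
      |deriv (deriv thet) q| * (4 * R ^ 2 / ε ^ 2) + |deriv thet q| * (2 * n / ε ^ 2) := by
      refine (abs_add_le _ _).trans ?_
      rw [abs_mul, abs_mul, abs_of_nonneg (by positivity : 0 ≤ 4 * ‖z‖ ^ 2 / ε ^ 2)]
      have : |-2 * (n:ℝ) / ε| = 2 * n / ε := by
        rw [abs_div, abs_mul, abs_of_pos hε]; simp
      rw [this]
      have : ε ^ 2 ≤ ε := by nlinarith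
      gcongr
    calc _ ≤ C1 * (ε * q / R) * (C * (ε * q / R) * (|deriv (deriv thet) q| * (4 * R ^ 2 / ε ^ 2) + |deriv thet q| * (2 * n / ε ^ 2))) := by gcongr
      _ = C1 * C * (4 * (q ^ 2 * |deriv (deriv thet) q|) + 2 * n * (q ^ 2 * |deriv thet q|) / R ^ 2) := by
        field_simp
      _ ≤ _ := by gcongr
  have b3 : |w * (2 * ∑ i, deriv thet q * (-2 / ε * inner ℝ z (ee i)) * fderiv ℝ ζ z (ee i))| ≤
      4 * n * C1 * M * C := by
    rw [abs_mul, abs_mul, abs_two]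
    have c1 : |∑ i, deriv thet q * (-2 / ε * inner ℝ z (ee i)) * fderiv ℝ ζ z (ee i)| ≤
        ∑ i : Fin n, |deriv thet q| * (2 / ε * R) * C := by
      refine (Finset.abs_sum_le_sum_abs _ _).trans (Finset.sum_le_sum fun i _ => ?_)
      rw [abs_mul, abs_mul, abs_mul]
      have e1 : |-2 / ε| = 2 / ε := by rw [abs_div, abs_of_pos hε]; simp
      have e2 : |inner ℝ z (ee i)| ≤ R := by
        have := abs_real_inner_le_norm z (ee i)
        rw [norm_ee, mul_one] at this; linarith
      have e3 : |fderiv ℝ ζ z (ee i)| ≤ C := by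
        have := (fderiv ℝ ζ z).le_opNorm (ee i)
        rw [norm_ee, mul_one] at this; exact this.trans h2
      rw [e1]; gcongr
    rw [Finset.sum_const, Finset.card_univ, Fintype.card_fin, nsmul_eq_mul] at c1
    calc _ ≤ C1 * (ε * q / R) * (2 * (n * (|deriv thet q| * (2 / ε * R) * C))) := by gcongr
      _ = 4 * n * C1 * (q * |deriv thet q|) * C := by field_simp; ring
      _ ≤ _ := by gcongr
  rw [mul_add, mul_add]
  refine (abs_add_le _ _).trans (add_le_add ((abs_add_le _ _).trans (add_le_add b1 b2)) b3)

lemma green {n : ℕ} {R : ℝ} (hR : 0 < R) {O : Set (E n)} (hO : IsOpen O) (hOR : O ⊆ ball 0 R)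
    {w : E n → ℝ} (hw : ContDiffOn ℝ 2 w O) {C1 g : ℝ} (hC1 : 0 ≤ C1)
    (hw0 : ∀ z ∈ O, |w z| ≤ C1 * (R - ‖z‖))
    (hg : ∀ z ∈ O, |lap n w z| ≤ g) {ζ : E n → ℝ} (hζ : ContDiff ℝ 2 ζ) (h0 : ∀ z, ‖z‖ = R → ζ z = 0)
    {K : Set (E n)} (hK : IsClosed K) (hKO : K ∩ ball 0 R ⊆ O)
    (hζK : ∀ z, z ∈ ball (0 : E n) R → z ∉ K → ζ z = 0) :
    ∫ z in O, w z * lap n ζ z = ∫ z in O, ζ z * lap n w z := by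
  obtain ⟨C, hC, hb1, hb2, hb3⟩ := smooth_lip hR hζ h0
  obtain ⟨M, hM, hth⟩ := thet_bd
  have hvs : ∀ ε, ContDiff ℝ 2 (fun z => eta n R ε z * ζ z) := fun ε =>
    ((eta_smooth n R ε).of_le two_le_top).mul hζ
  have key : ∀ ε, 0 < ε → ∫ z in O, w z * lap n (fun z => eta n R ε z * ζ z) z =
      ∫ z in O, (eta n R ε z * ζ z) * lap n w z := by
    intro ε hε
    set S := K ∩ {z : E n | ‖z‖ ^ 2 ≤ R ^ 2 - ε} with hS
    have hSb : S ⊆ ball 0 R := by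
      rintro z ⟨_, hz⟩
      rw [mem_ball_zero_iff]
      simp only [Set.mem_setOf_eq] at hz
      nlinarith [norm_nonneg z]
    have hSc : IsClosed S := hK.inter (isClosed_le (by fun_prop) (by fun_prop))
    have hSO : S ⊆ O := fun z hz => hKO ⟨hz.1, hSb hz⟩
    have hcomp : IsCompact S := (isCompact_closedBall (0 : E n) R).of_isClosed_subset hSc
      (hSb.trans ball_subset_closedBall)
    have hsup : tsupport (fun z => eta n R ε z * ζ z) ⊆ S := by
      apply closure_minimal _ hSc
      intro z hz
      rw [Function.mem_support] at hz
      have e1 : eta n R ε z ≠ 0 := left_ne_zero_of_mul hz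
      have e2 : ζ z ≠ 0 := right_ne_zero_of_mul hz
      have e3 : ‖z‖ ^ 2 ≤ R ^ 2 - ε := by
        by_contra hcon
        push Not at hcon
        apply e1
        rw [eta_eq]
        apply thet_zero
        rw [div_le_one hε]; linarith
      have e4 : z ∈ ball (0 : E n) R := by
        rw [mem_ball_zero_iff]; nlinarith [norm_nonneg z]
      refine ⟨?_, e3⟩
      by_contra hcon
      exact e2 (hζK z e4 hcon)
    have := ibp_lap hO hw (hvs ε) (hcomp.of_isClosed_subset (isClosed_tsupport _) hsup) (hsup.trans hSO)
    rw [setIntegral_eq_integral_of_forall_compl_eq_zero, setIntegral_eq_integral_of_forall_compl_eq_zero, this]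
    · intro z hz
      have := image_eq_zero_of_notMem_tsupport (fun h => hz (hSO (hsup h)))
      rw [this, zero_mul]
    · intro z hz
      rw [lap_zero_of_notMem (fun h => hz (hSO (hsup h))), mul_zero]
  have hfin : volume O < ⊤ := lt_of_le_of_lt (measure_mono hOR) measure_ball_lt_top
  have : IsFiniteMeasure (volume.restrict O) := ⟨by simpa using hfin⟩
  let ep : ℕ → ℝ := fun k => 1 / ((k : ℝ) + 1)
  have hep : ∀ k, 0 < ep k := fun k => by positivity
  have hep1 : ∀ k, ep k ≤ 1 := fun k => by
    simp only [ep]; rw [div_le_one (by positivity)]; linarith [(Nat.cast_nonneg k : (0:ℝ) ≤ k)]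
  have hev : ∀ z ∈ O, ∀ᶠ k in atTop, 2 < (R ^ 2 - ‖z‖ ^ 2) / ep k := by
    intro z hz
    have h1 : ‖z‖ < R := by simpa using hOR hz
    have h2 : 0 < R ^ 2 - ‖z‖ ^ 2 := by nlinarith [norm_nonneg z]
    obtain ⟨N, hN⟩ := exists_nat_gt (2 / (R ^ 2 - ‖z‖ ^ 2))
    filter_upwards [eventually_ge_atTop N] with k hk
    rw [div_lt_iff₀ h2] at hN
    have : (N:ℝ) ≤ k := by exact_mod_cast hk
    simp only [ep, div_div_eq_mul_div, div_one]
    nlinarith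
  have L1 : Tendsto (fun k => ∫ z in O, w z * lap n (fun z => eta n R (ep k) z * ζ z) z) atTop
      (𝓝 (∫ z in O, w z * lap n ζ z)) := by
    refine tendsto_integral_of_dominated_convergence (fun _ => C1 * R * C + C1 * C * (4 * M + 2 * n * M / R ^ 2)
      + 4 * n * C1 * M * C) ?_ (integrable_const _) ?_ ?_
    · intro k
      exact (hw.continuousOn.mul ((cont_lap isOpen_univ (hvs (ep k)).contDiffOn).mono (Set.subset_univ _))).aestronglyMeasurable hO.measurableSet
    · intro k
      filter_upwards [ae_restrict_mem hO.measurableSet] with z hz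
      have h1 : ‖z‖ < R := by simpa using hOR hz
      exact eta_bound hR hζ hC hC1 hM (hep k) (hep1 k) h1 (hw0 z hz) (hb1 z h1) (hb2 z h1) (hb3 z h1) hth
    · filter_upwards [ae_restrict_mem hO.measurableSet] with z hz
      refine tendsto_const_nhds.congr' ?_
      filter_upwards [hev z hz] with k hk
      rw [lap_eta_mul _ _ hζ, thet_one hk.le, thet_d1 hk, thet_d2 hk]
      simp
  have L2 : Tendsto (fun k => ∫ z in O, (eta n R (ep k) z * ζ z) * lap n w z) atTop
      (𝓝 (∫ z in O, ζ z * lap n w z)) := by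
    refine tendsto_integral_of_dominated_convergence (fun _ => C * R * g) ?_ (integrable_const _) ?_ ?_
    · intro k
      exact ((hvs (ep k)).continuous.continuousOn.mul (cont_lap hO hw)).aestronglyMeasurable hO.measurableSet
    · intro k
      filter_upwards [ae_restrict_mem hO.measurableSet] with z hz
      have h1 : ‖z‖ < R := by simpa using hOR hz
      rw [Real.norm_eq_abs, abs_mul, abs_mul]
      have e1 : |eta n R (ep k) z| ≤ 1 := by rw [eta_eq]; exact thet_abs _
      have e2 : |ζ z| ≤ C * R := (hb1 z h1).trans (by gcongr; linarith [norm_nonneg z])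
      calc _ ≤ 1 * (C * R) * g := by gcongr; exact hg z hz
        _ = _ := by ring
    · filter_upwards [ae_restrict_mem hO.measurableSet] with z hz
      refine tendsto_const_nhds.congr' ?_
      filter_upwards [hev z hz] with k hk
      rw [eta_eq, thet_one hk.le, one_mul]
  exact tendsto_nhds_unique L1 (L2.congr fun k => (key (ep k) (hep k)).symm)


def hfun (y : ℝ) : ℝ := Real.smoothTransition (1 - y)
def rhof (y : ℝ) : ℝ := -2 * deriv hfun y

lemma hfun_smooth : ContDiff ℝ (⊤ : ℕ∞) hfun :=
  Real.smoothTransition.contDiff.comp (contDiff_const.sub contDiff_id)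
lemma hfun_zero {y : ℝ} (h : 1 ≤ y) : hfun y = 0 := Real.smoothTransition.zero_of_nonpos (by linarith)
lemma hfun_abs (y : ℝ) : |hfun y| ≤ 1 := by
  unfold hfun
  rw [abs_of_nonneg (Real.smoothTransition.nonneg _)]; exact Real.smoothTransition.le_one _
lemma hfun_d1 {y : ℝ} (h : 1 < y) : deriv hfun y = 0 := by
  have : hfun =ᶠ[𝓝 y] fun _ => (0:ℝ) := by
    filter_upwards [Ioi_mem_nhds h] with a ha using hfun_zero (le_of_lt ha)
  rw [this.deriv_eq]; simp
lemma hfun_d2 {y : ℝ} (h : 1 < y) : deriv (deriv hfun) y = 0 := by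
  have : deriv hfun =ᶠ[𝓝 y] fun _ => (0:ℝ) := by
    filter_upwards [Ioi_mem_nhds h] with a ha using hfun_d1 ha
  rw [this.deriv_eq]; simp
lemma rhof_smooth : ContDiff ℝ (⊤ : ℕ∞) rhof := contDiff_const.mul (smooth_deriv hfun_smooth)
lemma rhof_zero {y : ℝ} (h : 1 < y) : rhof y = 0 := by simp [rhof, hfun_d1 h]
lemma rhof_nonneg (y : ℝ) : 0 ≤ rhof y := by
  have : Antitone hfun := fun a b hab => Real.smoothTransition.monotone (by linarith)
  have := this.deriv_nonpos (x := y)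
  unfold rhof; linarith
lemma rhof_ne : ∃ y, 0 < y ∧ rhof y ≠ 0 := by
  obtain ⟨y, hy, h⟩ := exists_deriv_eq_slope hfun (a := 0) (b := 1) one_pos
    hfun_smooth.continuous.continuousOn (hfun_smooth.differentiable (by simp)).differentiableOn
  refine ⟨y, hy.1, ?_⟩
  rw [rhof, h, hfun_zero le_rfl]
  simp [hfun]

def rho (n : ℕ) (z : E n) : ℝ := rhof (‖z‖ ^ 2)
lemma rho_smooth (n : ℕ) : ContDiff ℝ (⊤ : ℕ∞) (rho n) := rhof_smooth.comp (contDiff_norm_sq ℝ)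
lemma rho_zero {n : ℕ} {z : E n} (h : 1 < ‖z‖) : rho n z = 0 := rhof_zero (by nlinarith)
lemma rho_supp (n : ℕ) : HasCompactSupport (rho n) :=
  HasCompactSupport.intro (isCompact_closedBall 0 1) fun z hz => rho_zero (by simpa using hz)
def m0 (n : ℕ) : ℝ := ∫ z, rho n z
lemma m0_pos {n : ℕ} (hn : 0 < n) : 0 < m0 n := by
  obtain ⟨y, hy, h⟩ := rhof_ne
  refine (rho_smooth n).continuous.integral_pos_of_hasCompactSupport_nonneg_nonzero (rho_supp n)
    (fun z => rhof_nonneg _) (x := Real.sqrt y • ee ⟨0, hn⟩) ?_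
  unfold rho
  rw [norm_smul, norm_ee, mul_one, Real.norm_eq_abs, sq_abs, Real.sq_sqrt hy.le]
  exact h

/-- first kernel -/
def kap (n : ℕ) (s y : ℝ) : ℝ := rhof (y / s ^ 2) / s ^ n
def gk (n : ℕ) (s y : ℝ) : ℝ :=
  (2 * n * deriv hfun (y / s ^ 2) + 4 * (y / s ^ 2) * deriv (deriv hfun) (y / s ^ 2)) / s ^ (n + 1)
def phi (n : ℕ) (s y : ℝ) : ℝ := hfun (y / s ^ 2) * (s / s ^ n)

lemma kap_deriv (n : ℕ) {s : ℝ} (hs : 0 < s) (y : ℝ) : HasDerivAt (fun s => kap n s y) (gk n s y) s := by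
  have h1 : HasDerivAt rhof (-2 * deriv (deriv hfun) (y / s ^ 2)) (y / s ^ 2) :=
    (((smooth_deriv hfun_smooth).differentiable (by simp) _).hasDerivAt).const_mul (-2)
  have h2 : HasDerivAt (fun s : ℝ => y / s ^ 2) (-(2 * y) / s ^ 3) s := by
    have := ((hasDerivAt_pow 2 s).inv (by positivity)).const_mul y
    refine this.congr_deriv ?_ |>.congr_of_eventuallyEq (Eventually.of_forall fun a => by simp [div_eq_mul_inv])
    push_cast; field_simp
  have h3 := (h1.comp s h2).div (hasDerivAt_pow n s) (by positivity)
  refine h3.congr_deriv ?_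
  simp only [gk, rhof, Function.comp]
  rcases Nat.eq_zero_or_pos n with h | h
  · subst h; simp; field_simp; ring
  · obtain ⟨k, rfl⟩ := Nat.exists_eq_succ_of_ne_zero h.ne'
    simp only [Nat.succ_eq_add_one, Nat.add_sub_cancel]
    field_simp
    push_cast
    ring

lemma gk_bound (n : ℕ) : ∃ M, 0 ≤ M ∧ ∀ s, 0 < s → ∀ y, 0 ≤ y → |gk n s y| ≤ M / s ^ (n + 1) := by
  have c1 := (smooth_deriv hfun_smooth).continuous
  have c2 := (smooth_deriv (smooth_deriv hfun_smooth)).continuous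
  obtain ⟨M, hM, h⟩ := bdd_of_zero (f := fun y => 2 * n * deriv hfun y + 4 * y * deriv (deriv hfun) y)
    (by fun_prop) (N := 1) (fun y hy => by simp [hfun_d1 hy, hfun_d2 hy])
  refine ⟨M, hM, fun s hs y hy => ?_⟩
  unfold gk
  rw [abs_div, abs_of_pos (by positivity : 0 < s ^ (n + 1))]
  gcongr
  exact h _ (by positivity)

lemma kap_bound (n : ℕ) : ∃ M, 0 ≤ M ∧ ∀ s, 0 < s → ∀ y, 0 ≤ y → |kap n s y| ≤ M / s ^ n := by
  obtain ⟨M, hM, h⟩ := bdd_of_zero rhof_smooth.continuous (N := 1) (fun y hy => rhof_zero hy)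
  refine ⟨M, hM, fun s hs y hy => ?_⟩
  unfold kap
  rw [abs_div, abs_of_pos (by positivity : 0 < s ^ n)]
  gcongr
  exact h _ (by positivity)

def bq {n : ℕ} (R : ℝ) (x z : E n) : ℝ := R ^ 2 - 2 * inner ℝ x z + ‖x‖ ^ 2 / R ^ 2 * ‖z‖ ^ 2

lemma bq_eq {n : ℕ} {R : ℝ} (hR : 0 < R) (x z : E n) :
    bq R x z = (R ^ 2 - ‖x‖ ^ 2) * (R ^ 2 - ‖z‖ ^ 2) / R ^ 2 + ‖z - x‖ ^ 2 := by
  rw [bq, @norm_sub_sq_real, real_inner_comm]; field_simp; ring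

lemma bq_ge {n : ℕ} {R : ℝ} (hR : 0 < R) {x z : E n} (hx : ‖x‖ < R) (hz : ‖z‖ < R) :
    ‖z - x‖ ^ 2 ≤ bq R x z := by
  rw [bq_eq hR]
  have h1 : 0 ≤ R ^ 2 - ‖x‖ ^ 2 := by nlinarith [norm_nonneg x]
  have h2 : 0 ≤ R ^ 2 - ‖z‖ ^ 2 := by nlinarith [norm_nonneg z]
  have : 0 ≤ (R ^ 2 - ‖x‖ ^ 2) * (R ^ 2 - ‖z‖ ^ 2) / R ^ 2 := by positivity
  linarith

lemma bq_ge' {n : ℕ} {R : ℝ} (hR : 0 < R) {x z : E n} (hx : ‖x‖ < R) (hz : ‖z‖ < R) :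
    (R - ‖x‖) ^ 2 ≤ bq R x z := by
  have h1 := real_inner_le_norm x z
  have h2 : bq R x z ≥ (R - ‖x‖ * ‖z‖ / R) ^ 2 := by
    have : (R - ‖x‖ * ‖z‖ / R) ^ 2 = R ^ 2 - 2 * (‖x‖ * ‖z‖) + ‖x‖ ^ 2 / R ^ 2 * ‖z‖ ^ 2 := by
      field_simp; ring
    rw [this, bq]; linarith
  have h3 : ‖x‖ * ‖z‖ / R ≤ ‖x‖ := by
    rw [div_le_iff₀ hR]; have := norm_nonneg x; gcongr
  refine le_trans ?_ h2
  apply pow_le_pow_left₀ (by linarith); linarith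

def kD (n : ℕ) (R s : ℝ) (x z : E n) : ℝ := kap n s (‖z - x‖ ^ 2) - ‖x‖ ^ 2 / R ^ 2 * kap n s (bq R x z)
def gD (n : ℕ) (R s : ℝ) (x z : E n) : ℝ := gk n s (‖z - x‖ ^ 2) - ‖x‖ ^ 2 / R ^ 2 * gk n s (bq R x z)
def phiD (n : ℕ) (R s : ℝ) (x z : E n) : ℝ := phi n s (‖z - x‖ ^ 2) - phi n s (bq R x z)

lemma norm_sub_quad {n : ℕ} (s : ℝ) (x z : E n) : ‖z - x‖ ^ 2 / s ^ 2 =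
    ‖x‖ ^ 2 / s ^ 2 + inner ℝ ((-2 / s ^ 2) • x) z + 1 / s ^ 2 * ‖z‖ ^ 2 := by
  rw [@norm_sub_sq_real, real_inner_smul_left, real_inner_comm]; ring

lemma bq_quad {n : ℕ} (R s : ℝ) (x z : E n) : bq R x z / s ^ 2 =
    R ^ 2 / s ^ 2 + inner ℝ ((-2 / s ^ 2) • x) z + (‖x‖ ^ 2 / R ^ 2 / s ^ 2) * ‖z‖ ^ 2 := by
  rw [bq, real_inner_smul_left]; ring

lemma quad_smooth {n : ℕ} {h : ℝ → ℝ} (hh : ContDiff ℝ (⊤ : ℕ∞) h) (a γ c : ℝ) (β : E n) :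
    ContDiff ℝ 2 (fun z : E n => h (a + inner ℝ β z + γ * ‖z‖ ^ 2) * c) :=
  ((hh.comp ((contDiff_const.add (contDiff_const.inner ℝ contDiff_id)).add
      (contDiff_const.mul (contDiff_norm_sq ℝ)))).mul contDiff_const).of_le two_le_top

lemma lap_sub {n : ℕ} {f g : E n → ℝ} (hf : ContDiff ℝ 2 f) (hg : ContDiff ℝ 2 g) (z : E n) :
    lap n (fun z => f z - g z) z = lap n f z - lap n g z := by
  have e : fderiv ℝ (fun z => f z - g z) = fun z => fderiv ℝ f z - fderiv ℝ g z := by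
    ext1 z
    exact fderiv_fun_sub (hf.differentiable (by norm_num) z) (hg.differentiable (by norm_num) z)
  simp only [lap_eq, ← Finset.sum_sub_distrib]
  refine Finset.sum_congr rfl fun i _ => ?_
  unfold D2
  rw [e, fderiv_fun_sub (hasFDerivAt_D2 hf.contDiffAt).differentiableAt (hasFDerivAt_D2 hg.contDiffAt).differentiableAt]
  rfl

lemma lap_mul_const {n : ℕ} {f : E n → ℝ} (hf : ContDiff ℝ 2 f) (c : ℝ) (z : E n) :
    lap n (fun z => f z * c) z = lap n f z * c := by
  have := lap_mul hf (contDiff_const (c := c)) z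
  rw [this]
  have h0 : lap n (fun _ => c) z = 0 := by
    rw [lap_eq]; refine Finset.sum_eq_zero fun i _ => ?_
    unfold D2; simp
  rw [h0]; simp [mul_comm]

lemma phiD_smooth {n : ℕ} (R s : ℝ) (x : E n) : ContDiff ℝ 2 (phiD n R s x) := by
  unfold phiD phi
  simp only [norm_sub_quad, bq_quad]
  exact (quad_smooth hfun_smooth _ _ _ _).sub (quad_smooth hfun_smooth _ _ _ _)

lemma phiD_lap {n : ℕ} {R s : ℝ} (hR : 0 < R) (hs : 0 < s) (x z : E n) :
    lap n (phiD n R s x) z = gD n R s x z := by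
  have e : phiD n R s x = fun z => hfun (‖x‖ ^ 2 / s ^ 2 + inner ℝ ((-2 / s ^ 2) • x) z + 1 / s ^ 2 * ‖z‖ ^ 2) * (s / s ^ n)
    - hfun (R ^ 2 / s ^ 2 + inner ℝ ((-2 / s ^ 2) • x) z + (‖x‖ ^ 2 / R ^ 2 / s ^ 2) * ‖z‖ ^ 2) * (s / s ^ n) := by
    unfold phiD phi
    simp only [norm_sub_quad, bq_quad]
  have q1 := fun (a γ : ℝ) (β : E n) => by simpa using quad_smooth hfun_smooth a γ 1 β
  rw [e, lap_sub (quad_smooth hfun_smooth _ _ _ _) (quad_smooth hfun_smooth _ _ _ _), lap_mul_const (q1 _ _ _),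
    lap_mul_const (q1 _ _ _), lap_comp_quad hfun_smooth, lap_comp_quad hfun_smooth, ← norm_sub_quad, ← bq_quad]
  have n1 : ‖(-2 / s ^ 2) • x + (2 * (1 / s ^ 2)) • z‖ ^ 2 = 4 * (‖z - x‖ ^ 2 / s ^ 2) / s ^ 2 := by
    have : (-2 / s ^ 2) • x + (2 * (1 / s ^ 2)) • z = (2 / s ^ 2) • (z - x) := by module
    rw [this, norm_smul, mul_pow, Real.norm_eq_abs, sq_abs]; ring
  have n2 : ‖(-2 / s ^ 2) • x + (2 * (‖x‖ ^ 2 / R ^ 2 / s ^ 2)) • z‖ ^ 2 =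
      ‖x‖ ^ 2 / R ^ 2 * (4 * (bq R x z / s ^ 2) / s ^ 2) := by
    have : (-2 / s ^ 2) • x + (2 * (‖x‖ ^ 2 / R ^ 2 / s ^ 2)) • z =
        (2 / s ^ 2) • ((‖x‖ ^ 2 / R ^ 2) • z - x) := by module
    rw [this, norm_smul, mul_pow, Real.norm_eq_abs, sq_abs, @norm_sub_sq_real, norm_smul, mul_pow,
      Real.norm_eq_abs, sq_abs, real_inner_smul_left, real_inner_comm, bq]
    field_simp
    ring
  rw [n1, n2]
  unfold gD gk
  field_simp
  ring


lemma kD_cont {n : ℕ} (R s : ℝ) (x : E n) : Continuous (kD n R s x) := by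
  have := rhof_smooth.continuous
  unfold kD kap bq; fun_prop

lemma gD_cont {n : ℕ} (R s : ℝ) (x : E n) : Continuous (gD n R s x) := by
  have c1 := (smooth_deriv hfun_smooth).continuous
  have c2 := (smooth_deriv (smooth_deriv hfun_smooth)).continuous
  unfold gD gk bq; fun_prop

lemma ratio_le {n : ℕ} {R : ℝ} (hR : 0 < R) {x : E n} (hx : ‖x‖ < R) : ‖x‖ ^ 2 / R ^ 2 ≤ 1 := by
  rw [div_le_one (by positivity)]; exact pow_le_pow_left₀ (norm_nonneg _) hx.le 2

lemma kernel_mv {n : ℕ} (hn : 0 < n) : ∃ C, 0 ≤ C ∧ ∀ (R : ℝ) (x0 : E n) (t : ℝ) (w : E n → ℝ) (C1 g : ℝ)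
    (x : E n), 0 < R → 0 < t → 0 ≤ C1 → 0 ≤ g → ContDiffOn ℝ 2 w (ball 0 R ∩ ball x0 (2 * t)) →
    (∀ z ∈ ball 0 R ∩ ball x0 (2 * t), |w z| ≤ C1 * (R - ‖z‖)) →
    (∀ z ∈ ball 0 R ∩ ball x0 (2 * t), |lap n w z| ≤ g) → x ∈ ball 0 R ∩ ball x0 t →
    |(∫ z in ball 0 R ∩ ball x0 (2 * t), kD n R t x z * w z) - m0 n * w x| ≤ C * t ^ 2 * g := by
  obtain ⟨Mg, hMg, hgk⟩ := gk_bound n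
  obtain ⟨Mk, hMk, hkap⟩ := kap_bound n
  set V := (volume (ball (0 : E n) 1)).toReal with hV
  refine ⟨2 * V, by positivity, fun R x0 t w C1 g x hR ht hC1 hg hw hw0 hwg hx => ?_⟩
  set O := ball (0 : E n) R ∩ ball x0 (2 * t) with hO
  have oO : IsOpen O := isOpen_ball.inter isOpen_ball
  have mO : MeasurableSet O := oO.measurableSet
  have hOR : O ⊆ ball 0 R := Set.inter_subset_left
  have hxR : ‖x‖ < R := by simpa using hx.1
  have hfin : volume O < ⊤ := lt_of_le_of_lt (measure_mono hOR) measure_ball_lt_top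
  have : IsFiniteMeasure (volume.restrict O) := ⟨by simpa using hfin⟩
  have hOn : ∀ z ∈ O, ‖z‖ < R := fun z hz => by simpa using hOR hz
  have hwB : ∀ z ∈ O, |w z| ≤ C1 * R := fun z hz => (hw0 z hz).trans (by gcongr; linarith [norm_nonneg z])
  have hbq : ∀ z ∈ O, 0 ≤ bq R x z := fun z hz => le_trans (by positivity) (bq_ge hR hxR (hOn z hz))
  have hk0 : 0 ≤ ‖x‖ ^ 2 / R ^ 2 := by positivity
  have hk1 := ratio_le hR hxR
  have kDb : ∀ s, 0 < s → ∀ z ∈ O, |kD n R s x z| ≤ 2 * Mk / s ^ n := fun s hs z hz => by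
    unfold kD
    refine (abs_sub _ _).trans ?_
    rw [abs_mul, abs_of_nonneg hk0]
    have a1 := hkap s hs (‖z - x‖ ^ 2) (by positivity)
    have a2 := hkap s hs _ (hbq z hz)
    have : ‖x‖ ^ 2 / R ^ 2 * |kap n s (bq R x z)| ≤ 1 * (Mk / s ^ n) := by gcongr
    calc _ ≤ Mk / s ^ n + 1 * (Mk / s ^ n) := by linarith
      _ = _ := by ring
  have gDb : ∀ s, 0 < s → ∀ z ∈ O, |gD n R s x z| ≤ 2 * Mg / s ^ (n + 1) := fun s hs z hz => by
    unfold gD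
    refine (abs_sub _ _).trans ?_
    rw [abs_mul, abs_of_nonneg hk0]
    have a1 := hgk s hs (‖z - x‖ ^ 2) (by positivity)
    have a2 := hgk s hs _ (hbq z hz)
    have : ‖x‖ ^ 2 / R ^ 2 * |gk n s (bq R x z)| ≤ 1 * (Mg / s ^ (n + 1)) := by gcongr
    calc _ ≤ Mg / s ^ (n + 1) + 1 * (Mg / s ^ (n + 1)) := by linarith
      _ = _ := by ring
  have msk : ∀ s, AEStronglyMeasurable (fun z => kD n R s x z * w z) (volume.restrict O) := fun s =>
    ((kD_cont R s x).continuousOn.mul hw.continuousOn).aestronglyMeasurable mO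
  have msg : ∀ s, AEStronglyMeasurable (fun z => gD n R s x z * w z) (volume.restrict O) := fun s =>
    ((gD_cont R s x).continuousOn.mul hw.continuousOn).aestronglyMeasurable mO
  set U : ℝ → ℝ := fun s => ∫ z in O, kD n R s x z * w z with hU
  have dU : ∀ s, 0 < s → HasDerivAt U (∫ z in O, gD n R s x z * w z) s := fun s hs => by
    refine (hasDerivAt_integral_of_dominated_loc_of_deriv_le (μ := volume.restrict O)
      (F := fun s z => kD n R s x z * w z) (F' := fun s z => gD n R s x z * w z)
      (bound := fun _ => 2 * Mg / (s / 2) ^ (n + 1) * (C1 * R))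
      (Ioi_mem_nhds (show s / 2 < s by linarith)) (Eventually.of_forall msk) ?_ (msg s) ?_ (integrable_const _) ?_).2
    · refine Integrable.of_bound (msk s) (2 * Mk / s ^ n * (C1 * R)) ?_
      filter_upwards [ae_restrict_mem mO] with z hz
      rw [Real.norm_eq_abs, abs_mul]
      have := kDb s hs z hz
      have := hwB z hz
      gcongr
    · filter_upwards [ae_restrict_mem mO] with z hz a ha
      rw [Real.norm_eq_abs, abs_mul]
      have ha' : s / 2 < a := ha
      have := gDb a (by linarith) z hz
      have := hwB z hz
      have : 2 * Mg / a ^ (n + 1) ≤ 2 * Mg / (s / 2) ^ (n + 1) := by gcongr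
      gcongr
      linarith
    · filter_upwards [ae_restrict_mem mO] with z hz a ha
      have ha' : s / 2 < a := ha
      exact ((kap_deriv n (by linarith) _).sub ((kap_deriv n (by linarith) _).const_mul _)).mul_const _
  have bU : ∀ s, 0 < s → s ≤ t → |∫ z in O, gD n R s x z * w z| ≤ 2 * V * t * g := fun s hs hst => by
    have hz0 : ∀ z ∈ ball (0 : E n) R, z ∉ closedBall x s → phiD n R s x z = 0 := by
      intro z hz hzK
      have h1 : s < ‖z - x‖ := by simpa [dist_eq_norm] using hzK
      have h2 := bq_ge hR hxR (by simpa using hz : ‖z‖ < R)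
      have h3 : s ^ 2 ≤ ‖z - x‖ ^ 2 := pow_le_pow_left₀ hs.le h1.le 2
      unfold phiD phi
      rw [hfun_zero, hfun_zero]
      · simp
      · rw [le_div_iff₀ (by positivity)]; linarith
      · rw [le_div_iff₀ (by positivity)]; linarith
    have h1 := green hR oO hOR hw hC1 hw0 hwg (phiD_smooth R s x) (fun z hz => by
        unfold phiD
        rw [bq_eq hR, hz]; simp) (isClosed_closedBall (x := x) (ε := s)) (fun z hz => ⟨hz.2, by
        have e1 := hz.1
        have e2 := hx.2
        rw [mem_closedBall] at e1
        rw [mem_ball] at e2 ⊢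
        linarith [dist_triangle z x x0]⟩) hz0
    have h2 : ∫ z in O, gD n R s x z * w z = ∫ z in O, w z * lap n (phiD n R s x) z :=
      integral_congr_ae (Eventually.of_forall fun z => by simp only [phiD_lap hR hs]; ring)
    rw [h2, h1]
    have h3 : ∫ z in O, phiD n R s x z * lap n w z = ∫ z in O ∩ closedBall x s, phiD n R s x z * lap n w z := by
      apply setIntegral_eq_of_subset_of_forall_sdiff_eq_zero mO Set.inter_subset_left
      intro z hz
      rw [hz0 z (hOR hz.1) (fun h => hz.2 ⟨hz.1, h⟩), zero_mul]
    rw [h3]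
    have h4 := norm_setIntegral_le_of_norm_le_const (μ := volume) (s := O ∩ closedBall x s)
      (f := fun z => phiD n R s x z * lap n w z) (C := 2 * (s / s ^ n) * g)
      (lt_of_le_of_lt (measure_mono Set.inter_subset_left) hfin) (fun z hz => by
        rw [Real.norm_eq_abs, abs_mul]
        have a1 : |phiD n R s x z| ≤ 2 * (s / s ^ n) := by
          unfold phiD phi
          refine (abs_sub _ _).trans ?_
          rw [abs_mul, abs_mul, abs_of_pos (by positivity : 0 < s / s ^ n)]
          have a1 := hfun_abs (‖z - x‖ ^ 2 / s ^ 2)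
          have a2 := hfun_abs (bq R x z / s ^ 2)
          calc _ ≤ 1 * (s / s ^ n) + 1 * (s / s ^ n) := by gcongr
            _ = _ := by ring
        have a2 := hwg z hz.1
        gcongr)
    have h5 : volume.real (O ∩ closedBall x s) ≤ s ^ n * V := by
      have : volume.real (closedBall x s) = s ^ n * V := by
        rw [measureReal_def, Measure.addHaar_closedBall _ _ hs.le]
        simp [ENNReal.toReal_mul, hV, ENNReal.toReal_ofReal (by positivity : 0 ≤ s ^ n)]
      rw [← this]
      exact measureReal_mono Set.inter_subset_right measure_closedBall_lt_top.ne
    rw [Real.norm_eq_abs] at h4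
    calc _ ≤ _ := h4
      _ ≤ 2 * (s / s ^ n) * g * (s ^ n * V) := by gcongr
      _ = 2 * V * s * g := by field_simp
      _ ≤ _ := by gcongr
  have diff : ∀ s, 0 < s → s ≤ t → |U t - U s| ≤ 2 * V * t ^ 2 * g := fun s hs hst => by
    have := norm_image_sub_le_of_norm_deriv_le_segment' (f := U) (C := 2 * V * t * g)
      (fun a ha => (dU a (by linarith [ha.1])).hasDerivWithinAt)
      (fun a ha => bU a (by linarith [ha.1]) ha.2.le) t ⟨hst, le_rfl⟩
    rw [Real.norm_eq_abs] at this
    refine this.trans ?_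
    calc _ ≤ 2 * V * t * g * t := by gcongr; linarith
      _ = _ := by ring
  have hm := m0_pos hn
  have lim : Tendsto (fun c : ℝ => U c⁻¹) atTop (𝓝 (m0 n * w x)) := by
    have hxO : x ∈ O := ⟨hx.1, ball_subset_ball (by linarith) hx.2⟩
    have L := tendsto_integral_comp_smul_smul_of_integrable' (μ := (volume : Measure (E n)))
      (φ := fun z => rho n z / m0 n) (fun z => div_nonneg (rhof_nonneg _) hm.le)
      (by rw [integral_div]; exact div_self hm.ne') (by
        refine tendsto_const_nhds.congr' ?_
        have : ∀ᶠ z in Bornology.cobounded (E n), 1 < ‖z‖ :=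
          tendsto_norm_cobounded_atTop.eventually (eventually_gt_atTop 1)
        filter_upwards [this] with z hz
        rw [rho_zero hz]; simp) (g := O.indicator w) (x₀ := x) (by
        rw [integrable_indicator_iff mO]
        refine Integrable.of_bound (hw.continuousOn.aestronglyMeasurable mO) (C1 * R) ?_
        filter_upwards [ae_restrict_mem mO] with z hz using hwB z hz) (by
        refine (hw.continuousOn.continuousAt (oO.mem_nhds hxO)).congr ?_
        filter_upwards [oO.mem_nhds hxO] with z hz
        rw [Set.indicator_of_mem hz])
    rw [Set.indicator_of_mem hxO] at L
    refine (L.const_mul (m0 n)).congr' ?_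
    have hd : 0 < R - ‖x‖ := by linarith
    filter_upwards [eventually_gt_atTop 0, eventually_gt_atTop (R - ‖x‖)⁻¹] with c hc hc2
    have hci : c⁻¹ < R - ‖x‖ := inv_lt_of_inv_lt₀ hd hc2
    rw [← integral_const_mul]
    simp only [hU]
    rw [← integral_indicator mO]
    congr 1
    ext z
    by_cases hz : z ∈ O
    · rw [Set.indicator_of_mem hz, Set.indicator_of_mem hz]
      have e1 : kap n c⁻¹ (bq R x z) = 0 := by
        unfold kap
        rw [rhof_zero, zero_div]
        have := bq_ge' hR hxR (hOn z hz)
        have h7 : c⁻¹ ^ 2 < (R - ‖x‖) ^ 2 := pow_lt_pow_left₀ hci (by positivity) (by norm_num)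
        rw [lt_div_iff₀ (by positivity)]; linarith
      unfold kD
      rw [e1]
      unfold kap rho
      have e2 : ‖c • (x - z)‖ ^ 2 = ‖z - x‖ ^ 2 / c⁻¹ ^ 2 := by
        rw [norm_smul, norm_sub_rev, mul_pow, Real.norm_eq_abs, sq_abs]; field_simp
      rw [e2]
      simp only [finrank_euclideanSpace, Fintype.card_fin, smul_eq_mul, mul_zero, sub_zero, inv_pow]
      field_simp
    · rw [Set.indicator_of_notMem hz, Set.indicator_of_notMem hz]; simp
  have final : Tendsto (fun c : ℝ => |U t - U c⁻¹|) atTop (𝓝 |U t - m0 n * w x|) :=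
    (tendsto_const_nhds.sub lim).abs
  refine le_of_tendsto final ?_
  filter_upwards [eventually_gt_atTop 0, eventually_gt_atTop t⁻¹] with c hc hc2
  exact diff _ (by positivity) (inv_lt_of_inv_lt₀ ht hc2).le


def dbl {X F : Type*} [AddCommGroup X] [AddCommGroup F] (f : X → F) (x a b : X) : F :=
  f (x + a + b) - f (x + a) - f (x + b) + f x

lemma dbl_bound {X F : Type*} [NormedAddCommGroup X] [NormedSpace ℝ X] [NormedAddCommGroup F] [NormedSpace ℝ F]
    {f : X → F} (hf : ContDiff ℝ 2 f) {r M : ℝ} (hM : ∀ x, ‖x‖ ≤ r → ‖fderiv ℝ (fderiv ℝ f) x‖ ≤ M)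
    (x a b : X) (h : ‖x‖ + ‖a‖ + ‖b‖ ≤ r) : ‖dbl f x a b‖ ≤ M * ‖a‖ * ‖b‖ := by
  have hd : Differentiable ℝ f := hf.differentiable (by norm_num)
  have hd2 : Differentiable ℝ (fderiv ℝ f) :=
    (hf.fderiv_right (m := 1) (by norm_num)).differentiable (by norm_num)
  have e : dbl f x a b = (fun y => f (y + b) - f y) (x + a) - (fun y => f (y + b) - f y) x := by
    simp only [dbl]; abel
  rw [e]
  have := (convex_closedBall (0 : X) (r - ‖b‖)).norm_image_sub_le_of_norm_fderiv_le (𝕜 := ℝ)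
    (f := fun y => f (y + b) - f y) (C := M * ‖b‖) (x := x) (y := x + a) (fun y _ => by fun_prop) (fun y hy => by
      rw [mem_closedBall_zero_iff] at hy
      rw [fderiv_fun_sub (by fun_prop) (by fun_prop), fderiv_comp_add_right]
      have := (convex_closedBall (0 : X) r).norm_image_sub_le_of_norm_fderiv_le (𝕜 := ℝ) (f := fderiv ℝ f) (C := M)
        (x := y) (y := y + b) (fun y _ => hd2 y) (fun y hy => hM y (by simpa using hy))
        (by rw [mem_closedBall_zero_iff]; linarith [norm_nonneg b])
        (by rw [mem_closedBall_zero_iff]; linarith [norm_add_le y b])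
      simpa using this)
    (by rw [mem_closedBall_zero_iff]; linarith [norm_nonneg a])
    (by rw [mem_closedBall_zero_iff]; linarith [norm_add_le x a])
  refine this.trans (le_of_eq ?_)
  rw [add_sub_cancel_left]; ring

set_option maxSynthPendingDepth 10 in
set_option synthInstance.maxHeartbeats 400000 in
lemma dbl_diff_bound {X : Type*} [NormedAddCommGroup X] [NormedSpace ℝ X] [ProperSpace X]
    {f : X → ℝ} (hf : ContDiff ℝ 3 f) (r : ℝ) : ∃ M, 0 ≤ M ∧ ∀ x y a b : X, ‖x‖ + ‖a‖ + ‖b‖ ≤ r →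
      ‖y‖ + ‖a‖ + ‖b‖ ≤ r → |dbl f y a b - dbl f x a b| ≤ M * ‖a‖ * ‖b‖ * ‖y - x‖ := by
  have h1 : ContDiff ℝ 2 (fderiv ℝ f) := hf.fderiv_right (by norm_num)
  have h2 : ContDiff ℝ 1 (fderiv ℝ (fderiv ℝ f)) := h1.fderiv_right (by norm_num)
  have h3 : Continuous (fderiv ℝ (fderiv ℝ (fderiv ℝ f))) := h2.continuous_fderiv (by norm_num)
  have hd : Differentiable ℝ f := hf.differentiable (by norm_num)
  obtain ⟨M, hM⟩ := (isCompact_closedBall (0 : X) r).exists_bound_of_continuousOn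
    (f := fun x => ‖fderiv ℝ (fderiv ℝ (fderiv ℝ f)) x‖) h3.norm.continuousOn
  simp only [norm_norm] at hM
  refine ⟨|M|, abs_nonneg _, fun x y a b hx hy => ?_⟩
  have := (convex_closedBall (0 : X) (r - ‖a‖ - ‖b‖)).norm_image_sub_le_of_norm_fderiv_le (𝕜 := ℝ)
    (f := fun y => dbl f y a b) (C := |M| * ‖a‖ * ‖b‖) (x := x) (y := y) (fun y _ => by unfold dbl; fun_prop)
    (fun y hy => by
      rw [mem_closedBall_zero_iff] at hy
      have e : fderiv ℝ (fun y => dbl f y a b) y = dbl (fderiv ℝ f) y a b := by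
        unfold dbl
        rw [fderiv_fun_add (by fun_prop) (by fun_prop), fderiv_fun_sub (by fun_prop) (by fun_prop),
          fderiv_fun_sub (by fun_prop) (by fun_prop)]
        simp only [add_assoc, fderiv_comp_add_right]
      rw [e]
      exact dbl_bound h1 (fun x hx => (hM x (by simpa using hx)).trans (le_abs_self _)) _ _ _ (by linarith))
    (by rw [mem_closedBall_zero_iff]; linarith)
    (by rw [mem_closedBall_zero_iff]; linarith)
  exact this

abbrev XX (n : ℕ) := E n × E n × ℝ × ℝ × E n
def Th (n : ℕ) (p : XX n) : ℝ := ‖p.2.1 + p.2.2.1 • p.1‖ ^ 2 * rho n (p.2.2.2.1 • p.1 + p.2.2.2.2)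

lemma Th_smooth (n : ℕ) : ContDiff ℝ 3 (Th n) := by
  have h := (rho_smooth n).of_le (show (3 : WithTop ℕ∞) ≤ ((⊤ : ℕ∞) : WithTop ℕ∞) by
    have : ((3 : ℕ∞) : WithTop ℕ∞) ≤ ((⊤ : ℕ∞) : WithTop ℕ∞) := WithTop.coe_le_coe.2 le_top
    exact this)
  unfold Th
  exact ContDiff.mul (ContDiff.norm_sq ℝ (by fun_prop)) (h.comp (by fun_prop))

def pt {n : ℕ} (q : E n) (l s : ℝ) (w : E n) (ξ : E n) : XX n := (ξ, q, l, s, w)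

lemma Th_tri (n : ℕ) : ∃ M, 0 ≤ M ∧ ∀ (q w : E n) (l s : ℝ) (x y a b : E n), ‖q‖ ≤ 1 → |l| ≤ 1 → |s| ≤ 1 →
    ‖x‖ + ‖a‖ + ‖b‖ ≤ 1 → ‖y‖ + ‖a‖ + ‖b‖ ≤ 1 →
    |dbl (fun ξ => Th n (pt q l s w ξ)) y a b - dbl (fun ξ => Th n (pt q l s w ξ)) x a b| ≤
      M * ‖a‖ * ‖b‖ * ‖y - x‖ := by
  obtain ⟨M, hM, h⟩ := dbl_diff_bound (Th_smooth n) 5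
  refine ⟨M, hM, fun q w l s x y a b hq hl hs hx hy => ?_⟩
  by_cases hw : ‖w‖ ≤ 3
  · have ez : ∀ v : E n, ‖((v, 0, 0, 0, 0) : XX n)‖ = ‖v‖ := fun v => by
      simp [Prod.norm_def]
    have ed : ∀ x : E n, dbl (fun ξ => Th n (pt q l s w ξ)) x a b =
        dbl (Th n) (pt q l s w x) (a, 0, 0, 0, 0) (b, 0, 0, 0, 0) := fun x => by
      simp [dbl, pt]
    have en : ∀ x : E n, ‖x‖ ≤ 1 → ‖pt q l s w x‖ ≤ 3 := fun x hx => by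
      simp only [pt, Prod.norm_def, Real.norm_eq_abs]
      refine max_le (by linarith) (max_le (by linarith) (max_le (by linarith) (max_le (by linarith) hw)))
    have := h (pt q l s w x) (pt q l s w y) (a, 0, 0, 0, 0) (b, 0, 0, 0, 0)
      (by rw [ez, ez]; linarith [en x (by linarith [norm_nonneg a, norm_nonneg b]), norm_nonneg x])
      (by rw [ez, ez]; linarith [en y (by linarith [norm_nonneg a, norm_nonneg b]), norm_nonneg y])
    rw [ed, ed]
    refine this.trans (le_of_eq ?_)
    rw [ez, ez]
    have : pt q l s w y - pt q l s w x = (y - x, 0, 0, 0, 0) := by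
      simp [pt]
      rfl
    rw [this, ez]
  · have e0 : ∀ v : E n, ‖v‖ ≤ 1 → Th n (pt q l s w v) = 0 := fun v hv => by
      unfold Th pt
      simp only
      rw [rho_zero, mul_zero]
      have h1 : ‖s • v‖ ≤ 1 := by
        rw [norm_smul]; exact mul_le_one₀ hs (norm_nonneg _) hv
      have h2 := norm_sub_le (s • v + w) (s • v)
      rw [add_sub_cancel_left] at h2
      linarith
    have e1 : ∀ x : E n, ‖x‖ + ‖a‖ + ‖b‖ ≤ 1 → dbl (fun ξ => Th n (pt q l s w ξ)) x a b = 0 := fun x hx => by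
      simp only [dbl]
      have := norm_nonneg a
      have := norm_nonneg b
      rw [e0 _ (by linarith [norm_add₃_le (a := x) (b := a) (c := b)]), e0 (x + a) (by linarith [norm_add_le x a]),
        e0 (x + b) (by linarith [norm_add_le x b]), e0 x (by linarith)]
      simp
    rw [e1 x hx, e1 y hy, sub_zero, abs_zero]
    positivity

lemma kD_Th {n : ℕ} (hn : 0 < n) {R t : ℝ} (hR : 0 < R) (ht : 0 < t) (x0 z ξ : E n) (hz : z ≠ 0) :
    kD n R t (x0 + t • ξ) z = (Th n (pt (ee ⟨0, hn⟩) 0 1 (t⁻¹ • (x0 - z)) ξ) -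
      Th n (pt (R⁻¹ • x0) (t / R) (‖z‖ / R) (t⁻¹ • ((‖z‖ / R) • x0 - (R / ‖z‖) • z)) ξ)) / t ^ n := by
  have hz0 : 0 < ‖z‖ := norm_pos_iff.2 hz
  unfold kD kap Th pt rho
  simp only [zero_smul, add_zero, norm_ee, one_smul]
  have e1 : ‖z - (x0 + t • ξ)‖ ^ 2 / t ^ 2 = ‖ξ + t⁻¹ • (x0 - z)‖ ^ 2 := by
    have : ξ + t⁻¹ • (x0 - z) = (-t⁻¹) • (z - (x0 + t • ξ)) := by
      rw [smul_sub (-t⁻¹), smul_add, smul_smul, neg_mul, inv_mul_cancel₀ ht.ne']; module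
    rw [this, norm_smul, mul_pow, Real.norm_eq_abs, sq_abs]; field_simp
  have e2 : ‖x0 + t • ξ‖ ^ 2 / R ^ 2 = ‖R⁻¹ • x0 + (t / R) • ξ‖ ^ 2 := by
    have : R⁻¹ • x0 + (t / R) • ξ = R⁻¹ • (x0 + t • ξ) := by module
    rw [this, norm_smul, mul_pow, Real.norm_eq_abs, sq_abs]; field_simp
  have e3 : bq R (x0 + t • ξ) z / t ^ 2 =
      ‖(‖z‖ / R) • ξ + t⁻¹ • ((‖z‖ / R) • x0 - (R / ‖z‖) • z)‖ ^ 2 := by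
    have : (‖z‖ / R) • ξ + t⁻¹ • ((‖z‖ / R) • x0 - (R / ‖z‖) • z) =
      t⁻¹ • ((‖z‖ / R) • (x0 + t • ξ) - (R / ‖z‖) • z) := by
      rw [smul_add, smul_smul _ t, smul_sub, smul_sub, smul_add, smul_smul _ (‖z‖ / R * t)]
      have : t⁻¹ * (‖z‖ / R * t) = ‖z‖ / R := by field_simp
      rw [this]; module
    rw [this, norm_smul, mul_pow, Real.norm_eq_abs, sq_abs, @norm_sub_sq_real, norm_smul, norm_smul,
      real_inner_smul_left, real_inner_smul_right, mul_pow, mul_pow, Real.norm_eq_abs, Real.norm_eq_abs,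
      sq_abs, sq_abs, bq]
    field_simp
    ring
  rw [e1, e2, e3]
  ring

lemma kD_tri {n : ℕ} (hn : 0 < n) : ∃ M, 0 ≤ M ∧ ∀ (R t : ℝ) (x0 z x y a b : E n), 0 < R → 0 < t → 2 * t ≤ ‖x0‖ →
    ‖x0‖ ≤ R → z ∈ ball 0 R ∩ ball x0 (2 * t) → ‖x - x0‖ + ‖a‖ + ‖b‖ ≤ t → ‖y - x0‖ + ‖a‖ + ‖b‖ ≤ t →
    |dbl (fun x => kD n R t x z) y a b - dbl (fun x => kD n R t x z) x a b| ≤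
      M * ‖a‖ * ‖b‖ * ‖y - x‖ / t ^ (n + 3) := by
  obtain ⟨M, hM, h⟩ := Th_tri n
  refine ⟨2 * M, by positivity, fun R t x0 z x y a b hR ht htx hxR hz hx hy => ?_⟩
  have hz1 : ‖z‖ < R := by simpa using hz.1
  have hz0 : z ≠ 0 := by
    rintro rfl
    have := hz.2
    rw [mem_ball, dist_zero_left] at this
    linarith
  have ed : ∀ x, dbl (fun x => kD n R t x z) x a b =
      (dbl (fun ξ => Th n (pt (ee ⟨0, hn⟩) 0 1 (t⁻¹ • (x0 - z)) ξ)) (t⁻¹ • (x - x0)) (t⁻¹ • a) (t⁻¹ • b)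
      - dbl (fun ξ => Th n (pt (R⁻¹ • x0) (t / R) (‖z‖ / R) (t⁻¹ • ((‖z‖ / R) • x0 - (R / ‖z‖) • z)) ξ)) (t⁻¹ • (x - x0)) (t⁻¹ • a) (t⁻¹ • b)) / t ^ n := by
    intro x
    have key : ∀ ξ : E n, kD n R t (x0 + t • ξ) z = _ := fun ξ => kD_Th hn hR ht x0 z ξ hz0
    have s1 : x = x0 + t • (t⁻¹ • (x - x0)) := by rw [smul_smul, mul_inv_cancel₀ ht.ne']; module
    have s2 : ∀ v : E n, x + v = x0 + t • (t⁻¹ • (x - x0) + t⁻¹ • v) := fun v => by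
      rw [smul_add, smul_smul, smul_smul, mul_inv_cancel₀ ht.ne']; module
    have s3 : x + a + b = x0 + t • (t⁻¹ • (x - x0) + t⁻¹ • a + t⁻¹ • b) := by
      rw [add_assoc, s2]; module
    have k1 := key (t⁻¹ • (x - x0))
    have k2 := key (t⁻¹ • (x - x0) + t⁻¹ • a)
    have k3 := key (t⁻¹ • (x - x0) + t⁻¹ • b)
    have k4 := key (t⁻¹ • (x - x0) + t⁻¹ • a + t⁻¹ • b)
    rw [← s1] at k1
    rw [← s2] at k2 k3
    rw [← s3] at k4
    simp only [dbl]
    rw [k1, k2, k3, k4]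
    ring
  have ns : ∀ v : E n, ‖t⁻¹ • v‖ = ‖v‖ / t := fun v => by
    rw [norm_smul, Real.norm_eq_abs, abs_of_pos (by positivity)]; field_simp
  have hh : ∀ x : E n, ‖x - x0‖ + ‖a‖ + ‖b‖ ≤ t → ‖t⁻¹ • (x - x0)‖ + ‖t⁻¹ • a‖ + ‖t⁻¹ • b‖ ≤ 1 := fun x hx => by
    rw [ns, ns, ns, ← add_div, ← add_div, div_le_one ht]; exact hx
  have h1 := h (ee ⟨0, hn⟩) (t⁻¹ • (x0 - z)) 0 1 _ _ _ _ (by rw [norm_ee]) (by simp) (by simp) (hh x hx) (hh y hy)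
  have h2 := h (R⁻¹ • x0) (t⁻¹ • ((‖z‖ / R) • x0 - (R / ‖z‖) • z)) (t / R) (‖z‖ / R) _ _ _ _
    (by rw [norm_smul, Real.norm_eq_abs, abs_of_pos (by positivity), inv_mul_le_iff₀ hR]; linarith)
    (by rw [abs_of_pos (by positivity), div_le_one hR]; linarith)
    (by rw [abs_of_nonneg (by positivity), div_le_one hR]; linarith) (hh x hx) (hh y hy)
  have e4 : t⁻¹ • (y - x0) - t⁻¹ • (x - x0) = t⁻¹ • (y - x) := by module
  rw [e4, ns, ns, ns] at h1 h2
  rw [ed, ed, ← sub_div, abs_div, abs_of_pos (by positivity : 0 < t ^ n), div_le_iff₀ (by positivity)]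
  have e5 : 2 * M * ‖a‖ * ‖b‖ * ‖y - x‖ / t ^ (n + 3) * t ^ n =
      M * (‖a‖ / t) * (‖b‖ / t) * (‖y - x‖ / t) + M * (‖a‖ / t) * (‖b‖ / t) * (‖y - x‖ / t) := by
    rw [pow_add]; field_simp; ring
  rw [e5]
  refine le_trans (le_of_eq ?_) ((abs_sub _ _).trans (add_le_add h1 h2))
  congr 1; ring

lemma K_lemma {n : ℕ} (hn : 0 < n) : ∃ C, 0 ≤ C ∧ ∀ (R : ℝ) (x0 : E n) (t : ℝ) (w : E n → ℝ) (C1 g m : ℝ)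
    (x y a b : E n), 0 < R → 0 < t → 0 ≤ C1 → 0 ≤ g → 0 ≤ m → 2 * t ≤ ‖x0‖ → ‖x0‖ ≤ R →
    ContDiffOn ℝ 2 w (ball 0 R ∩ ball x0 (2 * t)) →
    (∀ z ∈ ball 0 R ∩ ball x0 (2 * t), |w z| ≤ C1 * (R - ‖z‖)) →
    (∀ z ∈ ball 0 R ∩ ball x0 (2 * t), |w z| ≤ m) →
    (∀ z ∈ ball 0 R ∩ ball x0 (2 * t), |lap n w z| ≤ g) →
    ‖x - x0‖ + ‖a‖ + ‖b‖ < t → ‖y - x0‖ + ‖a‖ + ‖b‖ < t → ‖x‖ + ‖a‖ + ‖b‖ < R → ‖y‖ + ‖a‖ + ‖b‖ < R →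
    |dbl w y a b - dbl w x a b| ≤ C * (t ^ 2 * g + m * (‖a‖ * ‖b‖ * ‖y - x‖ / t ^ 3)) := by
  obtain ⟨C, hC, h1⟩ := kernel_mv hn
  obtain ⟨M, hM, h2⟩ := kD_tri hn
  have hm := m0_pos hn
  set V := (volume (ball (0 : E n) 1)).toReal with hV
  refine ⟨(8 * C + M * 2 ^ n * V) / m0 n, by positivity,
    fun R x0 t w C1 g m x y a b hR ht hC1 hg hmm htx hxR hw hw0 hwm hwg hx hy hxa hya => ?_⟩
  set O := ball (0 : E n) R ∩ ball x0 (2 * t) with hO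
  have oO : IsOpen O := isOpen_ball.inter isOpen_ball
  have mO : MeasurableSet O := oO.measurableSet
  have hfin : volume O < ⊤ := lt_of_le_of_lt (measure_mono Set.inter_subset_left) measure_ball_lt_top
  have : IsFiniteMeasure (volume.restrict O) := ⟨by simpa using hfin⟩
  set U : E n → ℝ := fun x => ∫ z in O, kD n R t x z * w z with hU
  have mv : ∀ x ∈ ball 0 R ∩ ball x0 t, |U x - m0 n * w x| ≤ C * t ^ 2 * g := fun x hx =>
    h1 R x0 t w C1 g x hR ht hC1 hg hw hw0 hwg hx
  have hU0 : ∀ x, Integrable (fun z => kD n R t x z * w z) (volume.restrict O) := fun x => by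
    obtain ⟨B, hB⟩ := (isCompact_closedBall (0 : E n) R).exists_bound_of_continuousOn (kD_cont R t x).continuousOn
    refine Integrable.of_bound (((kD_cont R t x).continuousOn.mul hw.continuousOn).aestronglyMeasurable mO) (B * m) ?_
    filter_upwards [ae_restrict_mem mO] with z hz
    rw [norm_mul]
    have b1 := hB z (ball_subset_closedBall hz.1)
    have b2 := hwm z hz
    have := (norm_nonneg _).trans b1
    rw [Real.norm_eq_abs (w z)]
    gcongr
  have eU : dbl U y a b - dbl U x a b = ∫ z in O, (dbl (fun x => kD n R t x z) y a b - dbl (fun x => kD n R t x z) x a b) * w z := by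
    have e1 : ∀ p : E n, dbl U p a b = ∫ z in O, (dbl (fun x => kD n R t x z) p a b) * w z := fun p => by
      have e2 : (fun z => (dbl (fun x => kD n R t x z) p a b) * w z) = fun z =>
          (((kD n R t (p + a + b) z * w z - kD n R t (p + a) z * w z) - kD n R t (p + b) z * w z)
            + kD n R t p z * w z) := by
        ext z; simp only [dbl]; ring
      rw [e2, integral_add (by exact ((hU0 _).sub (hU0 _)).sub (hU0 _)) (hU0 _),
        integral_sub (by exact (hU0 _).sub (hU0 _)) (hU0 _), integral_sub (hU0 _) (hU0 _)]
      rfl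
    have i1 : ∀ p : E n, Integrable (fun z => (dbl (fun x => kD n R t x z) p a b) * w z) (volume.restrict O) := fun p => by
      have e2 : (fun z => (dbl (fun x => kD n R t x z) p a b) * w z) = fun z =>
          (((kD n R t (p + a + b) z * w z - kD n R t (p + a) z * w z) - kD n R t (p + b) z * w z)
            + kD n R t p z * w z) := by
        ext z; simp only [dbl]; ring
      rw [e2]
      exact (((hU0 _).sub (hU0 _)).sub (hU0 _)).add (hU0 _)
    rw [e1, e1, ← integral_sub (i1 y) (i1 x)]
    congr 1
    ext z
    ring
  have bU : |dbl U y a b - dbl U x a b| ≤ M * 2 ^ n * V * (m * (‖a‖ * ‖b‖ * ‖y - x‖ / t ^ 3)) := by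
    rw [eU]
    have h4 := norm_setIntegral_le_of_norm_le_const (μ := volume) (s := O)
      (f := fun z => (dbl (fun x => kD n R t x z) y a b - dbl (fun x => kD n R t x z) x a b) * w z)
      (C := M * ‖a‖ * ‖b‖ * ‖y - x‖ / t ^ (n + 3) * m) hfin (fun z hz => by
        rw [norm_mul]
        have b1 := h2 R t x0 z x y a b hR ht htx hxR hz hx.le hy.le
        have b2 := hwm z hz
        rw [Real.norm_eq_abs, Real.norm_eq_abs]
        gcongr)
    have h5 : volume.real O ≤ (2 * t) ^ n * V := by
      have : volume.real (ball x0 (2 * t)) = (2 * t) ^ n * V := by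
        rw [measureReal_def, Measure.addHaar_ball_of_pos _ _ (by positivity : 0 < 2 * t), ENNReal.toReal_mul,
          ENNReal.toReal_ofReal (by positivity)]
        simp [hV]
      rw [← this]
      exact measureReal_mono Set.inter_subset_right measure_ball_lt_top.ne
    refine h4.trans ?_
    calc _ ≤ M * ‖a‖ * ‖b‖ * ‖y - x‖ / t ^ (n + 3) * m * ((2 * t) ^ n * V) := by gcongr
      _ = _ := by rw [mul_pow, pow_add]; field_simp
  have pts : ∀ x : E n, ‖x - x0‖ + ‖a‖ + ‖b‖ < t → ‖x‖ + ‖a‖ + ‖b‖ < R →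
      x + a + b ∈ ball 0 R ∩ ball x0 t ∧ x + a ∈ ball 0 R ∩ ball x0 t ∧ x + b ∈ ball 0 R ∩ ball x0 t ∧
      x ∈ ball 0 R ∩ ball x0 t := by
    intro x hx hxa
    have na := norm_nonneg a
    have nb := norm_nonneg b
    have e1 : ∀ v : E n, x + v - x0 = (x - x0) + v := fun v => by abel
    simp only [Set.mem_inter_iff, mem_ball, dist_eq_norm, sub_zero, add_assoc, e1]
    have t1 := norm_add_le a b
    refine ⟨⟨?_, ?_⟩, ⟨?_, ?_⟩, ⟨?_, ?_⟩, ⟨?_, ?_⟩⟩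
    · linarith [norm_add_le x (a + b)]
    · linarith [norm_add_le (x - x0) (a + b)]
    · linarith [norm_add_le x a]
    · linarith [norm_add_le (x - x0) a]
    · linarith [norm_add_le x b]
    · linarith [norm_add_le (x - x0) b]
    · linarith
    · linarith
  have dd : ∀ x : E n, ‖x - x0‖ + ‖a‖ + ‖b‖ < t → ‖x‖ + ‖a‖ + ‖b‖ < R →
      |dbl U x a b - m0 n * dbl w x a b| ≤ 4 * (C * t ^ 2 * g) := by
    intro x hx hxa
    obtain ⟨p1, p2, p3, p4⟩ := pts x hx hxa
    have q1 := abs_le.1 (mv _ p1)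
    have q2 := abs_le.1 (mv _ p2)
    have q3 := abs_le.1 (mv _ p3)
    have q4 := abs_le.1 (mv _ p4)
    unfold dbl
    rw [abs_le]
    constructor <;> linarith
  have d1 := abs_le.1 (dd x hx hxa)
  have d2 := abs_le.1 (dd y hy hya)
  have d3 := abs_le.1 bU
  rw [div_mul_eq_mul_div, le_div_iff₀ hm]
  have : |dbl w y a b - dbl w x a b| * m0 n = |m0 n * dbl w y a b - m0 n * dbl w x a b| := by
    rw [← mul_sub, abs_mul, abs_of_pos hm, mul_comm]
  rw [this]
  set Q := m * (‖a‖ * ‖b‖ * ‖y - x‖ / t ^ 3)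
  have hQ : 0 ≤ Q := by positivity
  have f1 : (8 * C + M * 2 ^ n * V) * (t ^ 2 * g + Q) = 8 * (C * t ^ 2 * g) + M * 2 ^ n * V * Q + 8 * C * Q
    + M * 2 ^ n * V * (t ^ 2 * g) := by ring
  rw [f1]
  have f2 : 0 ≤ 8 * C * Q := by positivity
  have f3 : 0 ≤ M * 2 ^ n * V * (t ^ 2 * g) := by positivity
  rw [abs_le]
  constructor <;> linarith


lemma taylor1d {φ φ' φ'' : ℝ → ℝ} {k M : ℝ} (h1 : ∀ τ ∈ Set.Icc (0:ℝ) 1, HasDerivAt φ (φ' τ) τ)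
    (h2 : ∀ τ ∈ Set.Icc (0:ℝ) 1, HasDerivAt φ' (φ'' τ) τ) (hM : ∀ τ ∈ Set.Icc (0:ℝ) 1, |φ'' τ - k| ≤ M) :
    |φ 1 - φ 0 - φ' 0 - 1 / 2 * k| ≤ M := by
  have hM0 : 0 ≤ M := (abs_nonneg _).trans (hM 0 (by simp))
  have s1 : ∀ τ ∈ Set.Icc (0:ℝ) 1, |φ' τ - φ' 0 - τ * k| ≤ M := by
    intro τ hτ
    have := (convex_Icc (0:ℝ) 1).norm_image_sub_le_of_norm_hasDerivWithin_le (f := fun τ => φ' τ - τ * k)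
      (f' := fun τ => φ'' τ - 1 * k) (C := M) (x := 0) (y := τ)
      (fun x hx => ((h2 x hx).sub ((hasDerivAt_id x).mul_const k)).hasDerivWithinAt)
      (fun x hx => by rw [one_mul]; exact hM x hx) (by simp) hτ
    simp only [Real.norm_eq_abs, sub_zero, zero_mul] at this
    rw [show φ' τ - φ' 0 - τ * k = φ' τ - τ * k - φ' 0 by ring]
    refine this.trans ?_
    rw [abs_of_nonneg hτ.1]
    exact mul_le_of_le_one_right hM0 hτ.2
  have := (convex_Icc (0:ℝ) 1).norm_image_sub_le_of_norm_hasDerivWithin_le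
      (f := fun τ => φ τ - τ * φ' 0 - 1 / 2 * k * τ ^ 2)
      (f' := fun τ => φ' τ - 1 * φ' 0 - 1 / 2 * k * (2 * τ)) (C := M) (x := 0) (y := 1)
      (fun x hx => (((h1 x hx).sub ((hasDerivAt_id x).mul_const _)).sub
        (((hasDerivAt_pow 2 x).congr_deriv (by norm_num)).const_mul _)).hasDerivWithinAt)
      (fun x hx => by
        have := s1 x hx
        rw [Real.norm_eq_abs]
        rwa [show φ' x - 1 * φ' 0 - 1 / 2 * k * (2 * x) = φ' x - φ' 0 - x * k by ring]) (by simp) (by simp)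
  simp only [Real.norm_eq_abs, sub_zero, abs_one, mul_one] at this
  refine le_trans (le_of_eq ?_) this
  congr 1; ring

lemma taylor {n : ℕ} {u : E n → ℝ} {S : Set (E n)} (oS : IsOpen S) (cS : Convex ℝ S) (hu : ContDiffOn ℝ 2 u S)
    {p z : E n} (hp : p ∈ S) (hz : z ∈ S) {A : E n →L[ℝ] E n →L[ℝ] ℝ} {M : ℝ}
    (hM : ∀ q ∈ S, ‖q - p‖ ≤ ‖z - p‖ → ‖D2 u q - A‖ ≤ M) :
    |u z - u p - fderiv ℝ u p (z - p) - 1 / 2 * A (z - p) (z - p)| ≤ M * ‖z - p‖ ^ 2 := by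
  have mem : ∀ τ ∈ Set.Icc (0:ℝ) 1, p + τ • (z - p) ∈ S := fun τ hτ => by
    have := cS.add_smul_sub_mem hp hz hτ; exact this
  have cd : ∀ τ ∈ Set.Icc (0:ℝ) 1, ContDiffAt ℝ 2 u (p + τ • (z - p)) := fun τ hτ =>
    (hu _ (mem τ hτ)).contDiffAt (oS.mem_nhds (mem τ hτ))
  have := taylor1d (φ := fun τ => u (p + τ • (z - p))) (φ' := fun τ => fderiv ℝ u (p + τ • (z - p)) (z - p))
    (φ'' := fun τ => D2 u (p + τ • (z - p)) (z - p) (z - p)) (k := A (z - p) (z - p)) (M := M * ‖z - p‖ ^ 2)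
    (fun τ hτ => ((cd τ hτ).differentiableAt (by norm_num)).hasFDerivAt.comp_hasDerivAt τ (hasDerivAt_line p (z - p) τ))
    (fun τ hτ => by
      have := ((hasFDerivAt_D2 (cd τ hτ)).clm_apply (hasFDerivAt_const (z - p) _)).comp_hasDerivAt τ (hasDerivAt_line p (z - p) τ)
      generalize z - p = ζ at this ⊢
      refine this.congr_deriv ?_
      simp)
    (fun τ hτ => by
      have h1 := hM _ (mem τ hτ) (by
        rw [add_sub_cancel_left, norm_smul, Real.norm_eq_abs, abs_of_nonneg hτ.1]
        exact mul_le_of_le_one_left (norm_nonneg _) hτ.2)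
      have h2 := (D2 u (p + τ • (z - p)) - A).le_opNorm₂ (z - p) (z - p)
      simp only [sub_apply, Real.norm_eq_abs] at h2
      refine h2.trans ?_
      rw [mul_assoc, ← sq]
      gcongr)
  simpa using this

lemma dbl_taylor {n : ℕ} {u : E n → ℝ} {x : E n} {r : ℝ} (hu : ContDiffOn ℝ 2 u (ball x r))
    {A : E n →L[ℝ] E n →L[ℝ] ℝ} {M : ℝ} (hM : ∀ q ∈ ball x r, ‖D2 u q - A‖ ≤ M) {a b : E n}
    (hab : ‖a‖ + ‖b‖ < r) : |dbl u x a b - A b a| ≤ M * ‖a‖ * ‖b‖ := by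
  have na := norm_nonneg a
  have nb := norm_nonneg b
  have cd : ∀ q ∈ ball x r, ContDiffAt ℝ 2 u q := fun q hq => (hu q hq).contDiffAt (isOpen_ball.mem_nhds hq)
  have mb : ∀ v : E n, ∀ y ∈ ball x (r - ‖b‖), ‖v‖ ≤ ‖b‖ → y + v ∈ ball x r := fun v y hy hv => by
    rw [mem_ball, dist_eq_norm] at *
    have : y + v - x = (y - x) + v := by abel
    rw [this]; linarith [norm_add_le (y - x) v]
  have s1 : ∀ y ∈ ball x (r - ‖b‖), ‖fderiv ℝ u (y + b) - fderiv ℝ u y - A b‖ ≤ M * ‖b‖ := by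
    intro y hy
    have y0 : y ∈ ball x r := by simpa using mb 0 y hy (by simp)
    have := (convex_ball x r).norm_image_sub_le_of_norm_hasFDerivWithin_le (𝕜 := ℝ) (f := fun q => fderiv ℝ u q - A q)
      (f' := fun q => D2 u q - A) (C := M) (x := y) (y := y + b)
      (fun q hq => ((hasFDerivAt_D2 (cd q hq)).sub A.hasFDerivAt).hasFDerivWithinAt) hM y0 (mb b y hy le_rfl)
    rw [add_sub_cancel_left] at this
    refine le_trans (le_of_eq ?_) this
    congr 1
    rw [map_add]; abel
  have hda : ∀ y ∈ ball x (r - ‖b‖), HasFDerivAt (fun y => u (y + b) - u y - A b y)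
      (fderiv ℝ u (y + b) - fderiv ℝ u y - A b) y := fun y hy => by
    have y0 : y ∈ ball x r := by simpa using mb 0 y hy (by simp)
    refine HasFDerivAt.sub (HasFDerivAt.sub ?_ ?_) (A b).hasFDerivAt
    · have := ((cd _ (mb b y hy le_rfl)).differentiableAt (by norm_num)).hasFDerivAt
      exact (hasFDerivAt_comp_add_right b).2 this
    · exact ((cd _ y0).differentiableAt (by norm_num)).hasFDerivAt
  have := (convex_ball x (r - ‖b‖)).norm_image_sub_le_of_norm_hasFDerivWithin_le (𝕜 := ℝ) (C := M * ‖b‖) (x := x) (y := x + a)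
    (fun y hy => (hda y hy).hasFDerivWithinAt) s1 (by simp; linarith) (by simp; linarith)
  rw [add_sub_cancel_left, Real.norm_eq_abs] at this
  refine le_trans (le_of_eq ?_) (this.trans (le_of_eq (by ring)))
  congr 1
  simp only [dbl, map_add]; ring

lemma D2_poly {n : ℕ} {g : E n → ℝ} {z e : E n} (h : ContDiff ℝ 2 g) (k0 k1 k2 k3 : ℝ)
    (hg : ∀ τ : ℝ, g (z + τ • e) = k0 + k1 * τ + k2 * τ ^ 2 + k3 * τ ^ 3) : D2 g z e e = 2 * k2 := by
  refine D2_of_line h (G1 := fun τ => k1 + k2 * (2 * τ) + k3 * (3 * τ ^ 2)) (fun τ => ?_) ?_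
  · simp only [hg]
    have := (((hasDerivAt_const τ k0).add ((hasDerivAt_id τ).const_mul k1)).add
      ((hasDerivAt_pow 2 τ).const_mul k2)).add ((hasDerivAt_pow 3 τ).const_mul k3)
    refine this.congr_deriv ?_
    norm_num
  · have := ((hasDerivAt_const (0:ℝ) k1).add (((hasDerivAt_id (0:ℝ)).const_mul 2).const_mul k2)).add
      (((hasDerivAt_pow 2 (0:ℝ)).const_mul 3).const_mul k3)
    refine this.congr_deriv ?_
    norm_num
    ring

lemma lap_sub_at {n : ℕ} {f g : E n → ℝ} {z : E n} (hf : ContDiffAt ℝ 2 f z) (hg : ContDiff ℝ 2 g) :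
    lap n (fun z => f z - g z) z = lap n f z - lap n g z := by
  have e : fderiv ℝ (fun z => f z - g z) =ᶠ[𝓝 z] fun z => fderiv ℝ f z - fderiv ℝ g z := by
    filter_upwards [hf.eventually (by simp)] with y hy
    exact fderiv_fun_sub (hy.differentiableAt (by norm_num)) (hg.differentiable (by norm_num) y)
  have : D2 (fun z => f z - g z) z = D2 f z - D2 g z := by
    unfold D2
    rw [e.fderiv_eq]
    exact fderiv_fun_sub (hasFDerivAt_D2 hf).differentiableAt (hasFDerivAt_D2 hg.contDiffAt).differentiableAt
  simp only [lap_eq, this, sub_apply, Finset.sum_sub_distrib]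

/-- cubic polynomial -/
def Pl {n : ℕ} (p : E n) (c0 : ℝ) (c : E n →L[ℝ] ℝ) (A : E n →L[ℝ] E n →L[ℝ] ℝ) (b : E n) (z : E n) : ℝ :=
  c0 + c (z - p) + 1 / 2 * A (z - p) (z - p) + ‖z - p‖ ^ 2 * inner ℝ b (z - p)

lemma Pl_smooth {n : ℕ} (p : E n) (c0 : ℝ) (c : E n →L[ℝ] ℝ) (A : E n →L[ℝ] E n →L[ℝ] ℝ) (b : E n) :
    ContDiff ℝ 2 (Pl p c0 c A b) := by
  unfold Pl
  have h : ContDiff ℝ 2 (fun z : E n => z - p) := by fun_prop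
  refine ((contDiff_const.add (c.contDiff.comp h)).add (contDiff_const.mul ?_)).add
    ((h.norm_sq ℝ).mul (contDiff_const.inner ℝ h))
  exact (A.contDiff.comp h).clm_apply h

lemma Pl_line {n : ℕ} (p : E n) (c0 : ℝ) (c : E n →L[ℝ] ℝ) (A : E n →L[ℝ] E n →L[ℝ] ℝ) (b z e : E n) :
    D2 (Pl p c0 c A b) z e e = A e e + 2 * (‖e‖ ^ 2 * inner ℝ b (z - p)) + 4 * (inner ℝ (z - p) e * inner ℝ b e) := by
  rw [D2_poly (Pl_smooth p c0 c A b) (Pl p c0 c A b z)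
    (c e + 1 / 2 * (A (z - p) e + A e (z - p)) + 2 * inner ℝ (z - p) e * inner ℝ b (z - p) + ‖z - p‖ ^ 2 * inner ℝ b e)
    (1 / 2 * A e e + ‖e‖ ^ 2 * inner ℝ b (z - p) + 2 * inner ℝ (z - p) e * inner ℝ b e) (‖e‖ ^ 2 * inner ℝ b e)]
  · ring
  · intro τ
    unfold Pl
    rw [show z + τ • e - p = (z - p) + τ • e by abel]
    generalize z - p = ζ
    rw [@norm_add_sq_real]
    simp only [map_add, map_smul, add_apply, smul_apply, smul_eq_mul,
      inner_add_right, real_inner_smul_right, norm_smul, mul_pow, Real.norm_eq_abs, sq_abs]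
    ring

lemma Pl_lap {n : ℕ} (p : E n) (c0 : ℝ) (c : E n →L[ℝ] ℝ) (A : E n →L[ℝ] E n →L[ℝ] ℝ) (b z : E n) :
    lap n (Pl p c0 c A b) z = ∑ i, A (ee i) (ee i) + (2 * n + 4) * inner ℝ b (z - p) := by
  rw [lap_eq]
  simp only [Pl_line, norm_ee, Finset.sum_add_distrib, ← Finset.mul_sum]
  rw [sum_inner_ee, real_inner_comm]
  simp
  ring

lemma Pl_tri {n : ℕ} (p : E n) (c0 : ℝ) (c : E n →L[ℝ] ℝ) (A : E n →L[ℝ] E n →L[ℝ] ℝ) (b x y a a' : E n) :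
    |dbl (Pl p c0 c A b) y a a' - dbl (Pl p c0 c A b) x a a'| ≤ 6 * ‖b‖ * ‖a‖ * ‖a'‖ * ‖y - x‖ := by
  have e : dbl (Pl p c0 c A b) y a a' - dbl (Pl p c0 c A b) x a a' =
      2 * (inner ℝ a a' * inner ℝ b (y - x)) + 2 * (inner ℝ a (y - x) * inner ℝ b a')
      + 2 * (inner ℝ a' (y - x) * inner ℝ b a) := by
    simp only [dbl, Pl]
    obtain ⟨f, rfl⟩ : ∃ f, y = x + f := ⟨y - x, by abel⟩
    obtain ⟨ζ, rfl⟩ : ∃ ζ, x = p + ζ := ⟨x - p, by abel⟩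
    rw [show p + ζ + f + a + a' - p = ζ + f + a + a' by abel, show p + ζ + f + a - p = ζ + f + a by abel,
      show p + ζ + f + a' - p = ζ + f + a' by abel, show p + ζ + f - p = ζ + f by abel,
      show p + ζ + a + a' - p = ζ + a + a' by abel, show p + ζ + a - p = ζ + a by abel,
      show p + ζ + a' - p = ζ + a' by abel, show p + ζ - p = ζ by abel, add_sub_cancel_left]
    simp only [← real_inner_self_eq_norm_sq, inner_add_left, inner_add_right, map_add, add_apply,
      real_inner_comm ζ f, real_inner_comm ζ a, real_inner_comm ζ a', real_inner_comm a f, real_inner_comm a' f,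
      real_inner_comm a a']
    ring
  rw [e]
  have i1 := abs_real_inner_le_norm a a'
  have i2 := abs_real_inner_le_norm b (y - x)
  have i3 := abs_real_inner_le_norm a (y - x)
  have i4 := abs_real_inner_le_norm b a'
  have i5 := abs_real_inner_le_norm a' (y - x)
  have i6 := abs_real_inner_le_norm b a
  have j1 := mul_le_mul i1 i2 (abs_nonneg _) (by positivity)
  have j2 := mul_le_mul i3 i4 (abs_nonneg _) (by positivity)
  have j3 := mul_le_mul i5 i6 (abs_nonneg _) (by positivity)
  rw [← abs_mul] at j1 j2 j3
  have k1 := abs_le.1 j1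
  have k2 := abs_le.1 j2
  have k3 := abs_le.1 j3
  rw [abs_le]
  constructor <;> linarith


lemma poly_vanish {k1 k2 M Q α s0 : ℝ} (hα : 0 < α) (hs0 : 0 < s0) {q : ℝ → ℝ}
    (hq : ∀ s, 0 < s → s < s0 → |q s| ≤ Q)
    (h : ∀ s, 0 < s → s < s0 → |k1 * s + k2 * s ^ 2 + s ^ 3 * q s| ≤ M * (s ^ 2 * s ^ α)) : k1 = 0 ∧ k2 = 0 := by
  have ev : ∀ᶠ s : ℝ in 𝓝[>] 0, 0 < s ∧ s < s0 := Ioo_mem_nhdsGT hs0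
  have tid : Tendsto (fun s : ℝ => s) (𝓝[>] 0) (𝓝 0) := tendsto_nhdsWithin_of_tendsto_nhds tendsto_id
  have ta : Tendsto (fun s : ℝ => s ^ α) (𝓝[>] 0) (𝓝 0) := by
    have := tid.rpow_const (p := α) (Or.inr hα.le)
    rwa [Real.zero_rpow hα.ne'] at this
  have h1 : k1 = 0 := by
    have t1 : Tendsto (fun s : ℝ => M * (s * s ^ α) + |k2| * s + s ^ 2 * Q) (𝓝[>] 0) (𝓝 (M * (0 * 0) + |k2| * 0 + 0 ^ 2 * Q)) :=
      (((tid.mul ta).const_mul M).add (tid.const_mul _)).add ((tid.pow 2).mul_const Q)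
    have : |k1| ≤ M * (0 * 0) + |k2| * 0 + 0 ^ 2 * Q := by
      refine ge_of_tendsto t1 ?_
      filter_upwards [ev] with s ⟨hs, hs1⟩
      have a1 := h s hs hs1
      have a2 : |s ^ 3 * q s| ≤ s ^ 3 * Q := by
        rw [abs_mul, abs_of_pos (by positivity)]; gcongr; exact hq s hs hs1
      have a3 : |k2 * s ^ 2| = |k2| * s ^ 2 := by rw [abs_mul, abs_of_pos (by positivity : 0 < s ^ 2)]
      have a4 : |k1 * s| = |k1| * s := by rw [abs_mul, abs_of_pos hs]
      have a5 : |k1 * s| ≤ |k1 * s + k2 * s ^ 2 + s ^ 3 * q s| + |k2 * s ^ 2| + |s ^ 3 * q s| := by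
        have := abs_sub (k1 * s + k2 * s ^ 2 + s ^ 3 * q s - k2 * s ^ 2) (s ^ 3 * q s)
        have := abs_sub (k1 * s + k2 * s ^ 2 + s ^ 3 * q s) (k2 * s ^ 2)
        rw [show k1 * s = k1 * s + k2 * s ^ 2 + s ^ 3 * q s - k2 * s ^ 2 - s ^ 3 * q s by ring]
        rw [show k1 * s + k2 * s ^ 2 + s ^ 3 * q s - k2 * s ^ 2 - s ^ 3 * q s + k2 * s ^ 2 + s ^ 3 * q s =
          k1 * s + k2 * s ^ 2 + s ^ 3 * q s by ring]
        linarith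
      rw [a4, a3] at a5
      have : |k1| * s ≤ (M * (s * s ^ α) + |k2| * s + s ^ 2 * Q) * s := by nlinarith
      exact le_of_mul_le_mul_right this hs
    have : |k1| ≤ 0 := by simpa using this
    exact abs_eq_zero.1 (le_antisymm this (abs_nonneg _))
  refine ⟨h1, ?_⟩
  subst h1
  have t1 : Tendsto (fun s : ℝ => M * s ^ α + s * Q) (𝓝[>] 0) (𝓝 (M * 0 + 0 * Q)) :=
    (ta.const_mul M).add (tid.mul_const Q)
  have : |k2| ≤ M * 0 + 0 * Q := by
    refine ge_of_tendsto t1 ?_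
    filter_upwards [ev] with s ⟨hs, hs1⟩
    have a1 := h s hs hs1
    have a2 : |s ^ 3 * q s| ≤ s ^ 3 * Q := by
      rw [abs_mul, abs_of_pos (by positivity)]; gcongr; exact hq s hs hs1
    have a3 : |k2 * s ^ 2| = |k2| * s ^ 2 := by rw [abs_mul, abs_of_pos (by positivity : 0 < s ^ 2)]
    have a5 := abs_sub (0 * s + k2 * s ^ 2 + s ^ 3 * q s) (s ^ 3 * q s)
    rw [show 0 * s + k2 * s ^ 2 + s ^ 3 * q s - s ^ 3 * q s = k2 * s ^ 2 by ring, a3] at a5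
    have : |k2| * s ^ 2 ≤ (M * s ^ α + s * Q) * s ^ 2 := by nlinarith
    exact le_of_mul_le_mul_right this (by positivity)
  have : |k2| ≤ 0 := by simpa using this
  exact abs_eq_zero.1 (le_antisymm this (abs_nonneg _))

lemma sphere_jet {n : ℕ} {R r H α : ℝ} {p : E n} (hR : 0 < R) (hp : ‖p‖ = R) (hr : 0 < r) (hα : 0 < α) (hH : 0 ≤ H)
    {c : E n →L[ℝ] ℝ} {A : E n →L[ℝ] E n →L[ℝ] ℝ}
    (h : ∀ z, ‖z‖ = R → ‖z - p‖ < r → |c (z - p) + 1 / 2 * A (z - p) (z - p)| ≤ H * (‖z - p‖ ^ α * ‖z - p‖ ^ 2))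
    {τ : E n} (hτ : inner ℝ p τ = 0) (hτR : ‖τ‖ = R) : c τ = 0 ∧ A τ τ = c p := by
  have hs0 : 0 < min 1 (r / (4 * R)) := by positivity
  have key := poly_vanish (k1 := 2 * c τ) (k2 := -2 * c p + 2 * A τ τ) (M := 4 * H * ((4 * R) ^ α * (4 * R) ^ 2))
    (Q := 2 * |c τ| + 2 * |c p| + 2 * |A τ p + A p τ| + 2 * |A p p|) (α := α) hα hs0
    (q := fun s => 2 * c τ - 2 * s * c p - 2 * (A τ p + A p τ) + 2 * s * A p p) (fun s hs hs1 => by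
      have h1 : s ≤ 1 := (hs1.trans_le (min_le_left _ _)).le
      have b1 : |2 * c τ| = 2 * |c τ| := by rw [abs_mul, abs_two]
      have b2 : |2 * s * c p| ≤ 2 * |c p| := by
        rw [abs_mul, abs_of_pos (by positivity : 0 < 2 * s)]; gcongr; linarith
      have b3 : |2 * (A τ p + A p τ)| = 2 * |A τ p + A p τ| := by rw [abs_mul, abs_two]
      have b4 : |2 * s * A p p| ≤ 2 * |A p p| := by
        rw [abs_mul, abs_of_pos (by positivity : 0 < 2 * s)]; gcongr; linarith
      have c1 := abs_add_le (2 * c τ - 2 * s * c p - 2 * (A τ p + A p τ)) (2 * s * A p p)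
      have c2 := abs_sub (2 * c τ - 2 * s * c p) (2 * (A τ p + A p τ))
      have c3 := abs_sub (2 * c τ) (2 * s * c p)
      linarith) (fun s hs hs1 => by
      have h1 : s ≤ 1 := (hs1.trans_le (min_le_left _ _)).le
      have h2 : s < r / (4 * R) := hs1.trans_le (min_le_right _ _)
      rw [lt_div_iff₀ (by positivity)] at h2
      set ζ : E n := (2 * s / (1 + s ^ 2)) • (τ - s • p) with hζ
      have hd : 0 < 1 + s ^ 2 := by positivity
      have nτ : ‖τ - s • p‖ ^ 2 = R ^ 2 * (1 + s ^ 2) := by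
        rw [@norm_sub_sq_real, norm_smul, real_inner_smul_right, real_inner_comm, hτ, hτR, hp, mul_pow,
          Real.norm_eq_abs, sq_abs]; ring
      have nz : ‖p + ζ‖ = R := by
        have : ‖p + ζ‖ ^ 2 = R ^ 2 := by
          rw [@norm_add_sq_real, hζ, norm_smul, real_inner_smul_right, inner_sub_right, hτ, real_inner_smul_right,
            real_inner_self_eq_norm_sq, hp, mul_pow, nτ, Real.norm_eq_abs, sq_abs]
          field_simp
          ring
        exact (pow_left_inj₀ (norm_nonneg _) hR.le two_ne_zero).1 this
      have nζ : ‖ζ‖ ≤ 4 * R * s := by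
        have t1 : ‖τ - s • p‖ ≤ 2 * R := by
          have := norm_sub_le τ (s • p)
          rw [norm_smul, hτR, hp, Real.norm_eq_abs, abs_of_pos hs] at this
          nlinarith
        rw [hζ, norm_smul, Real.norm_eq_abs, abs_of_pos (by positivity)]
        have t2 : 2 * s / (1 + s ^ 2) ≤ 2 * s := div_le_self (by positivity) (by nlinarith)
        calc _ ≤ 2 * s * (2 * R) := by gcongr
          _ = _ := by ring
      have hh := h (p + ζ) nz (by rw [add_sub_cancel_left]; linarith)
      rw [add_sub_cancel_left] at hh
      have e1 : 2 * c τ * s + (-2 * c p + 2 * A τ τ) * s ^ 2 +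
          s ^ 3 * (2 * c τ - 2 * s * c p - 2 * (A τ p + A p τ) + 2 * s * A p p) =
          (1 + s ^ 2) ^ 2 * (c ζ + 1 / 2 * A ζ ζ) := by
        rw [hζ]
        simp only [map_smul, map_sub, smul_apply, sub_apply, smul_eq_mul]
        field_simp
        ring
      rw [e1, abs_mul, abs_of_pos (by positivity)]
      have e2 : ‖ζ‖ ^ α * ‖ζ‖ ^ 2 ≤ ((4 * R) ^ α * (4 * R) ^ 2) * (s ^ 2 * s ^ α) := by
        calc _ ≤ (4 * R * s) ^ α * (4 * R * s) ^ 2 := by gcongr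
          _ = _ := by rw [Real.mul_rpow (by positivity) hs.le]; ring
      calc _ ≤ 4 * (H * (((4 * R) ^ α * (4 * R) ^ 2) * (s ^ 2 * s ^ α))) := by
            gcongr
            · have : s ^ 2 ≤ 1 := pow_le_one₀ hs.le h1
              nlinarith [sq_nonneg s]
            · exact hh.trans (by gcongr)
        _ = _ := by ring)
  constructor
  · linarith [key.1]
  · linarith [key.2]

lemma sphere_b {n : ℕ} {R r H α β : ℝ} {p : E n} (hR : 0 < R) (hp : ‖p‖ = R) (hr : 0 < r) (hα : 0 < α) (hH : 0 ≤ H)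
    {c : E n →L[ℝ] ℝ} {A : E n →L[ℝ] E n →L[ℝ] ℝ} (hc : ‖c‖ ≤ β * R ^ 2) (hA : ‖A‖ ≤ β * R) (hβ : 0 ≤ β)
    (h : ∀ z, ‖z‖ = R → ‖z - p‖ < r → |c (z - p) + 1 / 2 * A (z - p) (z - p)| ≤ H * (‖z - p‖ ^ α * ‖z - p‖ ^ 2)) :
    ∃ b : E n, ‖b‖ ≤ 2 * β ∧ ∀ z, ‖z‖ = R → Pl p 0 c A b z = 0 := by
  have perp : ∀ τ : E n, inner ℝ p τ = 0 → c τ = 0 ∧ R ^ 2 * A τ τ = ‖τ‖ ^ 2 * c p := by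
    intro τ hτ
    by_cases h0 : τ = 0
    · simp [h0]
    have hn : 0 < ‖τ‖ := norm_pos_iff.2 h0
    obtain ⟨h1, h2⟩ := sphere_jet hR hp hr hα hH h (τ := (R / ‖τ‖) • τ) (by rw [real_inner_smul_right, hτ, mul_zero])
      (by rw [norm_smul, Real.norm_eq_abs, abs_of_pos (by positivity)]; field_simp)
    simp only [map_smul, smul_apply, smul_eq_mul] at h1 h2
    constructor
    · exact (mul_eq_zero.1 h1).resolve_left (by positivity)
    · rw [← h2]; field_simp
  set a := c p / (2 * R ^ 2) with ha
  set Qp := 1 / 2 * A p p - a * R ^ 2 with hQ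
  set ℓ : E n →L[ℝ] ℝ := (1 / (2 * R ^ 2)) • ((1 / 2 : ℝ) • (A p + A.flip p) - (2 * a + Qp / R ^ 2) • innerSL ℝ p) with hℓ
  have bp : |c p| ≤ β * R ^ 3 := by
    have := c.le_opNorm p
    rw [hp, Real.norm_eq_abs] at this
    refine this.trans ?_
    calc _ ≤ β * R ^ 2 * R := by gcongr
      _ = _ := by ring
  have ba : |a| ≤ β * R / 2 := by
    rw [ha, abs_div, abs_of_pos (by positivity : 0 < 2 * R ^ 2), div_le_iff₀ (by positivity)]
    refine bp.trans (le_of_eq ?_); ring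
  have bA : |A p p| ≤ β * R ^ 3 := by
    have := A.le_opNorm₂ p p
    rw [hp, Real.norm_eq_abs] at this
    refine this.trans ?_
    calc _ ≤ β * R * R * R := by gcongr
      _ = _ := by ring
  have bQ : |Qp| ≤ β * R ^ 3 := by
    have h1 := abs_le.1 bA
    have h2 := abs_le.1 ba
    rw [hQ, abs_le]
    constructor <;> nlinarith [sq_nonneg R]
  have bl : ‖ℓ‖ ≤ 2 * β := by
    have h1 : ‖A p + A.flip p‖ ≤ 2 * (β * R ^ 2) := by
      have i1 := A.le_opNorm p
      have i2 := A.flip.le_opNorm p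
      rw [ContinuousLinearMap.opNorm_flip] at i2
      rw [hp] at i1 i2
      have : ‖A‖ * R ≤ β * R ^ 2 := by nlinarith
      linarith [norm_add_le (A p) (A.flip p)]
    have h2 : |2 * a + Qp / R ^ 2| ≤ 2 * β * R := by
      have : |Qp / R ^ 2| ≤ β * R := by
        rw [abs_div, abs_of_pos (by positivity : 0 < R ^ 2), div_le_iff₀ (by positivity)]
        refine bQ.trans (le_of_eq ?_); ring
      have j1 := abs_le.1 this
      have j2 := abs_le.1 ba
      rw [abs_le]; constructor <;> linarith
    rw [hℓ, norm_smul, Real.norm_eq_abs, abs_of_pos (by positivity)]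
    have h3 : ‖(1 / 2 : ℝ) • (A p + A.flip p) - (2 * a + Qp / R ^ 2) • innerSL ℝ p‖ ≤ β * R ^ 2 + 2 * β * R * R := by
      refine (norm_sub_le _ _).trans ?_
      rw [norm_smul, norm_smul, innerSL_apply_norm, hp, Real.norm_eq_abs, Real.norm_eq_abs, abs_of_pos (by norm_num : (0:ℝ) < 1 / 2)]
      refine add_le_add (by linarith) (by gcongr)
    calc _ ≤ 1 / (2 * R ^ 2) * (β * R ^ 2 + 2 * β * R * R) := by gcongr
      _ = 3 / 2 * β := by field_simp; ring
      _ ≤ _ := by linarith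
  refine ⟨(InnerProductSpace.toDual ℝ (E n)).symm ℓ, by rw [LinearIsometryEquiv.norm_map]; exact bl, fun z hz => ?_⟩
  unfold Pl
  rw [InnerProductSpace.toDual_symm_apply]
  obtain ⟨ζ, rfl⟩ : ∃ ζ, z = p + ζ := ⟨z - p, by abel⟩
  rw [add_sub_cancel_left]
  set s := inner ℝ p ζ / R ^ 2 with hs
  have hsp : inner ℝ p ζ = s * R ^ 2 := by rw [hs]; field_simp
  obtain ⟨k1, k2⟩ := perp (ζ - s • p) (by
    rw [inner_sub_right, real_inner_smul_right, real_inner_self_eq_norm_sq, hp, hsp]; ring)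
  have hN : ‖ζ‖ ^ 2 = -2 * (s * R ^ 2) := by
    have : ‖p + ζ‖ ^ 2 = R ^ 2 := by rw [hz]
    rw [@norm_add_sq_real, hp, hsp] at this; linarith
  have hcp : c p = 2 * R ^ 2 * a := by rw [ha]; field_simp
  rw [@norm_sub_sq_real, real_inner_smul_right, real_inner_comm, hsp, norm_smul, hp, Real.norm_eq_abs, mul_pow, sq_abs, hcp] at k2
  simp only [map_smul, map_sub, smul_apply, sub_apply, smul_eq_mul] at k1 k2
  rw [hcp] at k1
  have k3 : A ζ ζ - s * (A ζ p + A p ζ) + s ^ 2 * A p p = 2 * a * (‖ζ‖ ^ 2 - s ^ 2 * R ^ 2) := by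
    have h9 : (R ^ 2) ≠ 0 := by positivity
    apply mul_left_cancel₀ h9
    linarith
  have hl : ℓ ζ = 1 / (2 * R ^ 2) * (1 / 2 * (A p ζ + A ζ p) - (2 * a + Qp / R ^ 2) * (s * R ^ 2)) := by
    rw [hℓ]
    simp [hsp]
    left; ring
  have hl2 : 2 * R ^ 2 * ℓ ζ = 1 / 2 * (A p ζ + A ζ p) - (2 * a * R ^ 2 + Qp) * s := by
    rw [hl]; field_simp
  rw [hN]
  rw [hN] at k3
  have : -2 * (s * R ^ 2) * ℓ ζ = - s * (2 * R ^ 2 * ℓ ζ) := by ring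
  rw [this, hl2, hQ]
  linear_combination k1 + 1 / 2 * k3

section


def Om {n : ℕ} (R : ℝ) (x0 : E n) : Set (E n) := ball x0 (‖x0‖ / 2) ∩ ball 0 R

lemma Om_open {n : ℕ} (R : ℝ) (x0 : E n) : IsOpen (Om R x0) := isOpen_ball.inter isOpen_ball
lemma Om_convex {n : ℕ} (R : ℝ) (x0 : E n) : Convex ℝ (Om R x0) := (convex_ball _ _).inter (convex_ball _ _)
lemma mem_Om {n : ℕ} {R : ℝ} {x0 z : E n} : z ∈ Om R x0 ↔ ‖z - x0‖ < ‖x0‖ / 2 ∧ ‖z‖ < R := by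
  simp [Om, dist_eq_norm]

structure Loc {n : ℕ} (R : ℝ) (x0 : E n) (u : E n → ℝ) (α H G β : ℝ) : Prop where
  pos : 0 < ‖x0‖
  lt : ‖x0‖ < R
  hH : 0 ≤ H
  hG : 0 ≤ G
  hβ : 0 ≤ β
  cd : ContDiffOn ℝ 2 u (Om R x0)
  hol : ∀ z ∈ Om R x0, ∀ z' ∈ Om R x0, ‖D2 u z - D2 u z'‖ ≤ H * ‖z - z'‖ ^ α
  lapl : ∀ z ∈ Om R x0, ∀ z' ∈ Om R x0, |lap n u z - lap n u z'| ≤ G * ‖z - z'‖ ^ α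
  d2 : ∀ z ∈ Om R x0, ‖D2 u z‖ ≤ β * ‖x0‖
  d1 : ∀ z ∈ Om R x0, ‖fderiv ℝ u z‖ ≤ β * ‖x0‖ ^ 2
  bd : R < 2 * ‖x0‖ → ∀ z ∈ Om R x0, |u z| ≤ β * ‖x0‖ ^ 2 * (R - ‖z‖)

def Jet {n : ℕ} (S : Set (E n)) (u : E n → ℝ) (α H G : ℝ) (p : E n) (c0 : ℝ) (c : E n →L[ℝ] ℝ)
    (A : E n →L[ℝ] E n →L[ℝ] ℝ) : Prop :=
  ∀ z ∈ S, |u z - c0 - c (z - p) - 1 / 2 * A (z - p) (z - p)| ≤ H * (‖z - p‖ ^ α * ‖z - p‖ ^ 2) ∧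
    |lap n u z - ∑ i, A (ee i) (ee i)| ≤ G * ‖z - p‖ ^ α

variable {n : ℕ} {R α H G β : ℝ} {x0 : E n} {u : E n → ℝ}

lemma jet_int (hα : 0 < α) (L : Loc R x0 u α H G β) {p : E n} (hp : p ∈ Om R x0) :
    Jet (Om R x0) u α H G p (u p) (fderiv ℝ u p) (D2 u p) := by
  intro z hz
  constructor
  · have := taylor (Om_open R x0) (Om_convex R x0) L.cd hp hz (A := D2 u p) (M := H * ‖z - p‖ ^ α) (fun q hq hqz => by
      refine (L.hol q hq p hp).trans ?_
      have := L.hH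
      gcongr)
    rw [← mul_assoc]; exact this
  · have := L.lapl z hz p hp
    rwa [lap_eq u p] at this

lemma tclm {ι X F : Type*} [NormedAddCommGroup X] [NormedSpace ℝ X] [NormedAddCommGroup F] [NormedSpace ℝ F] {l : Filter ι}
    {f : ι → X →L[ℝ] F} {g : ι → X} {f0 : X →L[ℝ] F} {g0 : X} (hf : Tendsto f l (𝓝 f0)) (hg : Tendsto g l (𝓝 g0)) :
    Tendsto (fun i => f i (g i)) l (𝓝 (f0 g0)) :=
  (isBoundedBilinearMap_apply.continuous.tendsto (f0, g0)).comp (hf.prodMk_nhds hg)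

lemma tendsto_ev {F : Type*} [NormedAddCommGroup F] {f : ℕ → F} {a : F} (h : Tendsto f atTop (𝓝 a)) {B : ℝ}
    (hB : ∀ k, ‖f k‖ ≤ B) : ‖a‖ ≤ B := le_of_tendsto' h.norm hB

set_option maxSynthPendingDepth 10 in
lemma jet_bd (hα : 0 < α) (L : Loc R x0 u α H G β) (hR : R - ‖x0‖ < ‖x0‖ / 2) :
    ∃ c A, ‖c‖ ≤ β * ‖x0‖ ^ 2 ∧ ‖A‖ ≤ β * ‖x0‖ ∧ Jet (Om R x0) u α H G ((R / ‖x0‖) • x0) 0 c A := by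
  have hρ := L.pos
  have hlt := L.lt
  set p := (R / ‖x0‖) • x0 with hp
  set s : ℕ → ℝ := fun k => (R - ‖x0‖) / ((k : ℝ) + 1) with hs
  have s0 : Tendsto s atTop (𝓝 0) := by
    have := (tendsto_one_div_add_atTop_nhds_zero_nat (𝕜 := ℝ)).const_mul (R - ‖x0‖)
    rw [mul_zero] at this
    refine this.congr fun k => ?_
    simp only [hs]; ring
  have sp : ∀ k, 0 < s k := fun k => div_pos (by linarith) (by positivity)
  have sle : ∀ k, s k ≤ R - ‖x0‖ := fun k => div_le_self (by linarith) (by linarith [Nat.cast_nonneg (α := ℝ) k])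
  set q : ℕ → E n := fun k => ((R - s k) / ‖x0‖) • x0 with hq
  have nq : ∀ k, ‖q k‖ = R - s k := fun k => by
    have : 0 ≤ R - s k := by linarith [sle k]
    simp only [hq]
    rw [norm_smul, Real.norm_eq_abs, abs_of_nonneg (by positivity)]; field_simp
  have mq : ∀ k, q k ∈ Om R x0 := fun k => by
    rw [mem_Om, nq]
    refine ⟨?_, by linarith [sp k]⟩
    have : q k - x0 = ((R - s k - ‖x0‖) / ‖x0‖) • x0 := by
      simp only [hq]
      rw [show (R - s k - ‖x0‖) / ‖x0‖ = (R - s k) / ‖x0‖ - 1 by field_simp]; module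
    rw [this, norm_smul, Real.norm_eq_abs, abs_of_nonneg (div_nonneg (by linarith [sle k]) hρ.le)]
    rw [div_mul_cancel₀ _ hρ.ne']; linarith [sp k]
  have qp : Tendsto q atTop (𝓝 p) := by
    have : Tendsto (fun k => ((R - s k) / ‖x0‖) • x0) atTop (𝓝 (((R - 0) / ‖x0‖) • x0)) :=
      ((tendsto_const_nhds.sub s0).div_const _).smul_const _
    simpa using this
  have u0 : Tendsto (fun k => u (q k)) atTop (𝓝 0) := by
    refine squeeze_zero_norm (a := fun k => β * ‖x0‖ ^ 2 * s k) (fun k => ?_) ?_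
    · have := L.bd (by linarith) (q k) (mq k)
      rw [nq] at this
      simpa using this
    · simpa using s0.const_mul (β * ‖x0‖ ^ 2)
  haveI : ProperSpace (E n →L[ℝ] ℝ) := FiniteDimensional.proper ℝ (E n →L[ℝ] ℝ)
  haveI : ProperSpace (E n →L[ℝ] E n →L[ℝ] ℝ) := FiniteDimensional.proper ℝ (E n →L[ℝ] E n →L[ℝ] ℝ)
  obtain ⟨⟨c, A⟩, -, φ, hφ, hlim⟩ := tendsto_subseq_of_bounded
    (isBounded_closedBall (x := (0 : (E n →L[ℝ] ℝ) × (E n →L[ℝ] E n →L[ℝ] ℝ))) (r := max (β * ‖x0‖ ^ 2) (β * ‖x0‖)))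
    (x := fun k => (fderiv ℝ u (q k), D2 u (q k))) (fun k => by
      rw [mem_closedBall_zero_iff, Prod.norm_def]
      exact max_le_max (L.d1 _ (mq k)) (L.d2 _ (mq k)))
  have hc : Tendsto (fun k => fderiv ℝ u (q (φ k))) atTop (𝓝 c) := (continuous_fst.tendsto _).comp hlim
  have hA : Tendsto (fun k => D2 u (q (φ k))) atTop (𝓝 A) := (continuous_snd.tendsto _).comp hlim
  have hq' : Tendsto (fun k => q (φ k)) atTop (𝓝 p) := qp.comp hφ.tendsto_atTop
  have hu' : Tendsto (fun k => u (q (φ k))) atTop (𝓝 0) := u0.comp hφ.tendsto_atTop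
  refine ⟨c, A, tendsto_ev hc fun k => L.d1 _ (mq _), tendsto_ev hA fun k => L.d2 _ (mq _), fun z hz => ?_⟩
  have tz : Tendsto (fun k => z - q (φ k)) atTop (𝓝 (z - p)) := tendsto_const_nhds.sub hq'
  have tn : Tendsto (fun k => ‖z - q (φ k)‖ ^ α) atTop (𝓝 (‖z - p‖ ^ α)) := tz.norm.rpow_const (Or.inr hα.le)
  constructor
  · have l1 : Tendsto (fun k => |u z - u (q (φ k)) - fderiv ℝ u (q (φ k)) (z - q (φ k)) -
        1 / 2 * D2 u (q (φ k)) (z - q (φ k)) (z - q (φ k))|) atTop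
        (𝓝 |u z - 0 - c (z - p) - 1 / 2 * A (z - p) (z - p)|) :=
      (((tendsto_const_nhds.sub hu').sub (tclm hc tz)).sub ((tclm (tclm hA tz) tz).const_mul _)).abs
    exact le_of_tendsto_of_tendsto' l1 ((tn.mul (tz.norm.pow 2)).const_mul H) fun k => (jet_int hα L (mq (φ k)) z hz).1
  · have l1 : Tendsto (fun k => |lap n u z - ∑ i, D2 u (q (φ k)) (ee i) (ee i)|) atTop
        (𝓝 |lap n u z - ∑ i, A (ee i) (ee i)|) :=
      (tendsto_const_nhds.sub (tendsto_finsetSum _ fun i _ =>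
        tclm (tclm hA tendsto_const_nhds) tendsto_const_nhds)).abs
    exact le_of_tendsto_of_tendsto' l1 (tn.const_mul G) fun k => (jet_int hα L (mq (φ k)) z hz).2

lemma jet_sphere (hα : 0 < α) (L : Loc R x0 u α H G β) (hR : R - ‖x0‖ < ‖x0‖ / 4) {c : E n →L[ℝ] ℝ}
    {A : E n →L[ℝ] E n →L[ℝ] ℝ} (J : Jet (Om R x0) u α H G ((R / ‖x0‖) • x0) 0 c A) (z : E n) (hz : ‖z‖ = R)
    (hzp : ‖z - (R / ‖x0‖) • x0‖ < ‖x0‖ / 4) :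
    |c (z - (R / ‖x0‖) • x0) + 1 / 2 * A (z - (R / ‖x0‖) • x0) (z - (R / ‖x0‖) • x0)| ≤
      H * (‖z - (R / ‖x0‖) • x0‖ ^ α * ‖z - (R / ‖x0‖) • x0‖ ^ 2) := by
  have hρ := L.pos
  have hlt := L.lt
  set p := (R / ‖x0‖) • x0 with hp
  have npx : ‖p - x0‖ = R - ‖x0‖ := by
    have : p - x0 = ((R - ‖x0‖) / ‖x0‖) • x0 := by
      rw [hp, show (R - ‖x0‖) / ‖x0‖ = R / ‖x0‖ - 1 by field_simp]; module
    rw [this, norm_smul, Real.norm_eq_abs, abs_of_nonneg (div_nonneg (by linarith) hρ.le), div_mul_cancel₀ _ hρ.ne']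
  have nzx : ‖z - x0‖ < ‖x0‖ / 2 := by
    have := norm_add_le (z - p) (p - x0)
    rw [sub_add_sub_cancel] at this
    linarith
  have tl : Tendsto (fun s : ℝ => (1 - s) • z) (𝓝[>] 0) (𝓝 z) := by
    have : Tendsto (fun s : ℝ => (1 - s) • z) (𝓝 0) (𝓝 ((1 - 0 : ℝ) • z)) :=
      (tendsto_const_nhds.sub tendsto_id).smul_const z
    rw [sub_zero, one_smul] at this
    exact this.mono_left nhdsWithin_le_nhds
  have ev : ∀ᶠ s : ℝ in 𝓝[>] 0, (1 - s) • z ∈ Om R x0 ∧ |u ((1 - s) • z)| ≤ β * ‖x0‖ ^ 2 * (s * R) := by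
    have e1 : ∀ᶠ s : ℝ in 𝓝[>] 0, (1 - s) • z ∈ ball x0 (‖x0‖ / 2) :=
      tl.eventually (isOpen_ball.mem_nhds (by rwa [mem_ball, dist_eq_norm]))
    have e2 : ∀ᶠ s : ℝ in 𝓝[>] 0, 0 < s ∧ s < 1 := Ioo_mem_nhdsGT one_pos
    filter_upwards [e1, e2] with s h1 ⟨h2, h3⟩
    have ns : ‖(1 - s) • z‖ = (1 - s) * R := by
      rw [norm_smul, Real.norm_eq_abs, abs_of_pos (by linarith), hz]
    have hm : (1 - s) • z ∈ Om R x0 := ⟨h1, by rw [mem_ball_zero_iff, ns]; nlinarith⟩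
    refine ⟨hm, (L.bd (by linarith) _ hm).trans (le_of_eq ?_)⟩
    rw [ns]; ring
  have tu : Tendsto (fun s : ℝ => u ((1 - s) • z)) (𝓝[>] 0) (𝓝 0) := by
    refine squeeze_zero_norm' (a := fun s => β * ‖x0‖ ^ 2 * (s * R)) (ev.mono fun s hs => hs.2) ?_
    have : Tendsto (fun s : ℝ => β * ‖x0‖ ^ 2 * (s * R)) (𝓝 0) (𝓝 (β * ‖x0‖ ^ 2 * (0 * R))) :=
      (tendsto_id.mul_const R).const_mul _
    rw [zero_mul, mul_zero] at this
    exact this.mono_left nhdsWithin_le_nhds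
  have tz : Tendsto (fun s : ℝ => (1 - s) • z - p) (𝓝[>] 0) (𝓝 (z - p)) := tl.sub_const p
  have l1 : Tendsto (fun s : ℝ => |u ((1 - s) • z) - 0 - c ((1 - s) • z - p) - 1 / 2 * A ((1 - s) • z - p) ((1 - s) • z - p)|)
      (𝓝[>] 0) (𝓝 |0 - 0 - c (z - p) - 1 / 2 * A (z - p) (z - p)|) :=
    (((tu.sub_const 0).sub ((c.continuous.tendsto _).comp tz)).sub
      ((tclm ((A.continuous.tendsto _).comp tz) tz).const_mul _)).abs
  have := le_of_tendsto_of_tendsto l1 (((tz.norm.rpow_const (Or.inr hα.le)).mul (tz.norm.pow 2)).const_mul H)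
    (ev.mono fun s hs => (J _ hs.1).1)
  rw [← abs_neg] at this
  refine le_trans (le_of_eq ?_) this
  congr 1; ring

lemma poly_exists (hα : 0 < α) (L : Loc R x0 u α H G β) {t : ℝ} (ht : 0 < t) (htx : 20 * t ≤ ‖x0‖) :
    ∃ p c0 c A b, ‖b‖ ≤ 2 * β ∧
      (∀ z ∈ ball 0 R ∩ ball x0 (2 * t), |u z - Pl p c0 c A b z| ≤ H * ((5 * t) ^ α * (5 * t) ^ 2) + 2 * β * (5 * t) ^ 3) ∧
      (∀ z ∈ ball 0 R ∩ ball x0 (2 * t), |lap n (fun z => u z - Pl p c0 c A b z) z| ≤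
        G * (5 * t) ^ α + (2 * n + 4) * (2 * β * (5 * t))) ∧
      ∃ C1, 0 ≤ C1 ∧ ∀ z ∈ ball 0 R ∩ ball x0 (2 * t), |u z - Pl p c0 c A b z| ≤ C1 * (R - ‖z‖) := by
  have hρ := L.pos
  have hlt := L.lt
  have hH := L.hH
  have hG := L.hG
  have hβ := L.hβ
  have sub : ball 0 R ∩ ball x0 (2 * t) ⊆ Om R x0 := fun z hz => ⟨ball_subset_ball (by linarith) hz.2, hz.1⟩
  have gen : ∀ p c0 c A b, Jet (Om R x0) u α H G p c0 c A → ‖b‖ ≤ 2 * β → ‖x0 - p‖ ≤ 3 * t →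
      (∀ z ∈ ball 0 R ∩ ball x0 (2 * t), |u z - Pl p c0 c A b z| ≤ H * ((5 * t) ^ α * (5 * t) ^ 2) + 2 * β * (5 * t) ^ 3) ∧
      (∀ z ∈ ball 0 R ∩ ball x0 (2 * t), |lap n (fun z => u z - Pl p c0 c A b z) z| ≤
        G * (5 * t) ^ α + (2 * n + 4) * (2 * β * (5 * t))) := by
    intro p c0 c A b J hb hxp
    have nz : ∀ z ∈ ball 0 R ∩ ball x0 (2 * t), ‖z - p‖ ≤ 5 * t := fun z hz => by
      have h1 := hz.2
      rw [mem_ball, dist_eq_norm] at h1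
      have := norm_add_le (z - x0) (x0 - p)
      rw [sub_add_sub_cancel] at this
      linarith
    have bi : ∀ z ∈ ball 0 R ∩ ball x0 (2 * t), |inner ℝ b (z - p)| ≤ 2 * β * (5 * t) := fun z hz => by
      refine (abs_real_inner_le_norm _ _).trans ?_
      gcongr
      exact nz z hz
    constructor
    · intro z hz
      have h1 := (J z (sub hz)).1
      have hnz := nz z hz
      have h2 : |‖z - p‖ ^ 2 * inner ℝ b (z - p)| ≤ (5 * t) ^ 2 * (2 * β * (5 * t)) := by
        rw [abs_mul, abs_of_nonneg (by positivity : 0 ≤ ‖z - p‖ ^ 2)]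
        gcongr
        exact bi z hz
      have h3 : H * (‖z - p‖ ^ α * ‖z - p‖ ^ 2) ≤ H * ((5 * t) ^ α * (5 * t) ^ 2) := by gcongr
      have h4 := abs_sub (u z - c0 - c (z - p) - 1 / 2 * A (z - p) (z - p)) (‖z - p‖ ^ 2 * inner ℝ b (z - p))
      unfold Pl
      rw [show u z - (c0 + c (z - p) + 1 / 2 * A (z - p) (z - p) + ‖z - p‖ ^ 2 * inner ℝ b (z - p)) =
        u z - c0 - c (z - p) - 1 / 2 * A (z - p) (z - p) - ‖z - p‖ ^ 2 * inner ℝ b (z - p) by ring]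
      nlinarith
    · intro z hz
      have h1 := (J z (sub hz)).2
      have hnz := nz z hz
      rw [lap_sub_at ((L.cd z (sub hz)).contDiffAt ((Om_open R x0).mem_nhds (sub hz))) (Pl_smooth p c0 c A b), Pl_lap]
      have h3 : G * ‖z - p‖ ^ α ≤ G * (5 * t) ^ α := by gcongr
      have h2 : |(2 * (n:ℝ) + 4) * inner ℝ b (z - p)| ≤ (2 * n + 4) * (2 * β * (5 * t)) := by
        rw [abs_mul, abs_of_nonneg (by positivity : 0 ≤ 2 * (n:ℝ) + 4)]
        gcongr
        exact bi z hz
      have h4 := abs_sub (lap n u z - ∑ i, A (ee i) (ee i)) ((2 * (n:ℝ) + 4) * inner ℝ b (z - p))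
      rw [← sub_sub]
      linarith
  by_cases hc : R - ‖x0‖ ≤ 3 * t
  · obtain ⟨c, A, bc, bA, J⟩ := jet_bd hα L (by linarith)
    have hR : 0 < R := hρ.trans hlt
    obtain ⟨b, hb, hb0⟩ := sphere_b (p := (R / ‖x0‖) • x0) hR
      (by rw [norm_smul, Real.norm_eq_abs, abs_of_pos (by positivity)]; field_simp) (r := ‖x0‖ / 4) (by linarith) hα hH
      (c := c) (A := A) (β := β) (bc.trans (by gcongr)) (bA.trans (by gcongr)) hβ
      (jet_sphere hα L (by linarith) J)
    have hx : ‖x0 - (R / ‖x0‖) • x0‖ ≤ 3 * t := by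
      have : x0 - (R / ‖x0‖) • x0 = (-((R - ‖x0‖) / ‖x0‖)) • x0 := by
        rw [show (R - ‖x0‖) / ‖x0‖ = R / ‖x0‖ - 1 by field_simp]; module
      rw [this, norm_smul, norm_neg, Real.norm_eq_abs, abs_of_nonneg (div_nonneg (by linarith) hρ.le), div_mul_cancel₀ _ hρ.ne']
      exact hc
    obtain ⟨g1, g2⟩ := gen _ 0 c A b J hb hx
    obtain ⟨C, hC, hC1, -⟩ := smooth_lip hR (Pl_smooth ((R / ‖x0‖) • x0) 0 c A b) hb0
    refine ⟨_, 0, c, A, b, hb, g1, g2, β * ‖x0‖ ^ 2 + C, by positivity, fun z hz => ?_⟩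
    have h1 := L.bd (by linarith) z (sub hz)
    have h2 := hC1 z (by simpa using hz.1)
    rw [add_mul]
    exact (abs_sub _ _).trans (add_le_add h1 h2)
  · push Not at hc
    have hx0 : x0 ∈ Om R x0 := by rw [mem_Om]; simp [hlt, hρ]
    obtain ⟨g1, g2⟩ := gen x0 (u x0) (fderiv ℝ u x0) (D2 u x0) 0 (jet_int hα L hx0) (by simpa using hβ) (by simpa using ht.le)
    refine ⟨x0, u x0, fderiv ℝ u x0, D2 u x0, 0, by simpa using hβ, g1, g2,
      (H * ((5 * t) ^ α * (5 * t) ^ 2) + 2 * β * (5 * t) ^ 3) / t, by positivity, fun z hz => (g1 z hz).trans ?_⟩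
    have h1 : ‖z - x0‖ < 2 * t := by have := hz.2; rwa [mem_ball, dist_eq_norm] at this
    have h2 : t ≤ R - ‖z‖ := by
      have := norm_add_le (z - x0) x0
      rw [sub_add_cancel] at this
      linarith
    rw [div_mul_eq_mul_div, le_div_iff₀ ht]
    gcongr

end


lemma opnorm2 {n : ℕ} {f : E n →L[ℝ] E n →L[ℝ] ℝ} {h B : ℝ} (hh : 0 < h) (hB : 0 ≤ B)
    (hf : ∀ a b, ‖a‖ = h → ‖b‖ = h → |f b a| ≤ B * h ^ 2) : ‖f‖ ≤ B := by
  refine f.opNorm_le_bound₂ hB fun v w => ?_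
  by_cases hv : v = 0
  · simp [hv]
  by_cases hw : w = 0
  · simp [hw]
  have hv' : 0 < ‖v‖ := norm_pos_iff.2 hv
  have hw' : 0 < ‖w‖ := norm_pos_iff.2 hw
  have ns : ∀ v : E n, 0 < ‖v‖ → ‖(h / ‖v‖) • v‖ = h := fun v hv => by
    rw [norm_smul, Real.norm_eq_abs, abs_of_pos (by positivity)]; field_simp
  have := hf ((h / ‖w‖) • w) ((h / ‖v‖) • v) (ns w hw') (ns v hv')
  simp only [map_smul, smul_apply, smul_eq_mul] at this
  rw [abs_mul, abs_mul, abs_of_pos (by positivity), abs_of_pos (by positivity)] at this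
  rw [Real.norm_eq_abs]
  have e : h / ‖w‖ * (h / ‖v‖ * |f v w|) = |f v w| / (‖v‖ * ‖w‖) * h ^ 2 := by field_simp
  rw [e] at this
  have := le_of_mul_le_mul_right this (by positivity)
  rw [div_le_iff₀ (by positivity)] at this
  linarith

set_option maxSynthPendingDepth 10 in
lemma LL_core {n : ℕ} {CK : ℝ} (hCK : 0 ≤ CK)
    (hK : ∀ (R : ℝ) (x0 : E n) (t : ℝ) (w : E n → ℝ) (C1 g m : ℝ)
    (x y a b : E n), 0 < R → 0 < t → 0 ≤ C1 → 0 ≤ g → 0 ≤ m → 2 * t ≤ ‖x0‖ → ‖x0‖ ≤ R →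
    ContDiffOn ℝ 2 w (ball 0 R ∩ ball x0 (2 * t)) →
    (∀ z ∈ ball 0 R ∩ ball x0 (2 * t), |w z| ≤ C1 * (R - ‖z‖)) →
    (∀ z ∈ ball 0 R ∩ ball x0 (2 * t), |w z| ≤ m) →
    (∀ z ∈ ball 0 R ∩ ball x0 (2 * t), |lap n w z| ≤ g) →
    ‖x - x0‖ + ‖a‖ + ‖b‖ < t → ‖y - x0‖ + ‖a‖ + ‖b‖ < t → ‖x‖ + ‖a‖ + ‖b‖ < R → ‖y‖ + ‖a‖ + ‖b‖ < R →
    |dbl w y a b - dbl w x a b| ≤ CK * (t ^ 2 * g + m * (‖a‖ * ‖b‖ * ‖y - x‖ / t ^ 3)))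
    {α : ℝ} (hα : 0 < α) {R : ℝ} {x0 y : E n} {u : E n → ℝ} {H G β : ℝ} (L : Loc R x0 u α H G β)
    {h t d : ℝ} (hd : ‖x0 - y‖ = d) (hh : 0 < h) (hhd : h ≤ d) (hdt : 8 * d ≤ t) (ht : 20 * t ≤ ‖x0‖) (hy : ‖y‖ ≤ ‖x0‖) :
    ‖D2 u x0 - D2 u y‖ ≤ 4 * (H * (3 * h) ^ α) + (CK * (t ^ 2 * (G * (5 * t) ^ α + (2 * n + 4) * (2 * β * (5 * t))) / h ^ 2 +
      (H * ((5 * t) ^ α * (5 * t) ^ 2) + 2 * β * (5 * t) ^ 3) * (d / t ^ 3)) + 12 * β * d) := by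
  have hρ := L.pos
  have hlt := L.lt
  have hH := L.hH
  have hG := L.hG
  have hβ := L.hβ
  have hd0 : 0 < d := hh.trans_le hhd
  have ht0 : 0 < t := by linarith
  set ρ := ‖x0‖ with hρd
  set l := 3 * h / ρ with hl
  have l0 : 0 < l := by positivity
  have l1 : l < 1 := by rw [hl, div_lt_one hρ]; linarith
  have lρ : l * ρ = 3 * h := by rw [hl]; field_simp
  set x' := (1 - l) • x0 with hx'
  set y' := (1 - l) • y with hy'
  have nx' : ‖x'‖ = ρ - 3 * h := by
    rw [hx', norm_smul, Real.norm_eq_abs, abs_of_pos (by linarith), ← lρ, hρd]; ring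
  have ny' : ‖y'‖ ≤ ρ - 3 * h := by
    rw [hy', norm_smul, Real.norm_eq_abs, abs_of_pos (by linarith), ← lρ]; nlinarith
  have dx' : ‖x' - x0‖ = 3 * h := by
    have : x' - x0 = (-l) • x0 := by rw [hx']; module
    rw [this, norm_smul, norm_neg, Real.norm_eq_abs, abs_of_pos l0, ← lρ]
  have dyy : ‖y' - y‖ ≤ 3 * h := by
    have : y' - y = (-l) • y := by rw [hy']; module
    rw [this, norm_smul, norm_neg, Real.norm_eq_abs, abs_of_pos l0, ← lρ]; gcongr
  have dyx : ‖y' - x'‖ ≤ d := by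
    have : y' - x' = -((1 - l) • (x0 - y)) := by rw [hx', hy']; module
    rw [this, norm_neg, norm_smul, hd, Real.norm_eq_abs, abs_of_pos (by linarith)]; nlinarith
  have dy' : ‖y' - x0‖ ≤ 4 * d := by
    have := norm_add_le (y' - x') (x' - x0)
    rw [sub_add_sub_cancel] at this
    linarith
  have mx0 : x0 ∈ Om R x0 := by rw [mem_Om, sub_self, norm_zero]; exact ⟨by linarith, hlt⟩
  have my : y ∈ Om R x0 := by rw [mem_Om, norm_sub_rev, hd]; exact ⟨by linarith, by linarith⟩
  have sb : ∀ q : E n, ‖q‖ ≤ ρ - 3 * h → ‖q - x0‖ ≤ 4 * d → ball q (3 * h) ⊆ Om R x0 := by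
    intro q h1 h2 z hz
    rw [mem_ball, dist_eq_norm] at hz
    rw [mem_Om]
    have e1 := norm_add_le (z - q) (q - x0)
    have e2 := norm_add_le (z - q) q
    rw [sub_add_sub_cancel] at e1
    rw [sub_add_cancel] at e2
    exact ⟨by linarith, by linarith⟩
  have bx := sb x' nx'.le (by linarith)
  have bby := sb y' ny' dy'
  have mx' : x' ∈ Om R x0 := bx (mem_ball_self (by positivity))
  have my' : y' ∈ Om R x0 := bby (mem_ball_self (by positivity))
  have hM : 0 ≤ H * (3 * h) ^ α := by positivity
  have T : ∀ q : E n, ball q (3 * h) ⊆ Om R x0 → ∀ a b : E n, ‖a‖ = h → ‖b‖ = h →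
      |dbl u q a b - D2 u q b a| ≤ H * (3 * h) ^ α * h ^ 2 := by
    intro q hq a b ha hb
    have := dbl_taylor (L.cd.mono hq) (A := D2 u q) (M := H * (3 * h) ^ α) (fun z hz => by
      refine (L.hol z (hq hz) q (hq (mem_ball_self (by positivity)))).trans ?_
      rw [mem_ball, dist_eq_norm] at hz
      gcongr) (a := a) (b := b) (by rw [ha, hb]; linarith)
    rw [ha, hb] at this
    linarith
  obtain ⟨p, c0, c, A, bb, hbb, w1, w2, C1, hC1, w3⟩ := poly_exists hα L ht0 ht
  set g := G * (5 * t) ^ α + (2 * n + 4) * (2 * β * (5 * t)) with hg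
  set m := H * ((5 * t) ^ α * (5 * t) ^ 2) + 2 * β * (5 * t) ^ 3 with hm
  have g0 : 0 ≤ g := by positivity
  have m0' : 0 ≤ m := by positivity
  have sub : ball 0 R ∩ ball x0 (2 * t) ⊆ Om R x0 := fun z hz => ⟨ball_subset_ball (by linarith) hz.2, hz.1⟩
  set B := 2 * (H * (3 * h) ^ α) + (CK * (t ^ 2 * g / h ^ 2 + m * (d / t ^ 3)) + 12 * β * d) with hB
  have main : ‖D2 u y' - D2 u x'‖ ≤ B := by
    refine opnorm2 hh (by positivity) fun a b ha hb => ?_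
    have q1 := hK R x0 t (fun z => u z - Pl p c0 c A bb z) C1 g m x' y' a b (by linarith) ht0 hC1 g0 m0' (by linarith) hlt.le
      ((L.cd.mono sub).sub (Pl_smooth p c0 c A bb).contDiffOn) w3 w1 w2 (by rw [ha, hb]; linarith)
      (by rw [ha, hb]; linarith) (by rw [ha, hb]; linarith) (by rw [ha, hb]; linarith)
    have q2 := Pl_tri p c0 c A bb x' y' a b
    have q3 := T x' bx a b ha hb
    have q4 := T y' bby a b ha hb
    rw [ha, hb] at q1 q2
    have q2' : 6 * ‖bb‖ * h * h * ‖y' - x'‖ ≤ 6 * (2 * β) * h * h * d := by gcongr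
    have q1' : CK * (t ^ 2 * g + m * (h * h * ‖y' - x'‖ / t ^ 3)) ≤ CK * (t ^ 2 * g + m * (h * h * d / t ^ 3)) := by gcongr
    have e1 : dbl (fun z => u z - Pl p c0 c A bb z) y' a b - dbl (fun z => u z - Pl p c0 c A bb z) x' a b =
      (dbl u y' a b - dbl u x' a b) - (dbl (Pl p c0 c A bb) y' a b - dbl (Pl p c0 c A bb) x' a b) := by
      simp only [dbl]; ring
    rw [e1] at q1
    have e2 : B * h ^ 2 = 2 * (H * (3 * h) ^ α * h ^ 2) + (CK * (t ^ 2 * g + m * (h * h * d / t ^ 3)) + 6 * (2 * β) * h * h * d) := by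
      rw [hB]; field_simp; ring
    rw [e2, sub_apply, sub_apply]
    have r1 := abs_le.1 (q1.trans q1')
    have r2 := abs_le.1 (q2.trans q2')
    have r3 := abs_le.1 q3
    have r4 := abs_le.1 q4
    rw [abs_le]
    constructor <;> linarith [r1.1, r1.2, r2.1, r2.2, r3.1, r3.2, r4.1, r4.2]
  have z1 : ‖D2 u x0 - D2 u x'‖ ≤ H * (3 * h) ^ α := by
    refine (L.hol _ mx0 _ mx').trans ?_
    rw [norm_sub_rev, dx']
  have z2 : ‖D2 u y' - D2 u y‖ ≤ H * (3 * h) ^ α := by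
    refine (L.hol _ my' _ my).trans ?_
    gcongr
  have z3 : ‖D2 u x0 - D2 u y‖ ≤ ‖D2 u x0 - D2 u x'‖ + ‖D2 u x' - D2 u y'‖ + ‖D2 u y' - D2 u y‖ := by
    have := dist_triangle4 (D2 u x0) (D2 u x') (D2 u y') (D2 u y)
    simpa only [dist_eq_norm] using this
  rw [norm_sub_rev (D2 u x')] at z3
  rw [hB] at main
  linarith

set_option maxSynthPendingDepth 10 in
lemma LL {n : ℕ} (hn : 0 < n) {α : ℝ} (hα : 0 < α) (hα1 : α < 1) {θ : ℝ} (hθ : 0 < θ) : ∃ C, 0 ≤ C ∧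
    ∀ (R : ℝ) (x0 y : E n) (u : E n → ℝ) (H G β : ℝ), Loc R x0 u α H G β → y ∈ Om R x0 → ‖y‖ ≤ ‖x0‖ →
    ‖D2 u x0 - D2 u y‖ ≤ ‖x0 - y‖ ^ α * (θ * H + C * (G + β * ‖x0‖ ^ (1 - α))) := by
  obtain ⟨CK, hCK, hK⟩ := K_lemma hn
  obtain ⟨ε, hε, hε1, hεθ⟩ : ∃ ε : ℝ, 0 < ε ∧ ε ≤ 1 ∧ 12 * ε ^ α ≤ θ / 2 := by
    refine ⟨min 1 ((θ / 24) ^ (1 / α)), by positivity, min_le_left _ _, ?_⟩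
    have : (min 1 ((θ / 24) ^ (1 / α))) ^ α ≤ ((θ / 24) ^ (1 / α)) ^ α :=
      Real.rpow_le_rpow (by positivity) (min_le_right _ _) hα.le
    have e : ((θ / 24) ^ (1 / α)) ^ α = θ / 24 := by
      rw [← Real.rpow_mul (by positivity), one_div, inv_mul_cancel₀ hα.ne', Real.rpow_one]
    rw [e] at this; linarith
  obtain ⟨K, hK8, hKθ⟩ : ∃ K : ℝ, 8 ≤ K ∧ 125 * CK * (K ^ α / K) ≤ θ / 2 := by
    have t1 : Tendsto (fun K : ℝ => 125 * CK * K ^ (-(1 - α))) atTop (𝓝 (125 * CK * 0)) :=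
      (tendsto_rpow_neg_atTop (by linarith)).const_mul _
    rw [mul_zero] at t1
    obtain ⟨K, h1, h2⟩ := ((t1.eventually_lt_const (by positivity : 0 < θ / 2)).and (eventually_ge_atTop 8)).exists
    refine ⟨K, h2, ?_⟩
    have : K ^ α / K = K ^ (-(1 - α)) := by
      rw [show -(1 - α) = α - 1 by ring, Real.rpow_sub_one (by linarith)]
    rw [this]; exact h1.le
  refine ⟨CK * (K ^ 2 / ε ^ 2) * (5 * K + (2 * n + 4) * (10 * K)) + 250 * CK + 12 + 40 * K, by positivity,
    fun R x0 y u H G β L my hy => ?_⟩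
  have hρ := L.pos
  have hH := L.hH
  have hG := L.hG
  have hβ := L.hβ
  by_cases h0 : x0 = y
  · subst h0
    have e : ‖D2 u x0 - D2 u x0‖ = 0 := by rw [← dist_eq_norm, dist_self]
    rw [e, sub_self, norm_zero, Real.zero_rpow hα.ne', zero_mul]
  set d := ‖x0 - y‖ with hd
  set ρ := ‖x0‖ with hρd
  have d0 : 0 < d := norm_pos_iff.2 (sub_ne_zero.2 h0)
  set D := d ^ α with hD
  have D0 : 0 < D := by positivity
  set Γ := β * ρ ^ (1 - α) with hΓ
  have Γ0 : 0 ≤ Γ := by positivity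
  have hsplit : ∀ s : ℝ, 0 < s → s = s ^ (1 - α) * s ^ α := fun s hs => by
    rw [← Real.rpow_add hs]; simp
  have h1α : ∀ s : ℝ, 1 ≤ s → s ^ α ≤ s := fun s hs => by
    have := Real.rpow_le_rpow_of_exponent_le hs hα1.le
    rwa [Real.rpow_one] at this
  by_cases hsm : 20 * (K * d) ≤ ρ
  · have core := LL_core hCK hK hα L (y := y) (h := ε * d) (t := K * d) hd.symm (by positivity) (by nlinarith) (by nlinarith) hsm hy
    have b1 : (3 * (ε * d)) ^ α ≤ 3 * ε ^ α * D := by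
      rw [Real.mul_rpow (by positivity) (by positivity), Real.mul_rpow hε.le d0.le, mul_assoc]
      have := h1α 3 (by norm_num)
      gcongr
    have b2 : (5 * (K * d)) ^ α ≤ 5 * K ^ α * D := by
      rw [Real.mul_rpow (by positivity) (by positivity), Real.mul_rpow (by positivity) d0.le, mul_assoc]
      have := h1α 5 (by norm_num)
      gcongr
    have b3 : 5 * K ^ α * D ≤ 5 * K * D := by
      have := h1α K (by linarith)
      gcongr
    have b4 : β * d ≤ Γ * D := by
      have : d ≤ ρ ^ (1 - α) * D := by
        rw [hD]
        nth_rewrite 1 [hsplit d d0]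
        gcongr
        nlinarith
      calc _ ≤ β * (ρ ^ (1 - α) * D) := by gcongr
        _ = _ := by rw [hΓ]; ring
    refine core.trans ?_
    have K0 : 0 < K := by linarith
    have e1 : CK * ((K * d) ^ 2 * (G * (5 * (K * d)) ^ α + (2 * n + 4) * (2 * β * (5 * (K * d)))) / (ε * d) ^ 2 +
      (H * ((5 * (K * d)) ^ α * (5 * (K * d)) ^ 2) + 2 * β * (5 * (K * d)) ^ 3) * (d / (K * d) ^ 3)) =
      CK * (K ^ 2 / ε ^ 2) * (G * (5 * (K * d)) ^ α + (2 * n + 4) * (10 * K) * (β * d)) +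
       (25 * CK * H / K * (5 * (K * d)) ^ α + 250 * CK * (β * d)) := by
      field_simp; ring
    rw [e1]
    have f1 : CK * (K ^ 2 / ε ^ 2) * (G * (5 * (K * d)) ^ α + (2 * n + 4) * (10 * K) * (β * d)) ≤
      CK * (K ^ 2 / ε ^ 2) * (G * (5 * K * D) + (2 * n + 4) * (10 * K) * (Γ * D)) := by
      have := b2.trans b3
      gcongr
    have f2 : 25 * CK * H / K * (5 * (K * d)) ^ α ≤ 25 * CK * H / K * (5 * K ^ α * D) := by gcongr
    have f3 : 250 * CK * (β * d) ≤ 250 * CK * (Γ * D) := by gcongr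
    have f4 : 4 * (H * (3 * (ε * d)) ^ α) ≤ 4 * (H * (3 * ε ^ α * D)) := by gcongr
    have f5 : 4 * (H * (3 * ε ^ α * D)) + 25 * CK * H / K * (5 * K ^ α * D) ≤ θ * H * D := by
      have : 4 * (H * (3 * ε ^ α * D)) + 25 * CK * H / K * (5 * K ^ α * D) =
        (12 * ε ^ α + 125 * CK * (K ^ α / K)) * (H * D) := by ring
      rw [this]
      calc _ ≤ θ * (H * D) := by gcongr; linarith
        _ = _ := by ring
    have f6 : CK * (K ^ 2 / ε ^ 2) * (G * (5 * K * D) + (2 * n + 4) * (10 * K) * (Γ * D)) ≤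
      CK * (K ^ 2 / ε ^ 2) * (5 * K + (2 * n + 4) * (10 * K)) * ((G + Γ) * D) := by
      have : CK * (K ^ 2 / ε ^ 2) * (5 * K + (2 * n + 4) * (10 * K)) * ((G + Γ) * D) =
        CK * (K ^ 2 / ε ^ 2) * (G * (5 * K * D) + (2 * n + 4) * (10 * K) * (Γ * D)) +
        CK * (K ^ 2 / ε ^ 2) * (Γ * (5 * K * D) + (2 * n + 4) * (10 * K) * (G * D)) := by ring
      rw [this]
      exact le_add_of_nonneg_right (by positivity)
    have f7 : 250 * CK * (Γ * D) ≤ 250 * CK * ((G + Γ) * D) := by gcongr; linarith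
    have f8 : Γ * D ≤ (G + Γ) * D := by gcongr; linarith
    have f9 : 0 ≤ 40 * K * ((G + Γ) * D) := by positivity
    have f10 : D * (θ * H + (CK * (K ^ 2 / ε ^ 2) * (5 * K + (2 * n + 4) * (10 * K)) + 250 * CK + 12 + 40 * K) * (G + Γ)) =
      θ * H * D + CK * (K ^ 2 / ε ^ 2) * (5 * K + (2 * n + 4) * (10 * K)) * ((G + Γ) * D) + 250 * CK * ((G + Γ) * D)
      + 12 * ((G + Γ) * D) + 40 * K * ((G + Γ) * D) := by ring
    rw [f10]
    linarith
  · push Not at hsm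
    have K0 : 0 < K := by linarith
    have mx0 : x0 ∈ Om R x0 := by rw [mem_Om, sub_self, norm_zero]; exact ⟨by linarith, L.lt⟩
    have h1 : ‖D2 u x0 - D2 u y‖ ≤ 2 * (β * ρ) := by
      linarith [norm_sub_le (D2 u x0) (D2 u y), L.d2 x0 mx0, L.d2 y my]
    have h2 : β * ρ ≤ Γ * (20 * K * D) := by
      have : ρ ^ α ≤ 20 * K * D := by
        calc ρ ^ α ≤ (20 * (K * d)) ^ α := by gcongr
          _ = (20 * K) ^ α * D := by rw [← mul_assoc, Real.mul_rpow (by positivity) d0.le]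
          _ ≤ _ := by
            have := h1α (20 * K) (by linarith)
            gcongr
      calc β * ρ = Γ * ρ ^ α := by rw [hΓ, mul_assoc, ← hsplit ρ hρ]
        _ ≤ _ := by gcongr
    have f : D * (θ * H + (CK * (K ^ 2 / ε ^ 2) * (5 * K + (2 * n + 4) * (10 * K)) + 250 * CK + 12 + 40 * K) * (G + Γ)) =
       2 * (Γ * (20 * K * D)) + D * (θ * H + (CK * (K ^ 2 / ε ^ 2) * (5 * K + (2 * n + 4) * (10 * K)) + 250 * CK + 12) * (G + Γ)
        + 40 * K * G) := by ring
    rw [f]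
    have : 0 ≤ D * (θ * H + (CK * (K ^ 2 / ε ^ 2) * (5 * K + (2 * n + 4) * (10 * K)) + 250 * CK + 12) * (G + Γ)
        + 40 * K * G) := by positivity
    linarith


lemma inner_pt {n : ℕ} {R h : ℝ} {x0 : E n} (h0 : 0 < ‖x0‖) (hlt : ‖x0‖ < R) (hh : 0 < h) (hs : 16 * h ≤ ‖x0‖) :
    ∃ x' : E n, ‖x0 - x'‖ = 3 * h ∧ ball x' (3 * h) ⊆ Om R x0 := by
  set l := 3 * h / ‖x0‖ with hl
  have lρ : l * ‖x0‖ = 3 * h := by rw [hl]; field_simp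
  have l0 : 0 < l := by positivity
  have l1 : l < 1 := by rw [hl, div_lt_one h0]; linarith
  have e1 : ‖x0 - (1 - l) • x0‖ = 3 * h := by
    have : x0 - (1 - l) • x0 = l • x0 := by module
    rw [this, norm_smul, Real.norm_eq_abs, abs_of_pos l0, lρ]
  refine ⟨(1 - l) • x0, e1, fun z hz => ?_⟩
  rw [mem_ball, dist_eq_norm] at hz
  have e2 : ‖(1 - l) • x0‖ = ‖x0‖ - 3 * h := by
    rw [norm_smul, Real.norm_eq_abs, abs_of_pos (by linarith)]; linarith
  have e3 := norm_add_le (z - (1 - l) • x0) ((1 - l) • x0 - x0)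
  have e4 := norm_add_le (z - (1 - l) • x0) ((1 - l) • x0)
  rw [sub_add_sub_cancel, norm_sub_rev ((1 - l) • x0), e1] at e3
  rw [sub_add_cancel] at e4
  rw [mem_Om]
  exact ⟨by linarith, by linarith⟩

set_option maxSynthPendingDepth 10 in
lemma interp2 {n : ℕ} {R h α Hl M : ℝ} {x0 : E n} {u : E n → ℝ} (hα : 0 < α) (h0 : 0 < ‖x0‖) (hlt : ‖x0‖ < R)
    (hh : 0 < h) (hs : 16 * h ≤ ‖x0‖) (hH : 0 ≤ Hl) (cd : ContDiffOn ℝ 2 u (Om R x0))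
    (hol : ∀ z ∈ Om R x0, ∀ z' ∈ Om R x0, ‖D2 u z - D2 u z'‖ ≤ Hl * ‖z - z'‖ ^ α)
    (hM : ∀ z ∈ Om R x0, |u z| ≤ M) : ‖D2 u x0‖ ≤ 2 * (Hl * (3 * h) ^ α) + 4 * M / h ^ 2 := by
  obtain ⟨x', e1, sb⟩ := inner_pt h0 hlt hh hs
  have mx0 : x0 ∈ Om R x0 := by rw [mem_Om, sub_self, norm_zero]; exact ⟨by linarith, hlt⟩
  have mx' : x' ∈ Om R x0 := sb (mem_ball_self (by positivity))
  have hM0 : 0 ≤ M := (abs_nonneg _).trans (hM x0 mx0)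
  have z1 : ‖D2 u x0 - D2 u x'‖ ≤ Hl * (3 * h) ^ α := by
    refine (hol _ mx0 _ mx').trans ?_
    rw [e1]
  have z2 : ‖D2 u x'‖ ≤ Hl * (3 * h) ^ α + 4 * M / h ^ 2 := by
    refine opnorm2 hh (by positivity) fun a b ha hb => ?_
    have := dbl_taylor (cd.mono sb) (A := D2 u x') (M := Hl * (3 * h) ^ α) (fun z hz => by
      refine (hol z (sb hz) x' mx').trans ?_
      rw [mem_ball, dist_eq_norm] at hz
      gcongr) (a := a) (b := b) (by rw [ha, hb]; linarith)
    rw [ha, hb] at this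
    have m1 : ∀ v : E n, ‖v‖ ≤ 2 * h → |u (x' + v)| ≤ M := fun v hv => hM _ (sb (by
      rw [mem_ball, dist_eq_norm, add_sub_cancel_left]; linarith))
    have n1 := abs_le.1 (m1 a (by linarith))
    have n2 := abs_le.1 (m1 b (by linarith))
    have n3 := abs_le.1 (m1 (a + b) (by linarith [norm_add_le a b]))
    have n4 := abs_le.1 (hM _ mx')
    rw [← add_assoc] at n3
    have e : (Hl * (3 * h) ^ α + 4 * M / h ^ 2) * h ^ 2 = Hl * (3 * h) ^ α * h * h + 4 * M := by field_simp
    rw [e]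
    rw [dbl] at this
    have t := abs_le.1 this
    rw [abs_le]
    constructor <;> linarith [n1.1, n1.2, n2.1, n2.2, n3.1, n3.2, n4.1, n4.2, t.1, t.2]
  have := norm_sub_norm_le (D2 u x0) (D2 u x')
  linarith

set_option maxSynthPendingDepth 10 in
lemma interp1 {n : ℕ} {R h α Hl M : ℝ} {x0 : E n} {u : E n → ℝ} (hα : 0 < α) (h0 : 0 < ‖x0‖) (hlt : ‖x0‖ < R)
    (hh : 0 < h) (hs : 16 * h ≤ ‖x0‖) (hH : 0 ≤ Hl) (cd : ContDiffOn ℝ 2 u (Om R x0))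
    (hol : ∀ z ∈ Om R x0, ∀ z' ∈ Om R x0, ‖D2 u z - D2 u z'‖ ≤ Hl * ‖z - z'‖ ^ α)
    (hM : ∀ z ∈ Om R x0, |u z| ≤ M) :
    ‖fderiv ℝ u x0‖ ≤ 2 * M / h + 4 * h * (‖D2 u x0‖ + Hl * ‖x0‖ ^ α) := by
  obtain ⟨x', e1, sb⟩ := inner_pt h0 hlt hh hs
  have mx0 : x0 ∈ Om R x0 := by rw [mem_Om, sub_self, norm_zero]; exact ⟨by linarith, hlt⟩
  have mx' : x' ∈ Om R x0 := sb (mem_ball_self (by positivity))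
  have hM0 : 0 ≤ M := (abs_nonneg _).trans (hM x0 mx0)
  set K := ‖D2 u x0‖ + Hl * ‖x0‖ ^ α with hK
  have hK0 : 0 ≤ K := by positivity
  have kb : ∀ q ∈ Om R x0, ‖D2 u q‖ ≤ K := fun q hq => by
    have t1 := hol q hq x0 mx0
    have t2 := norm_sub_norm_le (D2 u q) (D2 u x0)
    have t3 : Hl * ‖q - x0‖ ^ α ≤ Hl * ‖x0‖ ^ α := by
      rw [mem_Om] at hq
      have := hq.1
      gcongr
      linarith
    linarith
  have z1 : ‖fderiv ℝ u x0 - fderiv ℝ u x'‖ ≤ K * (3 * h) := by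
    have := (Om_convex R x0).norm_image_sub_le_of_norm_hasFDerivWithin_le (f := fderiv ℝ u) (f' := D2 u) (C := K)
      (fun q hq => (hasFDerivAt_D2 ((cd q hq).contDiffAt ((Om_open _ _).mem_nhds hq))).hasFDerivWithinAt)
      kb mx' mx0
    rwa [e1] at this
  have z2 : ‖fderiv ℝ u x'‖ ≤ 2 * M / h + K * h := by
    refine ContinuousLinearMap.opNorm_le_bound _ (by positivity) fun v => ?_
    by_cases hv : v = 0
    · simp [hv]
    have hv' : 0 < ‖v‖ := norm_pos_iff.2 hv
    set a := (h / ‖v‖) • v with ha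
    have na : ‖a‖ = h := by
      rw [ha, norm_smul, Real.norm_eq_abs, abs_of_pos (by positivity)]; field_simp
    have ma : x' + a ∈ Om R x0 := sb (by rw [mem_ball, dist_eq_norm, add_sub_cancel_left]; linarith)
    have := taylor (Om_open _ _) (Om_convex _ _) cd mx' ma (A := 0) (M := K) (fun q hq _ => by rw [sub_zero]; exact kb q hq)
    simp only [add_sub_cancel_left, zero_apply, mul_zero, sub_zero] at this
    rw [na] at this
    have n1 := abs_le.1 (hM _ ma)
    have n2 := abs_le.1 (hM _ mx')
    have t := abs_le.1 this
    have e : fderiv ℝ u x' v = (‖v‖ / h) * fderiv ℝ u x' a := by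
      rw [ha, map_smul, smul_eq_mul]; field_simp
    have b : |fderiv ℝ u x' a| ≤ 2 * M + K * h ^ 2 := by
      rw [abs_le]; constructor <;> linarith [n1.1, n1.2, n2.1, n2.2, t.1, t.2]
    rw [e, Real.norm_eq_abs, abs_mul, abs_of_pos (by positivity)]
    calc _ ≤ (‖v‖ / h) * (2 * M + K * h ^ 2) := by gcongr
      _ = _ := by field_simp
  have := norm_sub_norm_le (fderiv ℝ u x0) (fderiv ℝ u x')
  linarith


lemma wt0 {σ ρ s : ℝ} (hρ : 0 < ρ) (h1 : ρ / 4 ≤ s) (h2 : s ≤ 4 * ρ) : s ^ σ ≤ 4 ^ |σ| * ρ ^ σ := by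
  have hs : 0 < s := by linarith
  rcases le_total 0 σ with h | h
  · rw [abs_of_nonneg h, ← Real.mul_rpow (by norm_num) hρ.le]
    exact Real.rpow_le_rpow hs.le h2 h
  · rw [abs_of_nonpos h]
    have e : (4:ℝ) ^ (-σ) * ρ ^ σ = (ρ / 4) ^ σ := by
      rw [Real.div_rpow hρ.le (by norm_num), Real.rpow_neg (by norm_num)]; field_simp
    rw [e]
    exact Real.rpow_le_rpow_of_nonpos (by linarith) h1 h

def kk (σ : ℝ) : ℝ := 64 * 4 ^ |σ|

lemma kk_ge (σ : ℝ) : 64 ≤ kk σ := by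
  have : (1:ℝ) ≤ 4 ^ |σ| := Real.one_le_rpow (by norm_num) (abs_nonneg _)
  rw [kk]; linarith

lemma wts {σ ρ s α : ℝ} (hα : 0 < α) (hα1 : α < 1) (hρ : 0 < ρ) (h1 : ρ / 4 ≤ s) (h2 : s ≤ 4 * ρ) :
    s ^ σ ≤ kk σ * ρ ^ σ ∧ s ^ σ / s ≤ kk σ * (ρ ^ σ / ρ) ∧ s ^ σ / s ^ 2 ≤ kk σ * (ρ ^ σ / ρ ^ 2) ∧
    s ^ σ / s ^ 2 / s ^ α ≤ kk σ * (ρ ^ σ / ρ ^ 2 / ρ ^ α) := by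
  have hs : 0 < s := by linarith
  have w := wt0 (σ := σ) hρ h1 h2
  have p : 0 < (4:ℝ) ^ |σ| := by positivity
  have q : 0 < ρ ^ σ := by positivity
  have i1 : 1 / s ≤ 4 / ρ := by rw [div_le_div_iff₀ hs hρ]; linarith
  have i2 : 1 / s ^ α ≤ 4 / ρ ^ α := by
    rw [div_le_div_iff₀ (by positivity) (by positivity)]
    have : ρ ^ α ≤ (4 * s) ^ α := Real.rpow_le_rpow hρ.le (by linarith) hα.le
    rw [Real.mul_rpow (by norm_num) hs.le] at this
    have h4 : (4:ℝ) ^ α ≤ 4 := by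
      have := Real.rpow_le_rpow_of_exponent_le (x := 4) (by norm_num) hα1.le
      rwa [Real.rpow_one] at this
    have : (4:ℝ) ^ α * s ^ α ≤ 4 * s ^ α := by gcongr
    linarith
  have c1 : s ^ σ / s ≤ 4 * 4 ^ |σ| * (ρ ^ σ / ρ) := by
    calc s ^ σ / s = s ^ σ * (1 / s) := by ring
      _ ≤ (4 ^ |σ| * ρ ^ σ) * (4 / ρ) := by gcongr
      _ = _ := by ring
  have c2 : s ^ σ / s ^ 2 ≤ 16 * 4 ^ |σ| * (ρ ^ σ / ρ ^ 2) := by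
    calc s ^ σ / s ^ 2 = (s ^ σ / s) * (1 / s) := by field_simp
      _ ≤ (4 * 4 ^ |σ| * (ρ ^ σ / ρ)) * (4 / ρ) := by gcongr
      _ = _ := by field_simp; ring
  have c3 : s ^ σ / s ^ 2 / s ^ α ≤ 64 * 4 ^ |σ| * (ρ ^ σ / ρ ^ 2 / ρ ^ α) := by
    calc s ^ σ / s ^ 2 / s ^ α = (s ^ σ / s ^ 2) * (1 / s ^ α) := by ring
      _ ≤ (16 * 4 ^ |σ| * (ρ ^ σ / ρ ^ 2)) * (4 / ρ ^ α) := by gcongr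
      _ = _ := by ring
  rw [kk]
  refine ⟨?_, c1.trans ?_, c2.trans ?_, c3⟩
  · refine w.trans ?_
    have : 0 < (4:ℝ) ^ |σ| * ρ ^ σ := by positivity
    linarith
  · gcongr; norm_num
  · gcongr; norm_num

def Pun (n : ℕ) (R : ℝ) : Set (E n) := {x | 0 < ‖x‖ ∧ ‖x‖ < R}

structure Dat {n : ℕ} (R σ α A0 B c : ℝ) (V W : E n → ℝ) : Prop where
  hA0 : 0 ≤ A0
  hB0 : 0 ≤ B
  hc0 : 0 ≤ c
  cd : ContDiffOn ℝ 2 W (Pun n R)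
  cont : ContinuousOn W {x | 0 < ‖x‖ ∧ ‖x‖ ≤ R}
  bd : ∀ x, ‖x‖ = R → W x = 0
  hA : ∀ x ∈ Pun n R, |W x| ≤ A0 * ‖x‖ ^ σ
  hB : ∀ x ∈ Pun n R, ∀ y ∈ Pun n R, ‖y‖ ≤ ‖x‖ → ‖x‖ ≤ 4 * ‖y‖ →
    |(lap n W x + V x * W x) - (lap n W y + V y * W y)| ≤ B * (‖x‖ ^ σ / ‖x‖ ^ 2 / ‖x‖ ^ α) * ‖x - y‖ ^ α
  V1 : ∀ x ∈ Pun n R, |V x| ≤ c / ‖x‖ ^ 2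
  V2 : ∀ x ∈ Pun n R, ∀ y ∈ Pun n R, ‖y‖ ≤ ‖x‖ → ‖x‖ ≤ 4 * ‖y‖ → |V x - V y| ≤ c / ‖x‖ ^ 3 * ‖x - y‖

def PB {n : ℕ} (R σ α H : ℝ) (W : E n → ℝ) : Prop :=
  ∀ x ∈ Pun n R, ∀ y ∈ Pun n R, ‖y‖ ≤ ‖x‖ → ‖x‖ ≤ 4 * ‖y‖ →
    ‖D2 W x - D2 W y‖ ≤ H * (‖x‖ ^ σ / ‖x‖ ^ 2 / ‖x‖ ^ α) * ‖x - y‖ ^ α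

lemma Om_rng {n : ℕ} {R : ℝ} {x0 z : E n} (hz : z ∈ Om R x0) :
    ‖x0‖ / 2 < ‖z‖ ∧ ‖z‖ < 3 / 2 * ‖x0‖ := by
  rw [mem_Om] at hz
  have h1 := norm_sub_norm_le z x0
  have h2 := norm_sub_norm_le x0 z
  rw [norm_sub_rev] at h2
  constructor <;> linarith [hz.1]

lemma Om_sub {n : ℕ} {R : ℝ} {x0 : E n} (h0 : 0 < ‖x0‖) : Om R x0 ⊆ Pun n R := fun z hz =>
  ⟨by linarith [(Om_rng hz).1], ((mem_Om).1 hz).2⟩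

lemma ordpair {n : ℕ} {X : Type*} [NormedAddCommGroup X] {R σ α H : ℝ} {f : E n → X} (hα : 0 < α) (hα1 : α < 1) (hH : 0 ≤ H)
    (hf : ∀ x ∈ Pun n R, ∀ y ∈ Pun n R, ‖y‖ ≤ ‖x‖ → ‖x‖ ≤ 4 * ‖y‖ →
      ‖f x - f y‖ ≤ H * (‖x‖ ^ σ / ‖x‖ ^ 2 / ‖x‖ ^ α) * ‖x - y‖ ^ α)
    {x0 : E n} (h0 : 0 < ‖x0‖) : ∀ z ∈ Om R x0, ∀ z' ∈ Om R x0,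
      ‖f z - f z'‖ ≤ (kk σ * H * (‖x0‖ ^ σ / ‖x0‖ ^ 2 / ‖x0‖ ^ α)) * ‖z - z'‖ ^ α := by
  have key : ∀ z ∈ Om R x0, ∀ z' ∈ Om R x0, ‖z'‖ ≤ ‖z‖ →
      ‖f z - f z'‖ ≤ (kk σ * H * (‖x0‖ ^ σ / ‖x0‖ ^ 2 / ‖x0‖ ^ α)) * ‖z - z'‖ ^ α := by
    intro z hz z' hz' hle
    have r1 := Om_rng hz
    have r2 := Om_rng hz'
    refine (hf z (Om_sub h0 hz) z' (Om_sub h0 hz') hle (by linarith)).trans ?_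
    have := (wts (σ := σ) hα hα1 h0 (s := ‖z‖) (by linarith) (by linarith)).2.2.2
    have e : kk σ * H * (‖x0‖ ^ σ / ‖x0‖ ^ 2 / ‖x0‖ ^ α) = H * (kk σ * (‖x0‖ ^ σ / ‖x0‖ ^ 2 / ‖x0‖ ^ α)) := by ring
    rw [e]
    gcongr
  intro z hz z' hz'
  rcases le_total ‖z'‖ ‖z‖ with h | h
  · exact key z hz z' hz' h
  · rw [norm_sub_rev (f z), norm_sub_rev z]; exact key z' hz' z hz h

def QQ (σ α ε H A0 : ℝ) : ℝ := kk σ * (40 * ε ^ α * H + 40 * A0 / ε ^ 2)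

set_option maxSynthPendingDepth 10 in
lemma interp {n : ℕ} {R σ α A0 B c H ε : ℝ} {V W : E n → ℝ} (hα : 0 < α) (hα1 : α < 1) (D : Dat R σ α A0 B c V W)
    (hH : 0 ≤ H) (hP : PB R σ α H W) (hε : 0 < ε) (hε1 : 16 * ε ≤ 1) :
    ∀ x ∈ Pun n R, ‖D2 W x‖ ≤ QQ σ α ε H A0 * (‖x‖ ^ σ / ‖x‖ ^ 2) ∧ ‖fderiv ℝ W x‖ ≤ QQ σ α ε H A0 * (‖x‖ ^ σ / ‖x‖) := by
  intro x hx
  have hρ := hx.1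
  have hA0 := D.hA0
  have hol := ordpair hα hα1 hH hP hρ
  have k1 := kk_ge σ
  have cd := D.cd.mono (Om_sub (R := R) hρ)
  have hM : ∀ z ∈ Om R x, |W z| ≤ kk σ * A0 * ‖x‖ ^ σ := fun z hz => by
    have r := Om_rng hz
    have := (wts (σ := σ) hα hα1 hρ (s := ‖z‖) (by linarith) (by linarith)).1
    calc _ ≤ A0 * ‖z‖ ^ σ := D.hA z (Om_sub hρ hz)
      _ ≤ A0 * (kk σ * ‖x‖ ^ σ) := by gcongr
      _ = _ := by ring
  have hHl : 0 ≤ kk σ * H * (‖x‖ ^ σ / ‖x‖ ^ 2 / ‖x‖ ^ α) := by positivity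
  have i2 := interp2 hα hρ hx.2 (h := ε * ‖x‖) (by positivity) (by nlinarith) hHl cd hol hM
  have i1 := interp1 hα hρ hx.2 (h := ε * ‖x‖) (by positivity) (by nlinarith) hHl cd hol hM
  have h3 : (3:ℝ) ^ α ≤ 3 := by
    have := Real.rpow_le_rpow_of_exponent_le (x := 3) (by norm_num) hα1.le
    rwa [Real.rpow_one] at this
  have e3 : (3 * (ε * ‖x‖)) ^ α ≤ 3 * (ε ^ α * ‖x‖ ^ α) := by
    rw [Real.mul_rpow (by norm_num) (by positivity), Real.mul_rpow hε.le hρ.le]; gcongr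
  have eε : ε ≤ ε ^ α := by
    have := Real.rpow_le_rpow_of_exponent_ge hε (by linarith) hα1.le
    rwa [Real.rpow_one] at this
  have eε1 : ε ^ α ≤ 1 := Real.rpow_le_one hε.le (by linarith) hα.le
  set ρ := ‖x‖
  set w := ρ ^ σ
  have w0 : 0 < w := by positivity
  set a := ρ ^ α
  have a0 : 0 < a := by positivity
  have j2 : ‖D2 W x‖ ≤ kk σ * (6 * ε ^ α * H + 4 * A0 / ε ^ 2) * (w / ρ ^ 2) := by
    refine i2.trans ?_
    calc _ ≤ 2 * (kk σ * H * (w / ρ ^ 2 / a) * (3 * (ε ^ α * a))) + 4 * (kk σ * A0 * w) / (ε * ρ) ^ 2 := by gcongr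
      _ = _ := by field_simp; ring
  constructor
  · refine j2.trans ?_
    rw [QQ]
    gcongr <;> norm_num
  · refine i1.trans ?_
    calc _ ≤ 2 * (kk σ * A0 * w) / (ε * ρ) + 4 * (ε * ρ) * (kk σ * (6 * ε ^ α * H + 4 * A0 / ε ^ 2) * (w / ρ ^ 2) +
        kk σ * H * (w / ρ ^ 2 / a) * a) := by gcongr
      _ = kk σ * (18 * A0 / ε + 4 * ε * (6 * ε ^ α * H + H)) * (w / ρ) := by field_simp; ring
      _ ≤ _ := by
        rw [QQ]
        have g1 : 18 * A0 / ε ≤ 40 * A0 / ε ^ 2 := by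
          rw [div_le_div_iff₀ hε (by positivity)]
          have : A0 * ε * ε ≤ A0 * ε * 1 := by gcongr; linarith
          have : 0 ≤ A0 * ε := by positivity
          nlinarith
        have g2 : 4 * ε * (6 * ε ^ α * H + H) ≤ 40 * ε ^ α * H := by
          have : 4 * ε * (6 * ε ^ α * H + H) ≤ 4 * ε ^ α * (6 * 1 * H + H) := by gcongr
          have : 0 ≤ ε ^ α * H := by positivity
          nlinarith
        have g3 : 18 * A0 / ε + 4 * ε * (6 * ε ^ α * H + H) ≤ 40 * ε ^ α * H + 40 * A0 / ε ^ 2 := by linarith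
        exact mul_le_mul_of_nonneg_right (mul_le_mul_of_nonneg_left g3 (by linarith)) (by positivity)


lemma QQ_nonneg {σ α ε H A0 : ℝ} (hH : 0 ≤ H) (hA : 0 ≤ A0) (hε : 0 < ε) : 0 ≤ QQ σ α ε H A0 := by
  have := kk_ge σ
  rw [QQ]; positivity

lemma splitα {α s ρ : ℝ} (hα : 0 < α) (hα1 : α < 1) (hs : 0 ≤ s) (hρ : 0 < ρ) (h : s ≤ 2 * ρ) :
    s / ρ ≤ 2 * (s ^ α / ρ ^ α) := by
  rcases hs.eq_or_lt with rfl | hs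
  · rw [Real.zero_rpow hα.ne']; simp
  rw [← Real.div_rpow hs.le hρ.le]
  set q := s / ρ with hq
  have q0 : 0 < q := by positivity
  have q2 : q ≤ 2 := by rw [hq, div_le_iff₀ hρ]; exact h
  have e : q = q ^ (1 - α) * q ^ α := by rw [← Real.rpow_add q0]; simp
  have : q ^ (1 - α) ≤ 2 := by
    calc _ ≤ (2:ℝ) ^ (1 - α) := Real.rpow_le_rpow q0.le q2 (by linarith)
      _ ≤ (2:ℝ) ^ (1:ℝ) := Real.rpow_le_rpow_of_exponent_le (by norm_num) (by linarith)
      _ = 2 := by norm_num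
  nth_rewrite 1 [e]
  gcongr

set_option maxSynthPendingDepth 10 in
lemma mkLoc {n : ℕ} {R σ α A0 B c H Q : ℝ} {V W : E n → ℝ} (hα : 0 < α) (hα1 : α < 1) (D : Dat R σ α A0 B c V W)
    (hH : 0 ≤ H) (hP : PB R σ α H W) (hQ : 0 ≤ Q)
    (hI : ∀ x ∈ Pun n R, ‖D2 W x‖ ≤ Q * (‖x‖ ^ σ / ‖x‖ ^ 2) ∧ ‖fderiv ℝ W x‖ ≤ Q * (‖x‖ ^ σ / ‖x‖))
    {x : E n} (hx : x ∈ Pun n R) :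
    Loc R x W α (kk σ * H * (‖x‖ ^ σ / ‖x‖ ^ 2 / ‖x‖ ^ α))
      (kk σ * (B + 128 * c * (A0 + Q)) * (‖x‖ ^ σ / ‖x‖ ^ 2 / ‖x‖ ^ α)) (kk σ * Q * (‖x‖ ^ σ / ‖x‖ ^ 3)) := by
  have hρ := hx.1
  have k1 := kk_ge σ
  have hA0 := D.hA0
  have hB0 := D.hB0
  have hc0 := D.hc0
  have cd := D.cd.mono (Om_sub (R := R) hρ)
  have d1 : ∀ z ∈ Pun n R, ‖x‖ / 4 ≤ ‖z‖ → ‖z‖ ≤ 4 * ‖x‖ →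
      ‖fderiv ℝ W z‖ ≤ kk σ * Q * (‖x‖ ^ σ / ‖x‖ ^ 3) * ‖x‖ ^ 2 := fun z hz r1 r2 => by
    have := (wts (σ := σ) hα hα1 hρ (s := ‖z‖) r1 r2).2.1
    calc _ ≤ Q * (‖z‖ ^ σ / ‖z‖) := (hI z hz).2
      _ ≤ Q * (kk σ * (‖x‖ ^ σ / ‖x‖)) := by gcongr
      _ = _ := by field_simp
  have hM : ∀ z ∈ Om R x, |W z| ≤ kk σ * A0 * ‖x‖ ^ σ := fun z hz => by
    have r := Om_rng hz
    have := (wts (σ := σ) hα hα1 hρ (s := ‖z‖) (by linarith) (by linarith)).1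
    calc _ ≤ A0 * ‖z‖ ^ σ := D.hA z (Om_sub hρ hz)
      _ ≤ A0 * (kk σ * ‖x‖ ^ σ) := by gcongr
      _ = _ := by ring
  have hF := ordpair (f := fun z => lap n W z + V z * W z) hα hα1 hB0 D.hB hρ
  have hLip : ∀ z ∈ Om R x, ∀ z' ∈ Om R x, |W z - W z'| ≤ kk σ * Q * (‖x‖ ^ σ / ‖x‖ ^ 3) * ‖x‖ ^ 2 * ‖z - z'‖ := by
    intro z hz z' hz'
    have := (Om_convex R x).norm_image_sub_le_of_norm_hasFDerivWithin_le (f := W) (f' := fderiv ℝ W)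
      (C := kk σ * Q * (‖x‖ ^ σ / ‖x‖ ^ 3) * ‖x‖ ^ 2)
      (fun q hq => (((cd q hq).contDiffAt ((Om_open _ _).mem_nhds hq)).differentiableAt (by norm_num)).hasFDerivAt.hasFDerivWithinAt)
      (fun q hq => d1 q (Om_sub hρ hq) (by linarith [(Om_rng hq).1]) (by linarith [(Om_rng hq).2])) hz' hz
    exact this
  have hV1 : ∀ z ∈ Om R x, |V z| ≤ 4 * c / ‖x‖ ^ 2 := fun z hz => by
    refine (D.V1 z (Om_sub hρ hz)).trans ?_
    have r := (Om_rng hz).1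
    have z0 : 0 < ‖z‖ := by linarith
    rw [div_le_div_iff₀ (by positivity) (by positivity)]
    have : c * ‖x‖ ^ 2 ≤ c * (2 * ‖z‖) ^ 2 := by gcongr; linarith
    linarith
  have hV2 : ∀ z ∈ Om R x, ∀ z' ∈ Om R x, |V z - V z'| ≤ 8 * c / ‖x‖ ^ 3 * ‖z - z'‖ := by
    have key : ∀ z ∈ Om R x, ∀ z' ∈ Om R x, ‖z'‖ ≤ ‖z‖ → |V z - V z'| ≤ 8 * c / ‖x‖ ^ 3 * ‖z - z'‖ := by
      intro z hz z' hz' hle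
      have r1 := Om_rng hz
      have r2 := Om_rng hz'
      have z0 : 0 < ‖z‖ := by linarith
      refine (D.V2 z (Om_sub hρ hz) z' (Om_sub hρ hz') hle (by linarith)).trans ?_
      gcongr ?_ * _
      rw [div_le_div_iff₀ (by positivity) (by positivity)]
      have : c * ‖x‖ ^ 3 ≤ c * (2 * ‖z‖) ^ 3 := by gcongr; linarith
      linarith
    intro z hz z' hz'
    rcases le_total ‖z'‖ ‖z‖ with h | h
    · exact key z hz z' hz' h
    · rw [abs_sub_comm, norm_sub_rev]; exact key z' hz' z hz h
  refine ⟨hρ, hx.2, by positivity, by positivity, by positivity, cd, ordpair hα hα1 hH hP hρ, ?_, ?_, ?_, ?_⟩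
  · intro z hz z' hz'
    have f := hF z hz z' hz'
    rw [Real.norm_eq_abs] at f
    have e : lap n W z - lap n W z' = ((lap n W z + V z * W z) - (lap n W z' + V z' * W z')) -
      ((V z - V z') * W z + V z' * (W z - W z')) := by ring
    have g1 : |(V z - V z') * W z| ≤ 8 * c / ‖x‖ ^ 3 * ‖z - z'‖ * (kk σ * A0 * ‖x‖ ^ σ) := by
      rw [abs_mul]
      have := hV2 z hz z' hz'
      have := hM z hz
      gcongr
    have g2 : |V z' * (W z - W z')| ≤ 4 * c / ‖x‖ ^ 2 * (kk σ * Q * (‖x‖ ^ σ / ‖x‖ ^ 3) * ‖x‖ ^ 2 * ‖z - z'‖) := by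
      rw [abs_mul]
      have := hV1 z' hz'
      have := hLip z hz z' hz'
      gcongr
    have dz : ‖z - z'‖ ≤ 2 * ‖x‖ := by
      have a1 := ((mem_Om).1 hz).1
      have a2 := ((mem_Om).1 hz').1
      have := norm_sub_le (z - x) (z' - x)
      rw [sub_sub_sub_cancel_right] at this
      linarith
    have sp := splitα hα hα1 (norm_nonneg _) hρ dz
    have g3 : 8 * c / ‖x‖ ^ 3 * ‖z - z'‖ * (kk σ * A0 * ‖x‖ ^ σ) +
        4 * c / ‖x‖ ^ 2 * (kk σ * Q * (‖x‖ ^ σ / ‖x‖ ^ 3) * ‖x‖ ^ 2 * ‖z - z'‖) =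
        (kk σ * c * (8 * A0 + 4 * Q) * (‖x‖ ^ σ / ‖x‖ ^ 2)) * (‖z - z'‖ / ‖x‖) := by
      field_simp
    have g4 : (kk σ * c * (8 * A0 + 4 * Q) * (‖x‖ ^ σ / ‖x‖ ^ 2)) * (‖z - z'‖ / ‖x‖) ≤
        (kk σ * c * (8 * A0 + 8 * Q) * (‖x‖ ^ σ / ‖x‖ ^ 2)) * (2 * (‖z - z'‖ ^ α / ‖x‖ ^ α)) := by
      gcongr; norm_num
    have g5 : kk σ * (B + 128 * c * (A0 + Q)) * (‖x‖ ^ σ / ‖x‖ ^ 2 / ‖x‖ ^ α) * ‖z - z'‖ ^ α =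
      kk σ * B * (‖x‖ ^ σ / ‖x‖ ^ 2 / ‖x‖ ^ α) * ‖z - z'‖ ^ α +
      8 * ((kk σ * c * (8 * A0 + 8 * Q) * (‖x‖ ^ σ / ‖x‖ ^ 2)) * (2 * (‖z - z'‖ ^ α / ‖x‖ ^ α))) := by ring
    have g6 : 0 ≤ (kk σ * c * (8 * A0 + 8 * Q) * (‖x‖ ^ σ / ‖x‖ ^ 2)) * (2 * (‖z - z'‖ ^ α / ‖x‖ ^ α)) := by positivity
    rw [e, g5]
    have t1 := abs_sub ((lap n W z + V z * W z) - (lap n W z' + V z' * W z')) ((V z - V z') * W z + V z' * (W z - W z'))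
    have t2 := abs_add_le ((V z - V z') * W z) (V z' * (W z - W z'))
    linarith
  · intro z hz
    have r := Om_rng hz
    have := (wts (σ := σ) hα hα1 hρ (s := ‖z‖) (by linarith) (by linarith)).2.2.1
    calc _ ≤ Q * (‖z‖ ^ σ / ‖z‖ ^ 2) := (hI z (Om_sub hρ hz)).1
      _ ≤ Q * (kk σ * (‖x‖ ^ σ / ‖x‖ ^ 2)) := by gcongr
      _ = _ := by field_simp
  · intro z hz
    exact d1 z (Om_sub hρ hz) (by linarith [(Om_rng hz).1]) (by linarith [(Om_rng hz).2])
  · intro hR z hz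
    have r := Om_rng hz
    have zR := ((mem_Om).1 hz).2
    have z0 : 0 < ‖z‖ := by linarith
    have nt : ∀ τ : ℝ, 1 ≤ τ → ‖τ • z‖ = τ * ‖z‖ := fun τ hτ => by
      rw [norm_smul, Real.norm_eq_abs, abs_of_nonneg (by linarith)]
    refine radial_bound (norm_pos_iff.1 z0) zR ?_ ?_ ?_
    · refine D.cont.comp (by fun_prop) fun τ hτ => ?_
      have h1 := hτ.1
      have h2 := hτ.2
      rw [le_div_iff₀ z0] at h2
      show 0 < ‖τ • z‖ ∧ ‖τ • z‖ ≤ R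
      rw [nt τ h1]
      exact ⟨by positivity, h2⟩
    · intro τ hτ
      have h1 := hτ.1
      have h2 := hτ.2
      rw [lt_div_iff₀ z0] at h2
      have m : τ • z ∈ Pun n R := by
        show 0 < ‖τ • z‖ ∧ ‖τ • z‖ < R
        rw [nt τ h1]
        exact ⟨by positivity, h2⟩
      have op : IsOpen (Pun n R) := (isOpen_lt continuous_const continuous_norm).inter (isOpen_lt continuous_norm continuous_const)
      refine ⟨((D.cd _ m).contDiffAt (op.mem_nhds m)).differentiableAt (by norm_num), d1 _ m ?_ ?_⟩
      · rw [nt τ h1]; nlinarith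
      · rw [nt τ h1]; linarith
    · apply D.bd
      rw [norm_smul, Real.norm_eq_abs, abs_of_pos (div_pos (by linarith) z0)]; field_simp


lemma small_eps {α η : ℝ} (hα : 0 < α) (hη : 0 < η) : ∃ ε : ℝ, 0 < ε ∧ 16 * ε ≤ 1 ∧ ε ^ α ≤ η := by
  refine ⟨min (1 / 16) (η ^ (1 / α)), by positivity, by linarith [min_le_left (1 / 16) (η ^ (1 / α))], ?_⟩
  have : (min (1 / 16) (η ^ (1 / α))) ^ α ≤ (η ^ (1 / α)) ^ α :=
    Real.rpow_le_rpow (by positivity) (min_le_right _ _) hα.le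
  have e : (η ^ (1 / α)) ^ α = η := by
    rw [← Real.rpow_mul hη.le, one_div, inv_mul_cancel₀ hα.ne', Real.rpow_one]
  rwa [e] at this

set_option maxSynthPendingDepth 10 in
lemma stepPB {n : ℕ} (hn : 0 < n) {α : ℝ} (hα : 0 < α) (hα1 : α < 1) (σ : ℝ) {c : ℝ} (hc : 0 ≤ c) :
    ∃ C, 0 ≤ C ∧ ∀ (R A0 B H : ℝ) (V W : E n → ℝ), Dat R σ α A0 B c V W → 0 ≤ H → PB R σ α H W →
      PB R σ α (H / 2 + C * (A0 + B)) W := by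
  have k1 := kk_ge σ
  set k := kk σ with hk
  obtain ⟨CL, hCL, hL⟩ := LL hn hα hα1 (θ := 1 / (4 * k)) (by positivity)
  set K := k * (CL * (128 * c + 1) + 4) * (40 * k) with hK
  have K0 : 0 < K := by positivity
  obtain ⟨ε, hε, hε1, hεα⟩ := small_eps (η := 1 / (4 * K)) hα (by positivity)
  refine ⟨K / ε ^ 2 + k * CL * (1 + 128 * c), by positivity, fun R A0 B H V W D hH hP => ?_⟩
  have hA0 := D.hA0
  have hB0 := D.hB0
  have hI := interp hα hα1 D hH hP hε hε1
  set Q := QQ σ α ε H A0 with hQd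
  have hQ : 0 ≤ Q := QQ_nonneg hH hA0 hε
  have Qe : k * (CL * (128 * c + 1) + 4) * Q = K * ε ^ α * H + K / ε ^ 2 * A0 := by
    rw [hQd, QQ, hK, ← hk]; ring
  have Ke : K * ε ^ α ≤ 1 / 4 := by
    calc K * ε ^ α ≤ K * (1 / (4 * K)) := by gcongr
      _ = 1 / 4 := by field_simp
  have fin1 : k * (1 / (4 * k) * H + CL * (B + 128 * c * (A0 + Q) + Q)) + 4 * k * Q ≤
      H / 2 + (K / ε ^ 2 + k * CL * (1 + 128 * c)) * (A0 + B) := by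
    have e : k * (1 / (4 * k) * H + CL * (B + 128 * c * (A0 + Q) + Q)) + 4 * k * Q =
      H / 4 + k * CL * (B + 128 * c * A0) + k * (CL * (128 * c + 1) + 4) * Q := by field_simp; ring
    rw [e, Qe]
    have : K * ε ^ α * H ≤ 1 / 4 * H := by gcongr
    have e2 : (K / ε ^ 2 + k * CL * (1 + 128 * c)) * (A0 + B) = k * CL * (B + 128 * c * A0) + K / ε ^ 2 * A0 +
      (K / ε ^ 2 * B + k * CL * (A0 + 128 * c * B)) := by ring
    have : 0 ≤ K / ε ^ 2 * B + k * CL * (A0 + 128 * c * B) := by positivity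
    rw [e2]; linarith
  intro x hx y hy hyx hxy
  have hρ := hx.1
  have X0 : 0 ≤ (‖x‖ ^ σ / ‖x‖ ^ 2 / ‖x‖ ^ α) * ‖x - y‖ ^ α := by positivity
  suffices h : ‖D2 W x - D2 W y‖ ≤ (k * (1 / (4 * k) * H + CL * (B + 128 * c * (A0 + Q) + Q)) + 4 * k * Q) *
      ((‖x‖ ^ σ / ‖x‖ ^ 2 / ‖x‖ ^ α) * ‖x - y‖ ^ α) by
    refine h.trans ?_
    rw [mul_assoc (H / 2 + (K / ε ^ 2 + k * CL * (1 + 128 * c)) * (A0 + B))]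
    exact mul_le_mul_of_nonneg_right fin1 X0
  rw [add_mul]
  by_cases hO : y ∈ Om R x
  · have L := mkLoc hα hα1 D hH hP hQ hI hx
    have := hL R x y W _ _ _ L hO hyx
    have e : ‖x‖ ^ (1 - α) = ‖x‖ / ‖x‖ ^ α := by rw [Real.rpow_sub hρ, Real.rpow_one]
    rw [e, ← hk] at this
    have e2 : ‖x - y‖ ^ α * (1 / (4 * k) * (k * H * (‖x‖ ^ σ / ‖x‖ ^ 2 / ‖x‖ ^ α)) +
      CL * (k * (B + 128 * c * (A0 + Q)) * (‖x‖ ^ σ / ‖x‖ ^ 2 / ‖x‖ ^ α) + k * Q * (‖x‖ ^ σ / ‖x‖ ^ 3) * (‖x‖ / ‖x‖ ^ α))) =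
      k * (1 / (4 * k) * H + CL * (B + 128 * c * (A0 + Q) + Q)) * ((‖x‖ ^ σ / ‖x‖ ^ 2 / ‖x‖ ^ α) * ‖x - y‖ ^ α) := by
      have : 0 < ‖x‖ ^ α := by positivity
      field_simp
    rw [e2] at this
    have : 0 ≤ 4 * k * Q * ((‖x‖ ^ σ / ‖x‖ ^ 2 / ‖x‖ ^ α) * ‖x - y‖ ^ α) := by positivity
    linarith
  · have hd : ‖x‖ / 2 ≤ ‖x - y‖ := by
      by_contra h
      push Not at h
      exact hO ((mem_Om).2 ⟨by rwa [norm_sub_rev], hy.2⟩)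
    have hdα : ‖x‖ ^ α ≤ 2 * ‖x - y‖ ^ α := by
      have h1 : ‖x‖ ^ α ≤ (2 * ‖x - y‖) ^ α := Real.rpow_le_rpow hρ.le (by linarith) hα.le
      rw [Real.mul_rpow (by norm_num) (norm_nonneg _)] at h1
      have h2 : (2:ℝ) ^ α ≤ 2 := by
        have := Real.rpow_le_rpow_of_exponent_le (x := 2) (by norm_num) hα1.le
        rwa [Real.rpow_one] at this
      exact h1.trans (by gcongr)
    have w := (wts (σ := σ) hα hα1 hρ (s := ‖y‖) (by linarith) (by linarith)).2.2.1
    have b1 := (hI x hx).1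
    have b2 := (hI y hy).1
    have b3 : Q * (‖y‖ ^ σ / ‖y‖ ^ 2) ≤ Q * (k * (‖x‖ ^ σ / ‖x‖ ^ 2)) := by gcongr
    have b4 : Q * (‖x‖ ^ σ / ‖x‖ ^ 2) ≤ Q * (k * (‖x‖ ^ σ / ‖x‖ ^ 2)) := by
      have : 0 ≤ ‖x‖ ^ σ / ‖x‖ ^ 2 := by positivity
      gcongr; nlinarith
    have b5 : 2 * (Q * (k * (‖x‖ ^ σ / ‖x‖ ^ 2))) ≤ 4 * k * Q * ((‖x‖ ^ σ / ‖x‖ ^ 2 / ‖x‖ ^ α) * ‖x - y‖ ^ α) := by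
      have p : 0 < ‖x‖ ^ α := by positivity
      calc _ = 2 * k * Q * (‖x‖ ^ σ / ‖x‖ ^ 2 / ‖x‖ ^ α) * ‖x‖ ^ α := by field_simp
        _ ≤ 2 * k * Q * (‖x‖ ^ σ / ‖x‖ ^ 2 / ‖x‖ ^ α) * (2 * ‖x - y‖ ^ α) := by gcongr
        _ = _ := by ring
    have b6 : 0 ≤ k * (1 / (4 * k) * H + CL * (B + 128 * c * (A0 + Q) + Q)) * ((‖x‖ ^ σ / ‖x‖ ^ 2 / ‖x‖ ^ α) * ‖x - y‖ ^ α) := by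
      positivity
    have := norm_sub_le (D2 W x) (D2 W y)
    linarith

lemma core {n : ℕ} (hn : 0 < n) {α : ℝ} (hα : 0 < α) (hα1 : α < 1) (σ : ℝ) {c : ℝ} (hc : 0 ≤ c) :
    ∃ C, 0 ≤ C ∧ ∀ (R A0 B H : ℝ) (V W : E n → ℝ), Dat R σ α A0 B c V W → 0 ≤ H → PB R σ α H W →
      PB R σ α (C * (A0 + B)) W ∧ ∀ x ∈ Pun n R, ‖D2 W x‖ ≤ C * (A0 + B) * (‖x‖ ^ σ / ‖x‖ ^ 2) ∧
        ‖fderiv ℝ W x‖ ≤ C * (A0 + B) * (‖x‖ ^ σ / ‖x‖) := by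
  obtain ⟨C, hC, hs⟩ := stepPB hn hα hα1 σ hc
  have k1 := kk_ge σ
  have main : ∀ (R A0 B H : ℝ) (V W : E n → ℝ), Dat R σ α A0 B c V W → 0 ≤ H → PB R σ α H W →
      PB R σ α (2 * C * (A0 + B)) W := by
    intro R A0 B H V W D hH hP
    have hA0 := D.hA0
    have hB0 := D.hB0
    have it : ∀ m : ℕ, PB R σ α ((1 / 2) ^ m * H + 2 * C * (A0 + B)) W := by
      intro m
      induction m with
      | zero =>
        intro x hx y hy h1 h2
        refine (hP x hx y hy h1 h2).trans ?_
        gcongr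
        have : 0 ≤ 2 * C * (A0 + B) := by positivity
        simp only [pow_zero, one_mul]; linarith
      | succ m ih =>
        have := hs R A0 B _ V W D (by positivity) ih
        have e : ((1 / 2) ^ m * H + 2 * C * (A0 + B)) / 2 + C * (A0 + B) = (1 / 2) ^ (m + 1) * H + 2 * C * (A0 + B) := by
          rw [pow_succ]; ring
        rwa [e] at this
    intro x hx y hy h1 h2
    have t : Tendsto (fun m : ℕ => ((1 / 2 : ℝ) ^ m * H + 2 * C * (A0 + B)) * (‖x‖ ^ σ / ‖x‖ ^ 2 / ‖x‖ ^ α) * ‖x - y‖ ^ α) atTop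
        (𝓝 ((0 * H + 2 * C * (A0 + B)) * (‖x‖ ^ σ / ‖x‖ ^ 2 / ‖x‖ ^ α) * ‖x - y‖ ^ α)) := by
      have t0 : Tendsto (fun m : ℕ => (1 / 2 : ℝ) ^ m) atTop (𝓝 0) :=
        tendsto_pow_atTop_nhds_zero_of_lt_one (by norm_num) (by norm_num)
      exact (((t0.mul_const H).add_const _).mul_const _).mul_const _
    rw [zero_mul, zero_add] at t
    exact ge_of_tendsto' t fun m => it m x hx y hy h1 h2
  have q0 : 0 ≤ QQ σ α (1 / 16) (2 * C) 1 := QQ_nonneg (by positivity) (by norm_num) (by norm_num)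
  refine ⟨2 * C + QQ σ α (1 / 16) (2 * C) 1, by positivity, fun R A0 B H V W D hH hP => ?_⟩
  have hA0 := D.hA0
  have hB0 := D.hB0
  have P := main R A0 B H V W D hH hP
  have I := interp hα hα1 D (by positivity) P (ε := 1 / 16) (by norm_num) (by norm_num)
  have e : QQ σ α (1 / 16) (2 * C * (A0 + B)) A0 ≤ (2 * C + QQ σ α (1 / 16) (2 * C) 1) * (A0 + B) := by
    have : QQ σ α (1 / 16) (2 * C) 1 * (A0 + B) = QQ σ α (1 / 16) (2 * C * (A0 + B)) A0 + kk σ * (40 / (1 / 16) ^ 2) * B := by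
      rw [QQ, QQ]; ring
    have : 0 ≤ kk σ * (40 / (1 / 16) ^ 2) * B := by positivity
    have : 0 ≤ 2 * C * (A0 + B) := by positivity
    linarith
  refine ⟨fun x hx y hy h1 h2 => (P x hx y hy h1 h2).trans ?_, fun x hx => ⟨(I x hx).1.trans ?_, (I x hx).2.trans ?_⟩⟩
  · gcongr; linarith
  · gcongr
  · gcongr


def Vp (n : ℕ) (ψ : ℝ → ℝ) (x : E n) : ℝ :=
  ((n : ℝ) * ((n : ℝ) + 2)) / 4 * ‖x‖ ^ (-2 : ℝ) * ψ (-Real.log ‖x‖) ^ ((4 : ℝ) / ((n : ℝ) - 2))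

lemma pot {n : ℕ} (hn : 3 ≤ n) {ψ : ℝ → ℝ} {T : ℝ} (hψ : IsStdRadial n ψ T) : ∃ c, 0 ≤ c ∧
    (∀ x : E n, 0 < ‖x‖ → |Vp n ψ x| ≤ c / ‖x‖ ^ 2) ∧
    (∀ x y : E n, 0 < ‖x‖ → 0 < ‖y‖ → ‖y‖ ≤ ‖x‖ → ‖x‖ ≤ 4 * ‖y‖ → |Vp n ψ x - Vp n ψ y| ≤ c / ‖x‖ ^ 3 * ‖x - y‖) := by
  obtain ⟨hs, hT, hper, h01, -⟩ := hψ
  have hn' : (3:ℝ) ≤ n := by exact_mod_cast hn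
  set p := (4 : ℝ) / ((n : ℝ) - 2) with hp
  have p0 : 0 < p := div_pos (by norm_num) (by linarith)
  set g : ℝ → ℝ := fun t => ψ t ^ p with hg
  have g01 : ∀ t, 0 ≤ g t ∧ g t ≤ 1 := fun t =>
    ⟨(Real.rpow_pos_of_pos (h01 t).1 _).le, Real.rpow_le_one (h01 t).1.le (h01 t).2.le p0.le⟩
  have gs : ContDiff ℝ 1 g := (hs.of_le (by exact_mod_cast le_top)).rpow_const_of_ne fun t => (h01 t).1.ne'
  have gper : Function.Periodic g T := fun t => by simp only [hg, hper t]
  have dper : Function.Periodic (deriv g) T := fun t => by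
    rw [← deriv_comp_add_const]
    congr 1
    funext s; exact gper s
  obtain ⟨L, hL⟩ := (dper.isBounded_of_continuous hT.ne' gs.continuous_deriv_one).exists_norm_le
  have L0 : 0 ≤ L := (norm_nonneg _).trans (hL (deriv g 0) ⟨0, rfl⟩)
  have gL : ∀ s t, |g s - g t| ≤ L * |s - t| := fun s t =>
    convex_univ.norm_image_sub_le_of_norm_deriv_le (f := g) (fun x _ => (gs.differentiable (by norm_num)) x)
      (fun x _ => hL _ ⟨x, rfl⟩) (Set.mem_univ t) (Set.mem_univ s)
  set c0 := ((n : ℝ) * ((n : ℝ) + 2)) / 4 with hc0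
  have c00 : 0 ≤ c0 := by positivity
  have Ve : ∀ x : E n, 0 < ‖x‖ → Vp n ψ x = c0 * (g (-Real.log ‖x‖) / ‖x‖ ^ 2) := fun x hx => by
    rw [Vp, Real.rpow_neg hx.le, show (2:ℝ) = ((2:ℕ):ℝ) by norm_num, Real.rpow_natCast]
    simp only [hg, hc0, hp, Nat.cast_ofNat]
    ring
  refine ⟨c0 * (4 * L + 32), by positivity, fun x hx => ?_, fun x y hx hy hyx hxy => ?_⟩
  · have := g01 (-Real.log ‖x‖)
    rw [Ve x hx, abs_of_nonneg (mul_nonneg c00 (div_nonneg this.1 (by positivity))), mul_div_assoc]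
    gcongr
    linarith
  · rw [Ve x hx, Ve y hy, ← mul_sub, abs_mul, abs_of_nonneg c00]
    have hd : ‖x‖ - ‖y‖ ≤ ‖x - y‖ := norm_sub_norm_le x y
    set r := ‖x‖
    set s := ‖y‖
    have lg : |g (-Real.log r) - g (-Real.log s)| ≤ L * (4 * (r - s) / r) := by
      refine (gL _ _).trans ?_
      gcongr
      have h1 : Real.log s ≤ Real.log r := Real.log_le_log hy hyx
      rw [abs_of_nonpos (by linarith)]
      have h2 : Real.log r - Real.log s = Real.log (r / s) := (Real.log_div hx.ne' hy.ne').symm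
      have h3 := Real.log_le_sub_one_of_pos (div_pos hx hy)
      have h4 : r / s - 1 ≤ 4 * (r - s) / r := by
        rw [show r / s - 1 = (r - s) / s by field_simp, div_le_div_iff₀ hy hx]
        nlinarith
      linarith
    have h5 : |1 / r ^ 2 - 1 / s ^ 2| ≤ 32 * (r - s) / r ^ 3 := by
      have e : 1 / s ^ 2 - 1 / r ^ 2 = (r - s) * (r + s) / (r ^ 2 * s ^ 2) := by field_simp; ring
      rw [abs_sub_comm, e, abs_of_nonneg (div_nonneg (mul_nonneg (by linarith) (by linarith)) (by positivity)),
        div_le_div_iff₀ (by positivity) (by positivity)]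
      have a1 : (r + s) * r ^ 3 ≤ 32 * (r ^ 2 * s ^ 2) := by
        have : r ^ 2 ≤ (4 * s) ^ 2 := by gcongr
        calc (r + s) * r ^ 3 ≤ (r + r) * r ^ 3 := by gcongr
          _ = 2 * (r ^ 2 * r ^ 2) := by ring
          _ ≤ 2 * (r ^ 2 * (4 * s) ^ 2) := by gcongr
          _ = _ := by ring
      calc _ = (r - s) * ((r + s) * r ^ 3) := by ring
        _ ≤ (r - s) * (32 * (r ^ 2 * s ^ 2)) := mul_le_mul_of_nonneg_left a1 (by linarith)
        _ = _ := by ring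
    have e : g (-Real.log r) / r ^ 2 - g (-Real.log s) / s ^ 2 =
      1 / r ^ 2 * (g (-Real.log r) - g (-Real.log s)) + g (-Real.log s) * (1 / r ^ 2 - 1 / s ^ 2) := by ring
    have gs' := g01 (-Real.log s)
    have f : |g (-Real.log r) / r ^ 2 - g (-Real.log s) / s ^ 2| ≤ (4 * L + 32) / r ^ 3 * (r - s) := by
      rw [e]
      refine (abs_add_le _ _).trans ?_
      rw [abs_mul, abs_mul, abs_of_nonneg gs'.1, abs_of_pos (by positivity : 0 < 1 / r ^ 2)]
      calc _ ≤ 1 / r ^ 2 * (L * (4 * (r - s) / r)) + 1 * (32 * (r - s) / r ^ 3) := by gcongr; exact gs'.2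
        _ = _ := by field_simp
    calc _ ≤ c0 * ((4 * L + 32) / r ^ 3 * (r - s)) := by gcongr
      _ ≤ c0 * ((4 * L + 32) / r ^ 3 * ‖x - y‖) := by gcongr
      _ = _ := by ring


lemma bdry_fderiv {n : ℕ} {W : E n → ℝ} {x : E n} {R A : ℝ} (hR : 0 < R) (hx : ‖x‖ = R) (hA : 0 ≤ A)
    (hW : ∀ z, R / 2 ≤ ‖z‖ → ‖z‖ < R → |W z| ≤ A * (R - ‖z‖)) (h0 : W x = 0) : ‖fderiv ℝ W x‖ ≤ A := by
  by_cases hd : DifferentiableAt ℝ W x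
  swap
  · rw [fderiv_zero_of_not_differentiableAt hd, norm_zero]; exact hA
  have neg : ∀ v : E n, inner ℝ x v < 0 → |fderiv ℝ W x v| ≤ A * ‖v‖ := by
    intro v hv
    have h1 : HasDerivAt (fun s : ℝ => W (x + s • v)) (fderiv ℝ W x v) 0 := by
      have h2 : HasFDerivAt W (fderiv ℝ W x) (x + (0:ℝ) • v) := by simpa using hd.hasFDerivAt
      exact h2.comp_hasDerivAt (0:ℝ) (hasDerivAt_line x v 0)
    have t := h1.tendsto_slope_zero_right
    have tc : Tendsto (fun s : ℝ => ‖x + s • v‖) (𝓝[>] 0) (𝓝 R) := by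
      have : Continuous (fun s : ℝ => ‖x + s • v‖) := by fun_prop
      have := this.tendsto 0
      simp only [zero_smul, add_zero, hx] at this
      exact this.mono_left nhdsWithin_le_nhds
    have tq : Tendsto (fun s : ℝ => 2 * inner ℝ x v + s * ‖v‖ ^ 2) (𝓝[>] 0) (𝓝 (2 * inner ℝ x v)) := by
      have : Continuous (fun s : ℝ => 2 * inner ℝ x v + s * ‖v‖ ^ 2) := by fun_prop
      have := this.tendsto 0
      simp only [zero_mul, add_zero] at this
      exact this.mono_left nhdsWithin_le_nhds
    have ev : ∀ᶠ s : ℝ in 𝓝[>] 0, |s⁻¹ • (W (x + (0 + s) • v) - W (x + (0:ℝ) • v))| ≤ A * ‖v‖ := by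
      filter_upwards [tc.eventually_const_le (by linarith : R / 2 < R), tq.eventually_lt_const (by linarith : 2 * inner ℝ x v < 0),
        self_mem_nhdsWithin] with s s1 s2 s3
      have s3 : 0 < s := s3
      have e : ‖x + s • v‖ ^ 2 = R ^ 2 + s * (2 * inner ℝ x v + s * ‖v‖ ^ 2) := by
        rw [norm_add_sq_real, inner_smul_right, norm_smul, hx, Real.norm_eq_abs, mul_pow, sq_abs]; ring
      have lt : ‖x + s • v‖ < R := by
        have : s * (2 * inner ℝ x v + s * ‖v‖ ^ 2) < 0 := mul_neg_of_pos_of_neg s3 s2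
        exact lt_of_pow_lt_pow_left₀ 2 hR.le (by linarith)
      have b := hW _ s1 lt
      have b2 : R - ‖x + s • v‖ ≤ s * ‖v‖ := by
        have := norm_sub_norm_le x (x + s • v)
        rw [hx, sub_add_cancel_left, norm_neg, norm_smul, Real.norm_eq_abs, abs_of_pos s3] at this
        exact this
      rw [zero_add, zero_smul, add_zero, h0, sub_zero, smul_eq_mul, abs_mul, abs_of_pos (inv_pos.2 s3)]
      calc _ ≤ s⁻¹ * (A * (s * ‖v‖)) := by gcongr; exact b.trans (by gcongr)
        _ = _ := by field_simp
    exact le_of_tendsto t.abs ev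
  have nonpos : ∀ v : E n, inner ℝ x v ≤ 0 → |fderiv ℝ W x v| ≤ A * ‖v‖ := by
    intro v hv
    have c1 : Tendsto (fun s : ℝ => |fderiv ℝ W x (v - s • x)|) (𝓝[>] 0) (𝓝 |fderiv ℝ W x v|) := by
      have : Continuous (fun s : ℝ => |fderiv ℝ W x (v - s • x)|) := by fun_prop
      have := this.tendsto 0
      simp only [zero_smul, sub_zero] at this
      exact this.mono_left nhdsWithin_le_nhds
    have c2 : Tendsto (fun s : ℝ => A * ‖v - s • x‖) (𝓝[>] 0) (𝓝 (A * ‖v‖)) := by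
      have : Continuous (fun s : ℝ => A * ‖v - s • x‖) := by fun_prop
      have := this.tendsto 0
      simp only [zero_smul, sub_zero] at this
      exact this.mono_left nhdsWithin_le_nhds
    refine le_of_tendsto_of_tendsto c1 c2 ?_
    filter_upwards [self_mem_nhdsWithin] with s hs
    have hs : 0 < s := hs
    apply neg
    rw [inner_sub_right, inner_smul_right, real_inner_self_eq_norm_sq, hx]
    have : 0 < s * R ^ 2 := by positivity
    linarith
  refine ContinuousLinearMap.opNorm_le_bound _ hA fun v => ?_
  rw [Real.norm_eq_abs]
  rcases le_total (inner ℝ x v) 0 with h | h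
  · exact nonpos v h
  · have := nonpos (-v) (by rw [inner_neg_right]; linarith)
    rwa [map_neg, abs_neg, norm_neg] at this

set_option maxSynthPendingDepth 10 in
lemma coreC {n : ℕ} (hn : 0 < n) {α : ℝ} (hα : 0 < α) (hα1 : α < 1) (σ : ℝ) {c : ℝ} (hc : 0 ≤ c) :
    ∃ C, 0 ≤ C ∧ ∀ (R A0 B H : ℝ) (V W : E n → ℝ), 0 < R → Dat R σ α A0 B c V W → 0 ≤ H →
      (∀ x y : E n, ‖x‖ ≤ R → 0 < ‖y‖ → ‖y‖ ≤ ‖x‖ → ‖x‖ ≤ 4 * ‖y‖ →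
        ‖D2 W x - D2 W y‖ ≤ H * (‖x‖ ^ σ / ‖x‖ ^ 2 / ‖x‖ ^ α) * ‖x - y‖ ^ α) →
      (∀ x y : E n, ‖x‖ ≤ R → 0 < ‖y‖ → ‖y‖ ≤ ‖x‖ → ‖x‖ ≤ 4 * ‖y‖ →
        ‖D2 W x - D2 W y‖ ≤ C * (A0 + B) * (‖x‖ ^ σ / ‖x‖ ^ 2 / ‖x‖ ^ α) * ‖x - y‖ ^ α) ∧
      ∀ x : E n, 0 < ‖x‖ → ‖x‖ ≤ R → ‖D2 W x‖ ≤ C * (A0 + B) * (‖x‖ ^ σ / ‖x‖ ^ 2) ∧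
        ‖fderiv ℝ W x‖ ≤ C * (A0 + B) * (‖x‖ ^ σ / ‖x‖) := by
  obtain ⟨C, hC, hcore⟩ := core hn hα hα1 σ hc
  have k1 := kk_ge σ
  refine ⟨kk σ * C, by positivity, fun R A0 B H V W hR D hH hP => ?_⟩
  have hA0 := D.hA0
  have hB0 := D.hB0
  obtain ⟨P, I⟩ := hcore R A0 B H V W D hH (fun x hx y hy h1 h2 => hP x y hx.2.le hy.1 h1 h2)
  have CC : C * (A0 + B) ≤ kk σ * C * (A0 + B) := by
    have : 0 ≤ C * (A0 + B) := by positivity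
    rw [mul_assoc]; nlinarith
  have lim : ∀ x : E n, 0 < ‖x‖ → ‖x‖ ≤ R → Tendsto (fun s : ℝ => D2 W ((1 - s) • x)) (𝓝[>] 0) (𝓝 (D2 W x)) := by
    intro x h0 h1
    rw [tendsto_iff_norm_sub_tendsto_zero]
    have t : Tendsto (fun s : ℝ => H * (‖x‖ ^ σ / ‖x‖ ^ 2 / ‖x‖ ^ α) * (s * ‖x‖) ^ α) (𝓝[>] 0) (𝓝 0) := by
      have c1 : Continuous (fun s : ℝ => H * (‖x‖ ^ σ / ‖x‖ ^ 2 / ‖x‖ ^ α) * (s * ‖x‖) ^ α) :=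
        continuous_const.mul ((continuous_id.mul continuous_const).rpow_const fun _ => Or.inr hα.le)
      have := c1.tendsto 0
      simp only [zero_mul, Real.zero_rpow hα.ne', mul_zero] at this
      exact this.mono_left nhdsWithin_le_nhds
    refine squeeze_zero' (Eventually.of_forall fun _ => norm_nonneg _) ?_ t
    filter_upwards [Ioo_mem_nhdsGT (by norm_num : (0:ℝ) < 1 / 2)] with s hs
    have ns : ‖(1 - s) • x‖ = (1 - s) * ‖x‖ := by
      rw [norm_smul, Real.norm_eq_abs, abs_of_pos (by linarith [hs.2])]
    have := hP x ((1 - s) • x) h1 (by rw [ns]; exact mul_pos (by linarith [hs.2]) h0) (by rw [ns]; nlinarith [hs.1])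
      (by rw [ns]; nlinarith [hs.2])
    rw [norm_sub_rev]
    have e : x - (1 - s) • x = s • x := by module
    rwa [e, norm_smul, Real.norm_eq_abs, abs_of_pos hs.1] at this
  have wlim : ∀ x : E n, 0 < ‖x‖ → Tendsto (fun s : ℝ => ‖(1 - s) • x‖) (𝓝[>] 0) (𝓝 ‖x‖) := by
    intro x h0
    have : Continuous (fun s : ℝ => ‖(1 - s) • x‖) := by fun_prop
    have := this.tendsto 0
    simp only [sub_zero, one_smul] at this
    exact this.mono_left nhdsWithin_le_nhds
  have mem : ∀ x : E n, 0 < ‖x‖ → ‖x‖ ≤ R → ∀ s ∈ Set.Ioo (0:ℝ) (1 / 2), (1 - s) • x ∈ Pun n R := by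
    intro x h0 h1 s hs
    show 0 < ‖(1 - s) • x‖ ∧ ‖(1 - s) • x‖ < R
    rw [norm_smul, Real.norm_eq_abs, abs_of_pos (by linarith [hs.2])]
    exact ⟨mul_pos (by linarith [hs.2]) h0, by nlinarith [hs.1]⟩
  have w2 : ∀ x : E n, 0 < ‖x‖ → Tendsto (fun s : ℝ => C * (A0 + B) * (‖(1 - s) • x‖ ^ σ / ‖(1 - s) • x‖ ^ 2)) (𝓝[>] 0)
      (𝓝 (C * (A0 + B) * (‖x‖ ^ σ / ‖x‖ ^ 2))) := fun x h0 =>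
    (((wlim x h0).rpow_const (Or.inl h0.ne')).div ((wlim x h0).pow 2) (by positivity)).const_mul _
  have w3 : ∀ x : E n, 0 < ‖x‖ → Tendsto (fun s : ℝ => C * (A0 + B) * (‖(1 - s) • x‖ ^ σ / ‖(1 - s) • x‖ ^ 2 / ‖(1 - s) • x‖ ^ α)) (𝓝[>] 0)
      (𝓝 (C * (A0 + B) * (‖x‖ ^ σ / ‖x‖ ^ 2 / ‖x‖ ^ α))) := fun x h0 =>
    ((((wlim x h0).rpow_const (Or.inl h0.ne')).div ((wlim x h0).pow 2) (by positivity)).div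
      ((wlim x h0).rpow_const (Or.inl h0.ne')) (by positivity)).const_mul _
  constructor
  · intro x y hx hy hyx hxy
    have hx0 : 0 < ‖x‖ := by linarith
    have t1 := ((lim x hx0 hx).sub (lim y hy (hyx.trans hx))).norm
    have t2 : Tendsto (fun s : ℝ => ‖(1 - s) • x - (1 - s) • y‖ ^ α) (𝓝[>] 0) (𝓝 (‖x - y‖ ^ α)) := by
      have : Continuous (fun s : ℝ => ‖(1 - s) • x - (1 - s) • y‖ ^ α) :=
        Continuous.rpow_const (by fun_prop) fun _ => Or.inr hα.le
      have := this.tendsto 0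
      simp only [sub_zero, one_smul] at this
      exact this.mono_left nhdsWithin_le_nhds
    have key : ‖D2 W x - D2 W y‖ ≤ C * (A0 + B) * (‖x‖ ^ σ / ‖x‖ ^ 2 / ‖x‖ ^ α) * ‖x - y‖ ^ α := by
      refine le_of_tendsto_of_tendsto t1 ((w3 x hx0).mul t2) ?_
      filter_upwards [Ioo_mem_nhdsGT (by norm_num : (0:ℝ) < 1 / 2)] with s hs
      have ns : ∀ x : E n, ‖(1 - s) • x‖ = (1 - s) * ‖x‖ := fun x => by
        rw [norm_smul, Real.norm_eq_abs, abs_of_pos (by linarith [hs.2])]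
      refine P _ (mem x hx0 hx s hs) _ (mem y hy (hyx.trans hx) s hs) ?_ ?_
      · rw [ns, ns]; exact mul_le_mul_of_nonneg_left hyx (by linarith [hs.2])
      · rw [ns, ns]; nlinarith [hs.2]
    refine key.trans ?_
    gcongr
  · intro x hx0 hx
    constructor
    · have key : ‖D2 W x‖ ≤ C * (A0 + B) * (‖x‖ ^ σ / ‖x‖ ^ 2) := by
        refine le_of_tendsto_of_tendsto (lim x hx0 hx).norm (w2 x hx0) ?_
        filter_upwards [Ioo_mem_nhdsGT (by norm_num : (0:ℝ) < 1 / 2)] with s hs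
        exact (I _ (mem x hx0 hx s hs)).1
      exact key.trans (by gcongr)
    · rcases hx.lt_or_eq with h | h
      · exact (I x ⟨hx0, h⟩).2.trans (by gcongr)
      · refine bdry_fderiv hR h (by positivity) ?_ (D.bd x h)
        intro z z1 zR
        have z0 : 0 < ‖z‖ := by linarith
        have nt : ∀ τ : ℝ, 1 ≤ τ → ‖τ • z‖ = τ * ‖z‖ := fun τ hτ => by
          rw [norm_smul, Real.norm_eq_abs, abs_of_nonneg (by linarith)]
        refine radial_bound (norm_pos_iff.1 z0) zR ?_ ?_ ?_
        · refine D.cont.comp (by fun_prop) fun τ hτ => ?_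
          have h1 := hτ.1
          have h2 := hτ.2
          rw [le_div_iff₀ z0] at h2
          show 0 < ‖τ • z‖ ∧ ‖τ • z‖ ≤ R
          rw [nt τ h1]
          exact ⟨by positivity, h2⟩
        · intro τ hτ
          have h1 := hτ.1
          have h2 := hτ.2
          rw [lt_div_iff₀ z0] at h2
          have m : τ • z ∈ Pun n R := by
            show 0 < ‖τ • z‖ ∧ ‖τ • z‖ < R
            rw [nt τ h1]
            exact ⟨by positivity, h2⟩
          have op : IsOpen (Pun n R) := (isOpen_lt continuous_const continuous_norm).inter (isOpen_lt continuous_norm continuous_const)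
          refine ⟨((D.cd _ m).contDiffAt (op.mem_nhds m)).differentiableAt (by norm_num), (I _ m).2.trans ?_⟩
          have := (wts (σ := σ) hα hα1 hx0 (s := ‖τ • z‖) (by rw [nt τ h1]; nlinarith) (by rw [nt τ h1]; linarith)).2.1
          calc _ ≤ C * (A0 + B) * (kk σ * (‖x‖ ^ σ / ‖x‖)) := by gcongr
            _ = _ := by ring
        · apply D.bd
          rw [norm_smul, Real.norm_eq_abs, abs_of_pos (div_pos (by linarith) z0)]; field_simp


set_option maxSynthPendingDepth 10 in
lemma iter2_le {n : ℕ} (W : E n → ℝ) (x : E n) : ‖iteratedFDeriv ℝ 2 W x‖ ≤ ‖D2 W x‖ := by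
  refine ContinuousMultilinearMap.opNorm_le_bound (norm_nonneg _) fun m => ?_
  rw [iteratedFDeriv_two_apply, Fin.prod_univ_two, ← mul_assoc]
  exact (D2 W x).le_opNorm₂ _ _

set_option maxSynthPendingDepth 10 in
lemma iter2_sub_le {n : ℕ} (W : E n → ℝ) (x y : E n) :
    ‖iteratedFDeriv ℝ 2 W x - iteratedFDeriv ℝ 2 W y‖ ≤ ‖D2 W x - D2 W y‖ := by
  refine ContinuousMultilinearMap.opNorm_le_bound (norm_nonneg _) fun m => ?_
  rw [ContinuousMultilinearMap.sub_apply, iteratedFDeriv_two_apply, iteratedFDeriv_two_apply, Fin.prod_univ_two, ← mul_assoc]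
  exact (D2 W x - D2 W y).le_opNorm₂ _ _

set_option maxSynthPendingDepth 10 in
lemma le_iter2_sub {n : ℕ} (W : E n → ℝ) (x y : E n) :
    ‖D2 W x - D2 W y‖ ≤ ‖iteratedFDeriv ℝ 2 W x - iteratedFDeriv ℝ 2 W y‖ := by
  refine (D2 W x - D2 W y).opNorm_le_bound₂ (norm_nonneg _) fun v w => ?_
  have := (iteratedFDeriv ℝ 2 W x - iteratedFDeriv ℝ 2 W y).le_opNorm ![v, w]
  rw [ContinuousMultilinearMap.sub_apply, iteratedFDeriv_two_apply, iteratedFDeriv_two_apply, Fin.prod_univ_two, ← mul_assoc] at this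
  exact this

lemma iter0_sub {n : ℕ} (F : E n → ℝ) (x y : E n) :
    |F x - F y| ≤ ‖iteratedFDeriv ℝ 0 F x - iteratedFDeriv ℝ 0 F y‖ := by
  have := (iteratedFDeriv ℝ 0 F x - iteratedFDeriv ℝ 0 F y).le_opNorm ![]
  rw [ContinuousMultilinearMap.sub_apply, iteratedFDeriv_zero_apply, iteratedFDeriv_zero_apply] at this
  simpa using this

lemma semi_pair {n : ℕ} {X : Type*} [NormedAddCommGroup X] {α p r₀ K : ℝ} {f : E n → X} (hα : 0 < α) (hK : 0 ≤ K)
    (h : (⨆ (r : ℝ) (_ : 0 < r ∧ r ≤ r₀ / Real.exp 1), ENNReal.ofReal (r ^ p) *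
        holderSemi α {x : E n | r / Real.exp 1 ≤ ‖x‖ ∧ ‖x‖ ≤ Real.exp 1 * r} f) ≤ ENNReal.ofReal K) {x y : E n}
    (hx : ‖x‖ ≤ r₀) (hy : 0 < ‖y‖) (hyx : ‖y‖ ≤ ‖x‖) (hxy : ‖x‖ ≤ 4 * ‖y‖) :
    ‖f x - f y‖ ≤ K * Real.exp 1 ^ p / ‖x‖ ^ p * ‖x - y‖ ^ α := by
  by_cases e : x = y
  · subst e; simp [Real.zero_rpow hα.ne']
  have hx0 : 0 < ‖x‖ := by linarith
  have d0 : 0 < ‖x - y‖ := norm_pos_iff.2 (sub_ne_zero.2 e)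
  have e0 := Real.exp_pos 1
  have e2 : 2 ≤ Real.exp 1 := by linarith [Real.add_one_le_exp (1:ℝ)]
  set r := ‖x‖ / Real.exp 1 with hr
  have r0 : 0 < r := by positivity
  have re : Real.exp 1 * r = ‖x‖ := by rw [hr]; field_simp
  have rl : r ≤ r₀ / Real.exp 1 := by rw [hr]; gcongr
  have mem : ∀ z : E n, ‖z‖ ≤ ‖x‖ → ‖x‖ ≤ 4 * ‖z‖ → z ∈ {x : E n | r / Real.exp 1 ≤ ‖x‖ ∧ ‖x‖ ≤ Real.exp 1 * r} := by
    intro z h1 h2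
    refine ⟨?_, by rwa [re]⟩
    rw [div_le_iff₀ e0, hr, div_le_iff₀ e0]
    have : 4 * ‖z‖ ≤ Real.exp 1 * Real.exp 1 * ‖z‖ := by gcongr; nlinarith
    linarith
  have h1 := (le_iSup₂ (f := fun (r : ℝ) (_ : 0 < r ∧ r ≤ r₀ / Real.exp 1) => ENNReal.ofReal (r ^ p) *
        holderSemi α {x : E n | r / Real.exp 1 ≤ ‖x‖ ∧ ‖x‖ ≤ Real.exp 1 * r} f) r ⟨r0, rl⟩).trans h
  have h2 : ENNReal.ofReal (‖f x - f y‖ / ‖x - y‖ ^ α) ≤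
      holderSemi α {x : E n | r / Real.exp 1 ≤ ‖x‖ ∧ ‖x‖ ≤ Real.exp 1 * r} f := by
    unfold holderSemi
    exact le_iSup_of_le x <| le_iSup_of_le (mem x le_rfl (by linarith)) <| le_iSup_of_le y <|
      le_iSup_of_le (mem y hyx hxy) <| le_iSup_of_le e le_rfl
  have h3 : ENNReal.ofReal (r ^ p) * ENNReal.ofReal (‖f x - f y‖ / ‖x - y‖ ^ α) ≤ ENNReal.ofReal K :=
    (by gcongr : _ ≤ _).trans h1
  rw [← ENNReal.ofReal_mul (by positivity), ENNReal.ofReal_le_ofReal_iff hK, hr, Real.div_rpow hx0.le e0.le] at h3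
  have q1 : 0 < ‖x‖ ^ p := by positivity
  have q2 : 0 < Real.exp 1 ^ p := by positivity
  have q3 : 0 < ‖x - y‖ ^ α := by positivity
  calc ‖f x - f y‖ = (‖x‖ ^ p / Real.exp 1 ^ p * (‖f x - f y‖ / ‖x - y‖ ^ α)) * (Real.exp 1 ^ p / ‖x‖ ^ p * ‖x - y‖ ^ α) := by
        field_simp
    _ ≤ K * (Real.exp 1 ^ p / ‖x‖ ^ p * ‖x - y‖ ^ α) := by gcongr
    _ = _ := by ring

lemma semi_le {n : ℕ} {X : Type*} [NormedAddCommGroup X] {α p r₀ K : ℝ} {f : E n → X}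
    (h : ∀ (r : ℝ) (x y : E n), 0 < r → r ≤ r₀ / Real.exp 1 → r / Real.exp 1 ≤ ‖x‖ → ‖x‖ ≤ Real.exp 1 * r →
      r / Real.exp 1 ≤ ‖y‖ → ‖y‖ ≤ Real.exp 1 * r → x ≠ y → ‖f x - f y‖ ≤ K / r ^ p * ‖x - y‖ ^ α) :
    (⨆ (r : ℝ) (_ : 0 < r ∧ r ≤ r₀ / Real.exp 1), ENNReal.ofReal (r ^ p) *
        holderSemi α {x : E n | r / Real.exp 1 ≤ ‖x‖ ∧ ‖x‖ ≤ Real.exp 1 * r} f) ≤ ENNReal.ofReal K := by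
  refine iSup₂_le fun r hr => ?_
  have q1 : 0 < r ^ p := Real.rpow_pos_of_pos hr.1 _
  have : holderSemi α {x : E n | r / Real.exp 1 ≤ ‖x‖ ∧ ‖x‖ ≤ Real.exp 1 * r} f ≤ ENNReal.ofReal (K / r ^ p) := by
    unfold holderSemi
    refine iSup_le fun x => iSup_le fun hx => iSup_le fun y => iSup_le fun hy => iSup_le fun e => ?_
    apply ENNReal.ofReal_le_ofReal
    have d0 : 0 < ‖x - y‖ := norm_pos_iff.2 (sub_ne_zero.2 e)
    rw [div_le_iff₀ (by positivity)]
    exact h r x y hr.1 hr.2 hx.1 hx.2 hy.1 hy.2 e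
  calc _ ≤ ENNReal.ofReal (r ^ p) * ENNReal.ofReal (K / r ^ p) := by gcongr
    _ = _ := by rw [← ENNReal.ofReal_mul q1.le]; congr 1; field_simp

lemma wt_eq {ρ q σ : ℝ} {j : ℕ} (hρ : 0 < ρ) (h : q + σ = j) : ρ ^ σ / ρ ^ j = 1 / ρ ^ q := by
  have : ρ ^ q * ρ ^ σ = ρ ^ j := by rw [← Real.rpow_add hρ, h, Real.rpow_natCast]
  have q1 : 0 < ρ ^ q := by positivity
  rw [← this]; field_simp

/-- Weighted Schauder a priori estimate with homogeneous boundary data. -/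
theorem weighted_schauder_estimate
    (n : ℕ) (hn : 3 ≤ n) (ψ : ℝ → ℝ) (T : ℝ) (hψ : IsStdRadial n ψ T)
    (α : ℝ) (hα : α ∈ Set.Ioo (0 : ℝ) 1) (μ : ℝ) (hμ : 0 < μ) :
    ∃ C > (0 : ℝ), ∀ r₀ : ℝ, 0 < r₀ → r₀ ≤ 1 →
      ∀ W : E n → ℝ, ContDiffOn ℝ 2 W {x : E n | 0 < ‖x‖ ∧ ‖x‖ ≤ r₀} →
        weightedNka n 2 α μ (((n : ℝ) - 2) / 2) r₀ W ≠ ⊤ →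
        (∀ x : E n, ‖x‖ = r₀ → W x = 0) →
        weightedNka n 0 α μ (((n : ℝ) + 2) / 2) r₀ (linYamabe n ψ W) ≠ ⊤ →
        weightedNka n 2 α μ (((n : ℝ) - 2) / 2) r₀ W ≤
          ENNReal.ofReal C *
            ((⨆ (x : E n) (_ : 0 < ‖x‖ ∧ ‖x‖ ≤ r₀),
                ENNReal.ofReal (‖x‖ ^ (((n : ℝ) - 2) / 2 - μ) * |W x|)) +
              weightedNka n 0 α μ (((n : ℝ) + 2) / 2) r₀ (linYamabe n ψ W)) := by
  obtain ⟨hα0, hα1⟩ := hα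
  obtain ⟨c, hc, hV1, hV2⟩ := pot hn hψ
  set σ := μ - ((n : ℝ) - 2) / 2 with hσ
  obtain ⟨C, hC, hcore⟩ := coreC (n := n) (by lia) hα0 hα1 σ hc
  set p := 2 + α - σ with hp
  set e := Real.exp 1 with he
  have e0 : 0 < e := Real.exp_pos 1
  have e2 : 2 ≤ e := by linarith [Real.add_one_le_exp (1:ℝ)]
  have e3 : e < 3 := by linarith [Real.exp_one_lt_d9]
  have k1 := kk_ge σ
  have ep : 0 < e ^ p := by positivity
  have fp : 0 < (4:ℝ) ^ |p| := by positivity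
  refine ⟨1 + C * (1 + e ^ p) * (2 + 4 ^ |p| + 2 * kk σ), by positivity, fun r₀ hr hr1 W hcd hfin hbd hF => ?_⟩
  set S := ⨆ (x : E n) (_ : 0 < ‖x‖ ∧ ‖x‖ ≤ r₀), ENNReal.ofReal (‖x‖ ^ (((n : ℝ) - 2) / 2 - μ) * |W x|) with hS
  set NF := weightedNka n 0 α μ (((n : ℝ) + 2) / 2) r₀ (linYamabe n ψ W) with hNF
  have S_eq : (⨆ (x : E n) (_ : 0 < ‖x‖ ∧ ‖x‖ ≤ r₀),
      ENNReal.ofReal (‖x‖ ^ (((n : ℝ) - 2) / 2 + ((0:ℕ) : ℝ) - μ) * ‖iteratedFDeriv ℝ 0 W x‖)) = S := by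
    simp only [hS, norm_iteratedFDeriv_zero, Nat.cast_zero, add_zero, Real.norm_eq_abs]
  have S_fin : S ≠ ⊤ := by
    refine ne_top_of_le_ne_top hfin ?_
    rw [weightedNka, weightedNk, Finset.sum_range_succ, Finset.sum_range_succ, Finset.sum_range_one, S_eq]
    exact (le_self_add.trans le_self_add).trans le_self_add
  have pe : ∀ x : E n, 0 < ‖x‖ → ‖x‖ ^ σ / ‖x‖ ^ 2 / ‖x‖ ^ α = 1 / ‖x‖ ^ p := fun x hx => by
    rw [wt_eq (q := 2 - σ) hx (by push_cast; ring), div_div, ← Real.rpow_add hx]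
    congr 2; rw [hp]; ring
  set A0 := S.toReal with hA0
  set Nf := NF.toReal with hNf
  set Nw := (weightedNka n 2 α μ (((n : ℝ) - 2) / 2) r₀ W).toReal with hNw
  have A00 : 0 ≤ A0 := ENNReal.toReal_nonneg
  have Nf0 : 0 ≤ Nf := ENNReal.toReal_nonneg
  have Nw0 : 0 ≤ Nw := ENNReal.toReal_nonneg
  have hA : ∀ x : E n, 0 < ‖x‖ → ‖x‖ ≤ r₀ → |W x| ≤ A0 * ‖x‖ ^ σ := by
    intro x h1 h2
    have : ENNReal.ofReal (‖x‖ ^ (((n : ℝ) - 2) / 2 - μ) * |W x|) ≤ S :=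
      le_iSup₂ (f := fun (x : E n) (_ : 0 < ‖x‖ ∧ ‖x‖ ≤ r₀) =>
        ENNReal.ofReal (‖x‖ ^ (((n : ℝ) - 2) / 2 - μ) * |W x|)) x ⟨h1, h2⟩
    rw [← ENNReal.ofReal_toReal S_fin, ENNReal.ofReal_le_ofReal_iff A00] at this
    have e1 : ((n : ℝ) - 2) / 2 - μ = -σ := by rw [hσ]; ring
    rw [e1, Real.rpow_neg h1.le] at this
    have q : 0 < ‖x‖ ^ σ := by positivity
    rw [inv_mul_le_iff₀ q] at this
    linarith
  have hFp : ∀ x y : E n, ‖x‖ ≤ r₀ → 0 < ‖y‖ → ‖y‖ ≤ ‖x‖ → ‖x‖ ≤ 4 * ‖y‖ →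
      |linYamabe n ψ W x - linYamabe n ψ W y| ≤ Nf * e ^ p * (‖x‖ ^ σ / ‖x‖ ^ 2 / ‖x‖ ^ α) * ‖x - y‖ ^ α := by
    intro x y h1 h2 h3 h4
    refine (iter0_sub _ x y).trans ?_
    rw [pe x (by linarith), mul_one_div]
    refine semi_pair (r₀ := r₀) hα0 Nf0 ?_ h1 h2 h3 h4
    rw [hNf, ENNReal.ofReal_toReal hF, hNF, weightedNka]
    have e1 : ((n : ℝ) + 2) / 2 + ((0:ℕ):ℝ) + α - μ = p := by rw [hp, hσ]; push_cast; ring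
    rw [e1]
    exact le_add_self
  have hWp : ∀ x y : E n, ‖x‖ ≤ r₀ → 0 < ‖y‖ → ‖y‖ ≤ ‖x‖ → ‖x‖ ≤ 4 * ‖y‖ →
      ‖D2 W x - D2 W y‖ ≤ Nw * e ^ p * (‖x‖ ^ σ / ‖x‖ ^ 2 / ‖x‖ ^ α) * ‖x - y‖ ^ α := by
    intro x y h1 h2 h3 h4
    refine (le_iter2_sub W x y).trans ?_
    rw [pe x (by linarith), mul_one_div]
    refine semi_pair (r₀ := r₀) hα0 Nw0 ?_ h1 h2 h3 h4
    rw [hNw, ENNReal.ofReal_toReal hfin, weightedNka]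
    have e1 : ((n : ℝ) - 2) / 2 + ((2:ℕ):ℝ) + α - μ = p := by rw [hp, hσ]; push_cast; ring
    rw [e1]
    exact le_add_self
  have D : Dat r₀ σ α A0 (Nf * e ^ p) c (Vp n ψ) W :=
    ⟨A00, by positivity, hc, hcd.mono fun x hx => ⟨hx.1, hx.2.le⟩, hcd.continuousOn, hbd,
      fun x hx => hA x hx.1 hx.2.le, fun x hx y hy h1 h2 => hFp x y hx.2.le hy.1 h1 h2,
      fun x hx => hV1 x hx.1, fun x hx y hy h1 h2 => hV2 x y hx.1 hy.1 h1 h2⟩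
  obtain ⟨P, I⟩ := hcore r₀ A0 (Nf * e ^ p) (Nw * e ^ p) (Vp n ψ) W hr D (by positivity) hWp
  set M := C * (A0 + Nf * e ^ p) with hM
  have M0 : 0 ≤ M := by positivity
  have t1 : (⨆ (x : E n) (_ : 0 < ‖x‖ ∧ ‖x‖ ≤ r₀),
      ENNReal.ofReal (‖x‖ ^ (((n : ℝ) - 2) / 2 + ((1:ℕ) : ℝ) - μ) * ‖iteratedFDeriv ℝ 1 W x‖)) ≤ ENNReal.ofReal M := by
    refine iSup₂_le fun x hx => ENNReal.ofReal_le_ofReal ?_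
    rw [norm_iteratedFDeriv_one]
    have := (I x hx.1 hx.2).2
    have w := wt_eq (ρ := ‖x‖) (q := ((n : ℝ) - 2) / 2 + ((1:ℕ) : ℝ) - μ) (σ := σ) (j := 1) hx.1 (by rw [hσ]; ring)
    rw [pow_one] at w
    have q : 0 < ‖x‖ ^ (((n : ℝ) - 2) / 2 + ((1:ℕ) : ℝ) - μ) := Real.rpow_pos_of_pos hx.1 _
    rw [w, mul_one_div, le_div_iff₀ q] at this
    linarith
  have t2 : (⨆ (x : E n) (_ : 0 < ‖x‖ ∧ ‖x‖ ≤ r₀),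
      ENNReal.ofReal (‖x‖ ^ (((n : ℝ) - 2) / 2 + ((2:ℕ) : ℝ) - μ) * ‖iteratedFDeriv ℝ 2 W x‖)) ≤ ENNReal.ofReal M := by
    refine iSup₂_le fun x hx => ENNReal.ofReal_le_ofReal ?_
    have := (iter2_le W x).trans (I x hx.1 hx.2).1
    have w := wt_eq (ρ := ‖x‖) (q := ((n : ℝ) - 2) / 2 + ((2:ℕ) : ℝ) - μ) (σ := σ) (j := 2) hx.1 (by rw [hσ]; ring)
    have q : 0 < ‖x‖ ^ (((n : ℝ) - 2) / 2 + ((2:ℕ) : ℝ) - μ) := Real.rpow_pos_of_pos hx.1 _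
    rw [w, mul_one_div, le_div_iff₀ q] at this
    linarith
  have t3 : (⨆ (r : ℝ) (_ : 0 < r ∧ r ≤ r₀ / e), ENNReal.ofReal (r ^ (((n : ℝ) - 2) / 2 + ((2:ℕ) : ℝ) + α - μ)) *
        holderSemi α {x : E n | r / e ≤ ‖x‖ ∧ ‖x‖ ≤ e * r} (iteratedFDeriv ℝ 2 W)) ≤
        ENNReal.ofReal ((4 ^ |p| + 2 * kk σ) * M) := by
    have e1 : ((n : ℝ) - 2) / 2 + ((2:ℕ):ℝ) + α - μ = p := by rw [hp, hσ]; push_cast; ring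
    rw [e1]
    have key : ∀ (r : ℝ) (x y : E n), 0 < r → r ≤ r₀ / e → r / e ≤ ‖x‖ → ‖x‖ ≤ e * r →
        r / e ≤ ‖y‖ → ‖y‖ ≤ e * r → ‖y‖ ≤ ‖x‖ → ‖D2 W x - D2 W y‖ ≤ (4 ^ |p| + 2 * kk σ) * M / r ^ p * ‖x - y‖ ^ α := by
      intro r x y h0 h1 x1 x2 y1 y2 hyx
      have rr : r / 3 ≤ r / e := by gcongr
      have re : e * r ≤ 3 * r := by gcongr
      have y0 : 0 < ‖y‖ := by linarith
      have x0 : 0 < ‖x‖ := by linarith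
      have xr : ‖x‖ ≤ r₀ := by
        rw [le_div_iff₀ e0] at h1; linarith
      have rp : 0 < r ^ p := by positivity
      have add : ∀ a b : ℝ, (a + b) * M / r ^ p * ‖x - y‖ ^ α = a * M / r ^ p * ‖x - y‖ ^ α + b * M / r ^ p * ‖x - y‖ ^ α := by
        intro a b; ring
      rw [add]
      have p1 : 0 ≤ 4 ^ |p| * M / r ^ p * ‖x - y‖ ^ α := by positivity
      have p2 : 0 ≤ 2 * kk σ * M / r ^ p * ‖x - y‖ ^ α := by positivity
      by_cases h4 : ‖x‖ ≤ 4 * ‖y‖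
      · have := P x y xr y0 hyx h4
        rw [pe x x0] at this
        have w := wt0 (σ := p) (ρ := ‖x‖) (s := r) x0 (by linarith) (by linarith)
        have q : 0 < ‖x‖ ^ p := by positivity
        have : M * (1 / ‖x‖ ^ p) * ‖x - y‖ ^ α ≤ 4 ^ |p| * M / r ^ p * ‖x - y‖ ^ α := by
          gcongr ?_ * _
          rw [mul_one_div, div_le_div_iff₀ q rp]
          calc M * r ^ p ≤ M * (4 ^ |p| * ‖x‖ ^ p) := by gcongr
            _ = _ := by ring
        linarith
      · push Not at h4
        have d : r ≤ ‖x - y‖ := by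
          have := norm_sub_norm_le x y
          linarith
        have dα : r ^ α ≤ ‖x - y‖ ^ α := Real.rpow_le_rpow h0.le d hα0.le
        have b : ∀ z : E n, ‖z‖ ≤ r₀ → r / e ≤ ‖z‖ → ‖z‖ ≤ e * r → ‖D2 W z‖ ≤ kk σ * M / r ^ p * ‖x - y‖ ^ α := by
          intro z z0 z1 z2
          have w := (wts (σ := σ) hα0 hα1 h0 (s := ‖z‖) (by linarith) (by linarith)).2.2.1
          have rw' : r ^ σ / r ^ 2 = r ^ α / r ^ p := by
            rw [wt_eq (q := 2 - σ) h0 (by push_cast; ring), hp, show 2 + α - σ = α + (2 - σ) by ring, Real.rpow_add h0]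
            have : 0 < r ^ α := by positivity
            have : 0 < r ^ (2 - σ) := by positivity
            field_simp
          calc _ ≤ M * (‖z‖ ^ σ / ‖z‖ ^ 2) := (I z (by linarith) z0).1
            _ ≤ M * (kk σ * (r ^ α / r ^ p)) := by rw [← rw']; gcongr
            _ = kk σ * M / r ^ p * r ^ α := by ring
            _ ≤ _ := by gcongr
        have bx := b x xr x1 x2
        have bby := b y (hyx.trans xr) y1 y2
        have := norm_sub_le (D2 W x) (D2 W y)
        have e5 : 2 * kk σ * M / r ^ p * ‖x - y‖ ^ α = kk σ * M / r ^ p * ‖x - y‖ ^ α + kk σ * M / r ^ p * ‖x - y‖ ^ α := by ring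
        linarith
    refine semi_le fun r x y h0 h1 x1 x2 y1 y2 _ => ?_
    rcases le_total ‖y‖ ‖x‖ with h | h
    · exact (iter2_sub_le W x y).trans (key r x y h0 h1 x1 x2 y1 y2 h)
    · rw [norm_sub_rev, norm_sub_rev x]
      exact (iter2_sub_le W y x).trans (key r y x h0 h1 y1 y2 x1 x2 h)
  rw [weightedNka, weightedNk, Finset.sum_range_succ, Finset.sum_range_succ, Finset.sum_range_one, S_eq]
  have fin : S + ENNReal.ofReal M + ENNReal.ofReal M + ENNReal.ofReal ((4 ^ |p| + 2 * kk σ) * M) ≤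
      ENNReal.ofReal (1 + C * (1 + e ^ p) * (2 + 4 ^ |p| + 2 * kk σ)) * (S + NF) := by
    rw [← ENNReal.ofReal_toReal S_fin, ← ENNReal.ofReal_toReal hF, ← hA0, ← hNf,
      ← ENNReal.ofReal_add A00 M0, ← ENNReal.ofReal_add (by positivity) M0, ← ENNReal.ofReal_add (by positivity) (by positivity),
      ← ENNReal.ofReal_add A00 Nf0, ← ENNReal.ofReal_mul (by positivity)]
    apply ENNReal.ofReal_le_ofReal
    have m1 : M ≤ C * (1 + e ^ p) * (A0 + Nf) := by
      have : C * (1 + e ^ p) * (A0 + Nf) = M + C * (A0 * e ^ p + Nf) := by rw [hM]; ring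
      have : 0 ≤ C * (A0 * e ^ p + Nf) := by positivity
      linarith
    calc A0 + M + M + (4 ^ |p| + 2 * kk σ) * M = A0 + (2 + 4 ^ |p| + 2 * kk σ) * M := by ring
      _ ≤ (A0 + Nf) + (2 + 4 ^ |p| + 2 * kk σ) * (C * (1 + e ^ p) * (A0 + Nf)) := by gcongr; linarith
      _ = _ := by ring
  exact (add_le_add (add_le_add (add_le_add le_rfl t1) t2) t3).trans fin
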